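/- Let D be a domain in ℂⁿ and let a₁,…,a_m : D → ℂ be continuous functions. Define 𝓔 = {(z,w) ∈ D × ℂ : wᵐ + a₁(z)w^{m−1} + ⋯ + a_m(z) = 0}. Then 𝓔 is a pluripolar subset of ℂ^{n+1} if and only if the functions a₁,…,a_m are holomorphic on D. -/

import Mathlib

open Metric Set Polynomial

noncomputable section

/-- A function `u : ℂ → EReal` is subharmonic on an open set `U` if it is upper
semicontinuous on `U` and satisfies the maximum principle with respect to harmonic
majorants of the form `Re p`, `p` a complex polynomial, on every closed disc in `U`. -/
def SubharmonicOn (u : ℂ → EReal) (U : Set ℂ) : Prop :=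
  UpperSemicontinuousOn u U ∧
    ∀ (c : ℂ) (r : ℝ), 0 < r → closedBall c r ⊆ U →
      ∀ p : Polynomial ℂ,
        (∀ z ∈ sphere c r, u z ≤ (((p.eval z).re : ℝ) : EReal)) →
        ∀ z ∈ closedBall c r, u z ≤ (((p.eval z).re : ℝ) : EReal)

/-- `u : ℂ^N → [-∞, ∞)` is plurisubharmonic if it is upper semicontinuous, takes values
in `[-∞, ∞)`, and its restriction to every complex affine line is subharmonic. -/
def Plurisubharmonic {N : ℕ} (u : (Fin N → ℂ) → EReal) : Prop :=
  UpperSemicontinuous u ∧ (∀ z, u z ≠ ⊤) ∧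
    ∀ a b : Fin N → ℂ, SubharmonicOn (fun t : ℂ => u (a + t • b)) Set.univ

/-- A set `E ⊆ ℂ^N` is pluripolar if there is a plurisubharmonic function on `ℂ^N`,
not identically `-∞`, which is `-∞` on `E`. -/
def Pluripolar {N : ℕ} (E : Set (Fin N → ℂ)) : Prop :=
  ∃ u : (Fin N → ℂ) → EReal,
    Plurisubharmonic u ∧ ¬ (∀ z, u z = ⊥) ∧ ∀ z ∈ E, u z = ⊥


namespace Shch
open Filter Topology

/-- quadratic disc through `x` -/
def qd (x b c : ℂ × ℂ) (τ : ℂ) : ℂ × ℂ := x + τ • b + τ ^ 2 • c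

lemma qd_zero (x b c : ℂ × ℂ) : qd x b c 0 = x := by simp [qd]

lemma continuous_qd (b c : ℂ × ℂ) : Continuous (fun p : (ℂ × ℂ) × ℂ => qd p.1 b c p.2) := by
  unfold qd; fun_prop

structure Good (v : ℂ × ℂ → ℝ) : Prop where
  cont : Continuous v
  disc : ∀ x, ∃ b c : ℂ × ℂ, ∃ r0 > (0:ℝ), ∀ τ : ℂ, τ ≠ 0 → ‖τ‖ ≤ r0 → v x < v (qd x b c τ)
  maxp : ∀ (y b c : ℂ × ℂ) (Ω : Set ℂ) (t : ℝ), IsOpen Ω → Bornology.IsBounded Ω →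
    (∀ τ ∈ frontier Ω, v (qd y b c τ) ≤ t) → ∀ τ ∈ Ω, v (qd y b c τ) ≤ t

lemma good_max {v w : ℂ × ℂ → ℝ} (hv : Good v) (hw : Good w) : Good (fun x => max (v x) (w x)) where
  cont := hv.cont.max hw.cont
  disc := by
    intro x
    rcases le_total (v x) (w x) with h | h
    · obtain ⟨b, c, r0, hr0, H⟩ := hw.disc x
      refine ⟨b, c, r0, hr0, fun τ h1 h2 => ?_⟩
      simp only [max_eq_right h]
      exact lt_max_of_lt_right (H τ h1 h2)
    · obtain ⟨b, c, r0, hr0, H⟩ := hv.disc x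
      refine ⟨b, c, r0, hr0, fun τ h1 h2 => ?_⟩
      simp only [max_eq_left h]
      exact lt_max_of_lt_left (H τ h1 h2)
  maxp := by
    intro y b c Ω t h1 h2 h3 τ hτ
    exact max_le (hv.maxp y b c Ω t h1 h2 (fun τ h => (le_max_left _ _).trans (h3 τ h)) τ hτ)
      (hw.maxp y b c Ω t h1 h2 (fun τ h => (le_max_right _ _).trans (h3 τ h)) τ hτ)

/-- Values in `2πiℤ` : two such within distance 1 are equal. -/
lemma eq_of_exp_eq_of_dist {a b : ℂ} (h : Complex.exp a = Complex.exp b) (hd : dist a b < 1) :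
    a = b := by
  rw [Complex.exp_eq_exp_iff_exists_int] at h
  obtain ⟨n, hn⟩ := h
  have h1 : a - b = n * (2 * Real.pi * Complex.I) := by rw [hn]; ring
  rw [dist_eq_norm, h1] at hd
  have h2 : ‖(n:ℂ) * (2 * Real.pi * Complex.I)‖ = |(n:ℝ)| * (2 * Real.pi) := by
    simp [abs_of_pos Real.pi_pos]
  rw [h2] at hd
  have h3 : |(n:ℝ)| < 1 := by
    by_contra hc
    push Not at hc
    nlinarith [Real.pi_gt_three]
  have h4 : n = 0 := by
    have : |n| < 1 := by exact_mod_cast h3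
    exact Int.abs_lt_one_iff.1 this
  subst h4
  simpa [sub_eq_zero] using h1

/-- propagation principle -/
lemma Good.propagate {v : ℂ × ℂ → ℝ} (hv : Good v) {t : ℝ} {A V : Set (ℂ × ℂ)}
    (hA : ∀ x ∈ V, t < v x → ∃ U ∈ 𝓝 x, ∀ y ∈ U, y ∈ V → t < v y → (y ∈ A ↔ x ∈ A))
    (y b c : ℂ × ℂ) (S : Set ℂ) (hSo : IsOpen S) (hSb : Bornology.IsBounded S)
    (hV : ∀ τ ∈ closure S, qd y b c τ ∈ V)
    (h0 : (0:ℂ) ∈ S) (hy : t < v y) (hyA : y ∈ A) :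
    ∃ τ ∈ frontier S, t < v (qd y b c τ) ∧ qd y b c τ ∈ A := by
  by_contra hcon
  push Not at hcon
  have hcq : Continuous (qd y b c) := by unfold qd; fun_prop
  set Ω : Set ℂ := {τ | τ ∈ S ∧ t < v (qd y b c τ) ∧ qd y b c τ ∈ A}
  have hΩo : IsOpen Ω := by
    rw [isOpen_iff_mem_nhds]
    rintro τ ⟨h1, h2, h3⟩
    obtain ⟨U, hU, hUA⟩ := hA _ (hV _ (subset_closure h1)) h2
    have e1 : ∀ᶠ σ in 𝓝 τ, t < v (qd y b c σ) :=
      (hv.cont.comp hcq).continuousAt.eventually (lt_mem_nhds h2)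
    filter_upwards [hSo.mem_nhds h1, e1, hcq.continuousAt hU] with σ a1 a2 a3
    exact ⟨a1, a2, (hUA _ a3 (hV _ (subset_closure a1)) a2).2 h3⟩
  have hΩS : Ω ⊆ S := fun τ h => h.1
  have := hv.maxp y b c Ω t hΩo (hSb.subset hΩS) ?_ 0 ?_
  · rw [qd_zero] at this; linarith
  · intro τ hτ
    by_contra hlt
    push Not at hlt
    have hτn : τ ∉ Ω := fun h => by
      rw [hΩo.frontier_eq] at hτ; exact hτ.2 h
    have hτc : τ ∈ closure Ω := frontier_subset_closure hτ
    have hτA : qd y b c τ ∈ A := by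
      obtain ⟨U, hU, hUA⟩ := hA _ (hV _ (closure_mono hΩS hτc)) hlt
      have := hcq.continuousAt hU
      obtain ⟨σ, hσ1, hσ2⟩ := mem_closure_iff_nhds.1 hτc _ this
      exact (hUA _ hσ1 (hV _ (subset_closure hσ2.1)) hσ2.2.1).1 hσ2.2.2
    have hτS : τ ∉ S := fun h => hτn ⟨h, hlt, hτA⟩
    have : τ ∈ frontier S := by
      rw [hSo.frontier_eq]; exact ⟨closure_mono hΩS hτc, hτS⟩
    exact hcon τ this hlt hτA
  · exact ⟨h0, by rwa [qd_zero], by rwa [qd_zero]⟩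

lemma eq_of_locally_eq {X Y : Type*} [TopologicalSpace X] {S : Set X} (hS : IsPreconnected S)
    {f : X → Y} (hf : ∀ p ∈ S, ∃ U ∈ 𝓝 p, ∀ q ∈ U, q ∈ S → f q = f p) {p q : X} (hp : p ∈ S)
    (hq : q ∈ S) : f p = f q := by
  have : PreconnectedSpace S := isPreconnected_iff_preconnectedSpace.1 hS
  have h1 : IsLocallyConstant (fun x : S => f x) := by
    rw [IsLocallyConstant.iff_eventually_eq]
    rintro ⟨x, hx⟩
    obtain ⟨U, hU, H⟩ := hf x hx
    have : ∀ᶠ y : S in 𝓝 ⟨x, hx⟩, (y : X) ∈ U := continuous_subtype_val.continuousAt hU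
    filter_upwards [this] with y hy
    exact H y hy y.2
  exact h1.apply_eq_of_preconnectedSpace ⟨p, hp⟩ ⟨q, hq⟩

/-- two logs agreeing far away agree -/
lemma Good.unique {v : ℂ × ℂ → ℝ} (hv : Good v) {t t1 : ℝ}
    (hprop : Bornology.IsBounded {x | v x ≤ t1}) {θ θ' : ℂ × ℂ → ℂ}
    (hθ : ContinuousOn θ {x | t < v x}) (hθ' : ContinuousOn θ' {x | t < v x})
    (he : ∀ x, t < v x → Complex.exp (θ x) = Complex.exp (θ' x))
    (hf : ∀ x, t1 < v x → θ x = θ' x) : ∀ x, t < v x → θ x = θ' x := by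
  intro x hx
  by_contra hne
  have hop : IsOpen {x | t < v x} := isOpen_lt continuous_const hv.cont
  have key : ∀ y, t < v y → ∀ᶠ z in 𝓝 y, dist (θ z - θ' z) (θ y - θ' y) < 1 := by
    intro y hy
    have h1 := ((hθ.continuousAt (hop.mem_nhds hy)).sub (hθ'.continuousAt (hop.mem_nhds hy)))
    exact h1.eventually (ball_mem_nhds _ one_pos)
  have key2 : ∀ y, t < v y → ∃ U ∈ 𝓝 y, ∀ z ∈ U, t < v z → θ z - θ' z = θ y - θ' y := by
    intro y hy
    refine ⟨_, key y hy, fun z hz hzt => eq_of_exp_eq_of_dist ?_ hz⟩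
    rw [Complex.exp_sub, Complex.exp_sub, he z hzt, he y hy,
      div_self (Complex.exp_ne_zero _), div_self (Complex.exp_ne_zero _)]
  obtain ⟨ρ, hρ⟩ := hprop.subset_ball x
  have hS : (0:ℂ) ∈ ball (0:ℂ) (|ρ| + 1) := by simp; positivity
  obtain ⟨τ, hτ, h1, h2⟩ := hv.propagate (t := t) (A := {y | θ y ≠ θ' y}) (V := univ) (by
      intro y _ hyt
      obtain ⟨U, hU, H⟩ := key2 y hyt
      refine ⟨U, hU, fun z hz _ hzt => ?_⟩
      have := H z hz hzt
      show θ z ≠ θ' z ↔ θ y ≠ θ' y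
      rw [← sub_ne_zero, this, sub_ne_zero]) x (1, 0) 0
    (ball 0 (|ρ| + 1)) isOpen_ball isBounded_ball (fun _ _ => mem_univ _) hS hx hne
  · apply h2
    apply hf
    by_contra hle
    push Not at hle
    have h3 := hρ (show _ ∈ {x | v x ≤ t1} from hle)
    rw [frontier_ball _ (by positivity)] at hτ
    simp only [mem_ball, dist_eq_norm, qd, smul_zero, add_zero, add_sub_cancel_left] at h3
    have : ‖τ‖ = |ρ| + 1 := by simpa using hτ
    rw [norm_smul, this] at h3
    simp at h3
    linarith [le_abs_self ρ]

/-- local extension -/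
lemma Good.local_ext {v : ℂ × ℂ → ℝ} (hv : Good v) {t : ℝ} (ht : 0 < t)
    {Θ θ : ℂ × ℂ → ℂ} (hΘ : ContinuousOn Θ {x | 0 < v x}) (hΘ0 : ∀ x, 0 < v x → Θ x ≠ 0)
    (hθ : ContinuousOn θ {x | t < v x})
    (he : ∀ x, t < v x → Complex.exp (θ x) = Θ x) {x : ℂ × ℂ} (hx : v x = t) :
    x ∈ closure {x | t < v x} ∧ ∃ y, Tendsto θ (𝓝[{x | t < v x}] x) (𝓝 y) := by
  have hop : IsOpen {x | t < v x} := isOpen_lt continuous_const hv.cont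
  have hop0 : IsOpen {x | 0 < v x} := isOpen_lt continuous_const hv.cont
  have hx0 : 0 < v x := by linarith
  obtain ⟨b, c, r0, hr0, hd⟩ := hv.disc x
  have hcq : Continuous (qd x b c) := by unfold qd; fun_prop
  -- local logarithm
  have hΘx := hΘ.continuousAt (hop0.mem_nhds hx0)
  set lg : ℂ × ℂ → ℂ := fun y => Complex.log (Θ x) + Complex.log (Θ y / Θ x) with hlg
  have e1 : ∀ᶠ y in 𝓝 x, ‖Θ y / Θ x - 1‖ < 1 := by
    have : Tendsto (fun y => ‖Θ y / Θ x - 1‖) (𝓝 x) (𝓝 ‖Θ x / Θ x - 1‖) :=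
      ((hΘx.div_const _).sub continuousAt_const).norm
    rw [div_self (hΘ0 x hx0), sub_self, norm_zero] at this
    exact this.eventually (gt_mem_nhds one_pos)
  have e2 : ∀ᶠ y in 𝓝 x, 0 < v y := hop0.mem_nhds hx0
  obtain ⟨ε, hε, hU⟩ := Metric.eventually_nhds_iff_ball.1 (e1.and e2)
  have hslit : ∀ y ∈ ball x ε, Θ y / Θ x ∈ Complex.slitPlane := by
    intro y hy
    have := (hU y hy).1
    have h := Complex.mem_slitPlane_of_norm_lt_one this
    simpa using h
  have hlgc : ∀ y ∈ ball x ε, ContinuousAt lg y := by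
    intro y hy
    refine continuousAt_const.add (ContinuousAt.clog ?_ (hslit y hy))
    exact (hΘ.continuousAt (hop0.mem_nhds (hU y hy).2)).div_const _
  have hlge : ∀ y ∈ ball x ε, Complex.exp (lg y) = Θ y := by
    intro y hy
    have h0 := hΘ0 x hx0
    have h1 := hΘ0 y (hU y hy).2
    rw [hlg]; simp only
    rw [Complex.exp_add, Complex.exp_log h0, Complex.exp_log (div_ne_zero h1 h0)]
    field_simp
  -- locally constant difference
  have key : ∀ y ∈ ball x ε, t < v y → ∃ U ∈ 𝓝 y, ∀ z ∈ U, z ∈ ball x ε → t < v z →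
      θ z - lg z = θ y - lg y := by
    intro y hy hyt
    have h1 := ((hθ.continuousAt (hop.mem_nhds hyt)).sub (hlgc y hy))
    refine ⟨_, h1 (ball_mem_nhds _ one_pos), fun z hz hzb hzt => eq_of_exp_eq_of_dist ?_ hz⟩
    rw [Complex.exp_sub, Complex.exp_sub, he z hzt, he y hyt, hlge y hy, hlge z hzb,
      div_self (hΘ0 _ (hU y hy).2), div_self (hΘ0 _ (hU z hzb).2)]
  -- choose radius
  obtain ⟨r1, hr1, hr1U⟩ : ∃ r1 > 0, ∀ τ : ℂ, ‖τ‖ ≤ r1 → qd x b c τ ∈ ball x (ε / 2) := by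
    have : Tendsto (qd x b c) (𝓝 0) (𝓝 x) := by
      have := hcq.tendsto 0; rwa [qd_zero] at this
    have := this (ball_mem_nhds x (half_pos hε))
    obtain ⟨r, hr, h⟩ := Metric.nhds_basis_closedBall.mem_iff.1 this
    exact ⟨r, hr, fun τ hτ => h (by simpa using hτ)⟩
  set r := min r0 r1 with hr
  have hrpos : 0 < r := lt_min hr0 hr1
  -- epsilon
  have hcomp : IsCompact (sphere (0:ℂ) r) := isCompact_sphere _ _
  obtain ⟨δ, hδ, hδv⟩ : ∃ δ > 0, ∀ s ∈ ball (0 : ℂ × ℂ) δ, ∀ τ ∈ sphere (0:ℂ) r,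
      t < v (qd (x + s) b c τ) := by
    have hc2 : Continuous (fun p : (ℂ × ℂ) × ℂ => v (qd (x + p.1) b c p.2)) := by
      refine hv.cont.comp ?_
      unfold qd; fun_prop
    have hopen : IsOpen {p : (ℂ × ℂ) × ℂ | t < v (qd (x + p.1) b c p.2)} :=
      isOpen_lt continuous_const hc2
    have hsub : ({0} : Set (ℂ × ℂ)) ×ˢ sphere (0:ℂ) r ⊆
        {p : (ℂ × ℂ) × ℂ | t < v (qd (x + p.1) b c p.2)} := by
      rintro ⟨s, τ⟩ ⟨h1, h2⟩
      simp only [mem_singleton_iff] at h1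
      subst h1
      have hn : ‖τ‖ = r := by simpa using h2
      simp only [mem_ofPred_eq, add_zero]
      rw [← hx]
      refine hd τ ?_ (by rw [hn]; exact min_le_left _ _)
      rw [← norm_pos_iff, hn]; exact hrpos
    obtain ⟨u, w, hu, hw, h1, h2, h3⟩ := generalized_tube_lemma isCompact_singleton hcomp hopen hsub
    obtain ⟨δ, hδ, hb⟩ := Metric.isOpen_iff.1 hu 0 (h1 rfl)
    exact ⟨δ, hδ, fun s hs τ hτ => h3 (Set.mk_mem_prod (hb hs) (h2 hτ))⟩
  set δ' := min δ (ε / 2) with hδ'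
  have hδ'pos : 0 < δ' := lt_min hδ (half_pos hε)
  have hmem : ∀ s ∈ ball (0 : ℂ × ℂ) δ', ∀ τ : ℂ, ‖τ‖ ≤ r → qd (x + s) b c τ ∈ ball x ε := by
    intro s hs τ hτ
    have h1 := hr1U τ (hτ.trans (min_le_right _ _))
    have h2 : qd (x + s) b c τ = qd x b c τ + s := by unfold qd; ring
    rw [h2, mem_ball, dist_eq_norm]
    rw [mem_ball, dist_eq_norm] at h1
    have h3 : ‖s‖ < ε / 2 := by
      have : ‖s‖ < δ' := by simpa using hs
      exact this.trans_le (min_le_right _ _)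
    calc ‖qd x b c τ + s - x‖ = ‖(qd x b c τ - x) + s‖ := by congr 1; ring
      _ ≤ ‖qd x b c τ - x‖ + ‖s‖ := norm_add_le _ _
      _ < ε := by linarith
  -- constancy on boundary
  set Φ : (ℂ × ℂ) × ℂ → ℂ := fun p => θ (qd (x + p.1) b c p.2) - lg (qd (x + p.1) b c p.2)
  have hpre : IsPreconnected (ball (0 : ℂ × ℂ) δ' ×ˢ sphere (0:ℂ) r) := by
    refine IsPreconnected.prod (convex_ball _ _).isPreconnected ?_
    refine isPreconnected_sphere ?_ _ _
    rw [Complex.rank_real_complex]; norm_num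
  have hbd : ∀ s ∈ ball (0 : ℂ × ℂ) δ', ∀ τ ∈ sphere (0:ℂ) r, t < v (qd (x + s) b c τ) :=
    fun s hs τ hτ => hδv s (ball_subset_ball (min_le_left _ _) hs) τ hτ
  have hτ0 : (r : ℂ) ∈ sphere (0:ℂ) r := by simp [abs_of_pos hrpos]
  set k := Φ (0, (r:ℂ)) with hk
  have hconst : ∀ p ∈ ball (0 : ℂ × ℂ) δ' ×ˢ sphere (0:ℂ) r, Φ p = k := by
    intro p hp
    have hcx : Continuous (fun p : (ℂ × ℂ) × ℂ => qd (x + p.1) b c p.2) := by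
      unfold qd; fun_prop
    refine eq_of_locally_eq hpre (fun p hp => ?_) hp
      (Set.mk_mem_prod (by simpa using hδ'pos) hτ0)
    have hn : ∀ p ∈ ball (0 : ℂ × ℂ) δ' ×ˢ sphere (0:ℂ) r, qd (x + p.1) b c p.2 ∈ ball x ε :=
      fun p hp => hmem p.1 hp.1 p.2 (by have : ‖p.2‖ = r := by simpa using hp.2
                                        exact this.le)
    obtain ⟨U, hU, H⟩ := key _ (hn p hp) (hbd p.1 hp.1 p.2 hp.2)
    exact ⟨_, hcx.continuousAt hU, fun q hq hqS => H _ hq (hn q hqS) (hbd q.1 hqS.1 q.2 hqS.2)⟩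
  have hfin : ∀ y ∈ ball x δ', t < v y → θ y = lg y + k := by
    intro y hy hyt
    have hys : y - x ∈ ball (0 : ℂ × ℂ) δ' := by simpa [dist_eq_norm] using hy
    have hyy : x + (y - x) = y := by ring
    obtain ⟨τ, hτ, h1, h2⟩ := hv.propagate (t := t) (A := {z | θ z - lg z = θ y - lg y})
      (V := ball x ε) (by
        intro z hz hzt
        obtain ⟨U, hU, H⟩ := key z hz hzt
        refine ⟨U, hU, fun w hw hwb hwt => ?_⟩
        show θ w - lg w = θ y - lg y ↔ θ z - lg z = θ y - lg y
        rw [H w hw hwb hwt]) y b c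
      (ball 0 r) isOpen_ball isBounded_ball (by
        intro τ hτ
        have := hmem _ hys τ (by simpa using closure_ball_subset_closedBall hτ)
        rwa [hyy] at this) (by simpa using hrpos) hyt rfl
    · rw [frontier_ball _ hrpos.ne'] at hτ
      have h3 := hconst (y - x, τ) (Set.mk_mem_prod hys hτ)
      have h4 : θ (qd y b c τ) - lg (qd y b c τ) = θ y - lg y := h2
      simp only [Φ, hyy] at h3
      rw [h4] at h3
      rw [← h3]; ring
  refine ⟨?_, lg x + k, ?_⟩
  · rw [mem_closure_iff_nhds]
    intro U hU
    have h1 : Tendsto (fun s : ℝ => qd x b c (s:ℂ)) (𝓝[>] 0) (𝓝 x) := by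
      have := (hcq.comp Complex.continuous_ofReal).tendsto 0
      simp only [Function.comp, Complex.ofReal_zero, qd_zero] at this
      exact this.mono_left nhdsWithin_le_nhds
    have h2 : ∀ᶠ s : ℝ in 𝓝[>] 0, s ∈ Ioc 0 r0 := Ioc_mem_nhdsGT hr0
    have h1U : ∀ᶠ s : ℝ in 𝓝[>] 0, qd x b c (s:ℂ) ∈ U := h1.eventually hU
    obtain ⟨s, hs1, hs2⟩ := (h1U.and h2).exists
    refine ⟨_, hs1, ?_⟩
    have := hd s (by exact_mod_cast hs2.1.ne') (by simpa [abs_of_pos hs2.1] using hs2.2)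
    rw [hx] at this
    exact this
  · have h1 : Tendsto (fun y => lg y + k) (𝓝[{x | t < v x}] x) (𝓝 (lg x + k)) :=
      (((hlgc x (mem_ball_self hε)).add continuousAt_const).tendsto).mono_left nhdsWithin_le_nhds
    refine h1.congr' ?_
    filter_upwards [self_mem_nhdsWithin, mem_nhdsWithin_of_mem_nhds (ball_mem_nhds x hδ'pos)] with y h1 h2
    exact (hfin y h2 h1).symm

lemma Good.exists_log {v : ℂ × ℂ → ℝ} (hv : Good v) {t1 : ℝ} (ht1 : 0 < t1)
    (hprop : Bornology.IsBounded {x | v x ≤ t1})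
    {Θ : ℂ × ℂ → ℂ} (hΘ : ContinuousOn Θ {x | 0 < v x}) (hΘ0 : ∀ x, 0 < v x → Θ x ≠ 0)
    (hfar : ∀ x, t1 < v x → 0 < (Θ x).re) :
    ∃ θ : ℂ × ℂ → ℂ, ContinuousOn θ {x | 0 < v x} ∧ ∀ x, 0 < v x → Complex.exp (θ x) = Θ x := by
  have hop : ∀ t, IsOpen {x | t < v x} := fun t => isOpen_lt continuous_const hv.cont
  set T : Set ℝ := {t | 0 ≤ t ∧ t ≤ t1 ∧ ∃ θ : ℂ × ℂ → ℂ, ContinuousOn θ {x | t < v x} ∧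
    (∀ x, t < v x → Complex.exp (θ x) = Θ x) ∧ ∀ x, t1 < v x → θ x = Complex.log (Θ x)} with hT
  have hTt1 : t1 ∈ T := by
    refine ⟨ht1.le, le_rfl, fun x => Complex.log (Θ x), ?_, ?_, fun _ _ => rfl⟩
    · intro x hx
      have hx' : t1 < v x := hx
      refine ContinuousWithinAt.clog ?_ (Or.inl (hfar x hx))
      exact (hΘ x (ht1.trans hx')).mono (fun y hy => ht1.trans hy)
    · intro x hx
      exact Complex.exp_log (hΘ0 x (ht1.trans hx))
  have hbdd : BddBelow T := ⟨0, fun t ht => ht.1⟩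
  set ts := sInf T with hts
  have hts0 : 0 ≤ ts := le_csInf ⟨t1, hTt1⟩ fun t ht => ht.1
  have hts1 : ts ≤ t1 := csInf_le hbdd hTt1
  -- the infimum belongs to T
  have htsT : ts ∈ T := by
    have hex : ∀ x, ts < v x → ∃ t ∈ T, t < v x := fun x hx => exists_lt_of_csInf_lt ⟨t1, hTt1⟩ hx
    have hθ : ∀ t ∈ T, ∃ θ : ℂ × ℂ → ℂ, ContinuousOn θ {x | t < v x} ∧
      (∀ x, t < v x → Complex.exp (θ x) = Θ x) ∧ ∀ x, t1 < v x → θ x = Complex.log (Θ x) :=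
      fun t ht => ht.2.2
    choose! θ hθc hθe hθf using hθ
    choose! tt htT htv using hex
    have hag : ∀ t ∈ T, ∀ t' ∈ T, ∀ x, t < v x → t' < v x → θ t x = θ t' x := by
      intro t ht t' ht' x hx hx'
      refine hv.unique (t := max t t') hprop ((hθc t ht).mono ?_) ((hθc t' ht').mono ?_) ?_ ?_ x
        (max_lt hx hx')
      · intro y hy
        show t < v y
        exact lt_of_le_of_lt (le_max_left t t') hy
      · intro y hy
        show t' < v y
        exact lt_of_le_of_lt (le_max_right t t') hy
      · intro y hy
        rw [hθe t ht y (lt_of_le_of_lt (le_max_left _ _) hy),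
          hθe t' ht' y (lt_of_le_of_lt (le_max_right _ _) hy)]
      · intro y hy
        rw [hθf t ht y hy, hθf t' ht' y hy]
    refine ⟨hts0, hts1, fun x => θ (tt x) x, ?_, ?_, ?_⟩
    · intro x hx
      have hx' : ts < v x := hx
      have h1 := (hθc _ (htT x hx')).continuousAt ((hop _).mem_nhds (htv x hx'))
      refine (h1.congr ?_).continuousWithinAt
      filter_upwards [(hop _).mem_nhds (htv x hx'), (hop ts).mem_nhds hx'] with y hy hy'
      exact hag _ (htT x hx') _ (htT y hy') y hy (htv y hy')
    · intro x hx
      exact hθe _ (htT x hx) x (htv x hx)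
    · intro x hx
      have hx' : ts < v x := lt_of_le_of_lt hts1 hx
      exact hθf _ (htT x hx') x hx
  obtain ⟨-, -, θ, hθc, hθe, hθf⟩ := htsT
  rcases hts0.eq_or_lt with h0 | hpos
  · rw [← h0] at hθc hθe
    exact ⟨θ, hθc, hθe⟩
  exfalso
  -- extension
  set A : Set (ℂ × ℂ) := {x | ts < v x}
  set B : Set (ℂ × ℂ) := {x | ts ≤ v x}
  have hBc : IsClosed B := isClosed_le continuous_const hv.cont
  have hloc : ∀ x ∈ B, x ∈ closure A ∧ ∃ y, Tendsto θ (𝓝[A] x) (𝓝 y) := by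
    intro x hx
    rcases (show ts ≤ v x from hx).eq_or_lt with h | h
    · exact hv.local_ext hpos hΘ hΘ0 hθc hθe h.symm
    · exact ⟨subset_closure h, θ x, hθc x h⟩
  have hBcont : ContinuousOn (extendFrom A θ) B :=
    continuousOn_extendFrom (fun x hx => (hloc x hx).1) fun x hx => (hloc x hx).2
  have hext : ∀ x ∈ A, extendFrom A θ x = θ x := by
    intro x hx
    exact extendFrom_eq (subset_closure hx) (hθc x hx)
  have hexte : ∀ x ∈ B, Complex.exp (extendFrom A θ x) = Θ x := by
    intro x hx
    have h1 := tendsto_extendFrom (hloc x hx).2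
    have : (𝓝[A] x).NeBot := mem_closure_iff_nhdsWithin_neBot.1 (hloc x hx).1
    have hx0 : 0 < v x := lt_of_lt_of_le hpos hx
    have h2 : Tendsto Θ (𝓝[A] x) (𝓝 (Θ x)) :=
      ((hΘ.continuousAt ((hop 0).mem_nhds hx0)).tendsto).mono_left nhdsWithin_le_nhds
    have h3 := (Complex.continuous_exp.continuousAt.tendsto.comp h1)
    refine tendsto_nhds_unique h3 (h2.congr' ?_)
    filter_upwards [self_mem_nhdsWithin] with y hy
    exact (hθe y hy).symm
  obtain ⟨g, hg⟩ := ContinuousMap.exists_restrict_eq hBc ⟨B.domRestrict (extendFrom A θ),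
    continuousOn_iff_continuous_domRestrict.1 hBcont⟩
  have hgB : ∀ x ∈ B, g x = extendFrom A θ x := by
    intro x hx
    exact congrArg (fun f => f ⟨x, hx⟩) hg
  set N : Set (ℂ × ℂ) := {x | 0 < v x ∧ 0 < (Complex.exp (-g x) * Θ x).re} with hN
  have hcN : ContinuousOn (fun x => Complex.exp (-g x) * Θ x) {x | 0 < v x} :=
    ContinuousOn.mul (by fun_prop) hΘ
  have hNo : IsOpen N := by
    have := (Complex.continuous_re.comp_continuousOn hcN).isOpen_inter_preimage (hop 0)
      (isOpen_Ioi (a := (0:ℝ)))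
    exact this
  have hBN : B ⊆ N := by
    intro x hx
    have hx0 : 0 < v x := lt_of_lt_of_le hpos hx
    refine ⟨hx0, ?_⟩
    rw [hgB x hx, ← hexte x hx, ← Complex.exp_add]
    simp
  obtain ⟨t, htpos, htts, htN⟩ : ∃ t, 0 ≤ t ∧ t < ts ∧ ∀ x, t < v x → x ∈ N := by
    set C : Set (ℂ × ℂ) := {x | v x ≤ ts} \ N with hC
    have hCc : IsCompact C := by
      refine Metric.isCompact_of_isClosed_isBounded ?_ ?_
      · exact (isClosed_le hv.cont continuous_const).sdiff hNo
      · exact hprop.subset fun x hx => le_trans hx.1 hts1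
    rcases C.eq_empty_or_nonempty with he | hne
    · refine ⟨0, le_rfl, hpos, fun x hx => ?_⟩
      by_contra hn
      rcases le_total (v x) ts with h | h
      · have : x ∈ C := ⟨h, hn⟩
        rw [he] at this; exact this
      · exact hn (hBN h)
    · obtain ⟨x0, hx0, hmax⟩ := hCc.exists_isMaxOn hne hv.cont.continuousOn
      have hlt : v x0 < ts := by
        by_contra hc
        push Not at hc
        exact hx0.2 (hBN hc)
      refine ⟨max 0 (v x0), le_max_left _ _, max_lt hpos hlt, fun x hx => ?_⟩
      by_contra hn
      rcases le_total (v x) ts with h | h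
      · have h1 : v x ≤ v x0 := hmax (show x ∈ C from ⟨h, hn⟩)
        exact absurd (lt_of_le_of_lt (le_max_right 0 (v x0)) hx) (not_lt.2 h1)
      · exact hn (hBN h)
  have : t ∈ T := by
    refine ⟨htpos, htts.le.trans hts1, fun x => g x + Complex.log (Complex.exp (-g x) * Θ x), ?_, ?_, ?_⟩
    · intro x hx
      have hxN := htN x hx
      refine ContinuousAt.continuousWithinAt ?_
      exact g.continuous.continuousAt.add
        ((hcN.continuousAt ((hop 0).mem_nhds hxN.1)).clog (Or.inl hxN.2))
    · intro x hx
      have hxN := htN x hx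
      have : Complex.exp (-g x) * Θ x ≠ 0 := by
        intro h; have := hxN.2; rw [h] at this; simp at this
      rw [Complex.exp_add, Complex.exp_log this, ← mul_assoc, ← Complex.exp_add]
      simp
    · intro x hx
      have hxA : ts < v x := lt_of_le_of_lt hts1 hx
      have hxB : x ∈ B := hxA.le
      simp only
      rw [hgB x hxB, ← hexte x hxB, ← Complex.exp_add]
      simp only [neg_add_cancel, Complex.exp_zero, Complex.log_one, add_zero]
      rw [hext x hxA, hθf x hx, Complex.exp_log (hΘ0 x (lt_of_le_of_lt hts0 hxA))]
  exact absurd (csInf_le hbdd this) (not_le.2 htts)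

end Shch

namespace Shch
open Filter Topology

lemma taylor_two_expl {E : Type*} [NormedAddCommGroup E] [NormedSpace ℝ E] {v : E → ℝ}
    (hC : ContDiff ℝ 2 v) (x : E) :
    ∃ (A : E →L[ℝ] ℝ) (H : E →L[ℝ] E →L[ℝ] ℝ), H = (1/2 : ℝ) • fderiv ℝ (fderiv ℝ v) x ∧ (∀ y z, H y z = H z y) ∧
      ∀ ε > 0, ∃ δ > 0, ∀ y : E, ‖y‖ ≤ δ → |v (x + y) - v x - A y - H y y| ≤ ε * ‖y‖ ^ 2 := by
  set F := fderiv ℝ v with hF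
  have hF1 : ContDiff ℝ 1 F := hC.fderiv_right (by norm_num)
  have hd : ∀ y, HasFDerivAt v (F y) y := fun y =>
    ((hC.differentiable (by norm_num)) y).hasFDerivAt
  set H2 := fderiv ℝ F x with hH2
  have hd2 : HasFDerivAt F H2 x := ((hF1.differentiable (by norm_num)) x).hasFDerivAt
  have hsym : ∀ y z, H2 y z = H2 z y := fun y z =>
    second_derivative_symmetric hd hd2 y z
  refine ⟨F x, (1/2 : ℝ) • H2, rfl, fun y z => by simp [hsym y z], fun ε hε => ?_⟩
  have h1 := hd2.isLittleO
  have h2 := (Asymptotics.isLittleO_iff.1 h1) hε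
  obtain ⟨δ, hδ, hball⟩ := Metric.nhds_basis_closedBall.mem_iff.1 h2
  refine ⟨δ, hδ, fun y hy => ?_⟩
  set g : E → ℝ := fun y => v (x + y) - F x y - (1/2) * H2 y y with hg
  have hgd : ∀ y, HasFDerivAt g (F (x + y) - F x - H2 y) y := by
    intro y
    have a1 : HasFDerivAt (fun y => v (x + y)) (F (x + y)) y := by
      have := (hd (x + y)).comp y ((hasFDerivAt_id y).const_add x)
      exact HasFDerivAt.congr_fderiv (f := fun y => v (x + y)) this (by ext; simp)
    have a2 : HasFDerivAt (fun y => F x y) (F x) y := (F x).hasFDerivAt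
    have a3 : HasFDerivAt (fun y => (1/2 : ℝ) * H2 y y) (H2 y) y := by
      have := (H2.hasFDerivAt (x := y)).clm_apply (hasFDerivAt_id y)
      have := this.const_mul (1/2 : ℝ)
      refine this.congr_fderiv ?_
      ext z
      simp [hsym y z]
      ring
    exact (a1.sub a2).sub a3
  have hconv : Convex ℝ (closedBall (0:E) ‖y‖) := convex_closedBall _ _
  have hb : ∀ z ∈ closedBall (0:E) ‖y‖, ‖F (x + z) - F x - H2 z‖ ≤ ε * ‖y‖ := by
    intro z hz
    have hz' : ‖z‖ ≤ ‖y‖ := by simpa using hz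
    have := hball (show x + z ∈ closedBall x δ by simpa using hz'.trans hy)
    simp only [mem_ofPred_eq, add_sub_cancel_left] at this
    exact this.trans (by gcongr)
  have := hconv.norm_image_sub_le_of_norm_hasFDerivWithin_le (f := g)
    (fun z _ => (hgd z).hasFDerivWithinAt) hb (show (0:E) ∈ _ by simp) (show y ∈ _ by simp)
  simp only [hg, add_zero, map_zero, sub_zero, mul_zero, zero_apply] at this
  rw [Real.norm_eq_abs] at this
  calc _ = |v (x + y) - F x y - 1 / 2 * H2 y y - v x| := by
        congr 1; simp only [smul_apply, smul_eq_mul]; ring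
    _ ≤ ε * ‖y‖ * ‖y‖ := this
    _ = _ := by ring

lemma taylor_two {E : Type*} [NormedAddCommGroup E] [NormedSpace ℝ E] {v : E → ℝ}
    (hC : ContDiff ℝ 2 v) (x : E) :
    ∃ (A : E →L[ℝ] ℝ) (H : E →L[ℝ] E →L[ℝ] ℝ), (∀ y z, H y z = H z y) ∧
      ∀ ε > 0, ∃ δ > 0, ∀ y : E, ‖y‖ ≤ δ → |v (x + y) - v x - A y - H y y| ≤ ε * ‖y‖ ^ 2 := by
  obtain ⟨A, H, -, h⟩ := taylor_two_expl hC x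
  exact ⟨A, H, h⟩


section levi
variable {E : Type*} [NormedAddCommGroup E] [NormedSpace ℂ E]

lemma smul_split (τ : ℂ) (b : E) : τ • b = (τ.re : ℝ) • b + (τ.im : ℝ) • (Complex.I • b) := by
  conv_lhs => rw [← Complex.re_add_im τ]
  rw [add_smul, mul_smul]
  rfl

lemma quad_smul (H : E →L[ℝ] E →L[ℝ] ℝ) (hs : ∀ y z, H y z = H z y) (τ : ℂ) (b : E) :
    H (τ • b) (τ • b) = τ.re ^ 2 * H b b + 2 * (τ.re * τ.im) * H b (Complex.I • b) +
      τ.im ^ 2 * H (Complex.I • b) (Complex.I • b) := by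
  rw [smul_split]
  simp only [map_add, map_smul, add_apply, smul_apply,
    smul_eq_mul, hs (Complex.I • b) b]
  ring

lemma levi_of_submean {v : E → ℝ} (hvc : Continuous v) {κ : ℝ} {x : E} {A : E →L[ℝ] ℝ}
    {H : E →L[ℝ] E →L[ℝ] ℝ} (hs : ∀ y z, H y z = H z y)
    (hT : ∀ ε > 0, ∃ δ > 0, ∀ y : E, ‖y‖ ≤ δ → |v (x + y) - v x - A y - H y y| ≤ ε * ‖y‖ ^ 2)
    (hsub : ∀ b : E, v x + κ * ‖b‖ ^ 2 ≤
      (2 * Real.pi)⁻¹ * ∫ θ in (0:ℝ)..2 * Real.pi, v (x + Complex.exp (θ * Complex.I) • b)) (b : E) :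
    2 * κ * ‖b‖ ^ 2 ≤ H b b + H (Complex.I • b) (Complex.I • b) := by
  set S := H b b + H (Complex.I • b) (Complex.I • b) with hS
  have key : ∀ ε > 0, 2 * κ * ‖b‖ ^ 2 ≤ S + 2 * ε * ‖b‖ ^ 2 := by
    intro ε hε
    obtain ⟨δ, hδ, hy⟩ := hT ε hε
    set r : ℝ := δ / (‖b‖ + 1) with hr
    have hb1 : 0 < ‖b‖ + 1 := by positivity
    have hrpos : 0 < r := by positivity
    have h1 := hsub ((r:ℂ) • b)
    have hup : ∀ θ : ℝ, v (x + Complex.exp (θ * Complex.I) • ((r:ℂ) • b)) ≤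
        v x + ε * (r ^ 2 * ‖b‖ ^ 2) + (r * A b) * Real.cos θ + (r * A (Complex.I • b)) * Real.sin θ
          + r ^ 2 * H b b * (Real.cos θ) ^ 2 +
          (2 * r ^ 2 * H b (Complex.I • b)) * (Real.sin θ * Real.cos θ)
          + r ^ 2 * H (Complex.I • b) (Complex.I • b) * (Real.sin θ) ^ 2 := by
      intro θ
      set τ : ℂ := Complex.exp (θ * Complex.I) * r with hτ
      have e1 : Complex.exp (θ * Complex.I) • ((r:ℂ) • b) = τ • b := by rw [smul_smul]
      have e2 : τ.re = r * Real.cos θ := by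
        rw [hτ, Complex.re_mul_ofReal, Complex.exp_ofReal_mul_I_re, mul_comm]
      have e3 : τ.im = r * Real.sin θ := by
        rw [hτ, Complex.im_mul_ofReal, Complex.exp_ofReal_mul_I_im, mul_comm]
      have e4 : ‖τ‖ = r := by
        rw [hτ, norm_mul, Complex.norm_exp_ofReal_mul_I]; simp [abs_of_pos hrpos]
      have e5 : ‖τ • b‖ = r * ‖b‖ := by rw [norm_smul, e4]
      have e6 : r * ‖b‖ ≤ δ := by
        rw [hr, div_mul_eq_mul_div, div_le_iff₀ hb1]; nlinarith [norm_nonneg b]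
      have h2 := hy (τ • b) (by rw [e5]; exact e6)
      have h3 := (abs_le.1 h2).2
      rw [quad_smul H hs, e5, e2, e3] at h3
      have e7 : A (τ • b) = r * Real.cos θ * A b + r * Real.sin θ * A (Complex.I • b) := by
        rw [smul_split, map_add, map_smul, map_smul, e2, e3]; simp
      rw [e7] at h3
      rw [e1]
      nlinarith [h3]
    have hItg : IntervalIntegrable (fun θ : ℝ => v (x + Complex.exp (θ * Complex.I) • ((r:ℂ) • b)))
        MeasureTheory.volume 0 (2 * Real.pi) := by
      apply Continuous.intervalIntegrable
      fun_prop
    have h2 := intervalIntegral.integral_mono_on (b := 2 * Real.pi) (by positivity) hItg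
      (by apply Continuous.intervalIntegrable; fun_prop) (fun θ _ => hup θ)
    have h3 : (∫ θ in (0:ℝ)..2 * Real.pi, (v x + ε * (r ^ 2 * ‖b‖ ^ 2) + (r * A b) * Real.cos θ + (r * A (Complex.I • b)) * Real.sin θ
          + r ^ 2 * H b b * (Real.cos θ) ^ 2 +
          (2 * r ^ 2 * H b (Complex.I • b)) * (Real.sin θ * Real.cos θ)
          + r ^ 2 * H (Complex.I • b) (Complex.I • b) * (Real.sin θ) ^ 2)) =
          2 * Real.pi * (v x + ε * (r ^ 2 * ‖b‖ ^ 2) + r ^ 2 / 2 * S) := by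
      rw [intervalIntegral.integral_add, intervalIntegral.integral_add,
        intervalIntegral.integral_add, intervalIntegral.integral_add, intervalIntegral.integral_add]
      · simp only [intervalIntegral.integral_const_mul, integral_cos, integral_sin,
          integral_cos_sq, integral_sin_sq, intervalIntegral.integral_const, smul_eq_mul,
          integral_sin_mul_cos₁]
        simp [hS]
        ring
      all_goals (apply Continuous.intervalIntegrable; fun_prop)
    rw [h3] at h2
    have hpi : 0 < 2 * Real.pi := by positivity
    have h4 : (2 * Real.pi)⁻¹ * ∫ θ in (0:ℝ)..2 * Real.pi, v (x + Complex.exp (θ * Complex.I) • ((r:ℂ) • b)) ≤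
        v x + ε * (r ^ 2 * ‖b‖ ^ 2) + r ^ 2 / 2 * S := by
      rw [inv_mul_le_iff₀ hpi]; exact h2
    have h5 := h1.trans h4
    rw [norm_smul] at h5
    simp only [Complex.norm_real, Real.norm_eq_abs, abs_of_pos hrpos] at h5
    have h6 : r ^ 2 * (2 * κ * ‖b‖ ^ 2) ≤ r ^ 2 * (S + 2 * ε * ‖b‖ ^ 2) := by nlinarith
    exact le_of_mul_le_mul_left h6 (by positivity)
  by_contra hc
  push Not at hc
  set d := 2 * κ * ‖b‖ ^ 2 - S with hd
  have hdpos : 0 < d := by linarith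
  have := key (d / (4 * (‖b‖ ^ 2 + 1))) (by positivity)
  have h2 : 2 * (d / (4 * (‖b‖ ^ 2 + 1))) * ‖b‖ ^ 2 ≤ d / 2 := by
    rw [show 2 * (d / (4 * (‖b‖ ^ 2 + 1))) * ‖b‖ ^ 2 = (d / 2) * (‖b‖ ^ 2 / (‖b‖ ^ 2 + 1)) by
      field_simp; ring]
    have : ‖b‖ ^ 2 / (‖b‖ ^ 2 + 1) ≤ 1 := by rw [div_le_one (by positivity)]; linarith
    nlinarith
  linarith
end levi

end Shch

namespace Shch
open Filter Topology

section levi2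
variable {E : Type*} [NormedAddCommGroup E] [NormedSpace ℂ E]

/-- complex linear part of a real functional -/
def ell (A : E →L[ℝ] ℝ) (y : E) : ℂ := A y - Complex.I * A (Complex.I • y)

lemma ell_re (A : E →L[ℝ] ℝ) (y : E) : (ell A y).re = A y := by simp [ell]

lemma ell_add (A : E →L[ℝ] ℝ) (y z : E) : ell A (y + z) = ell A y + ell A z := by
  simp [ell, smul_add]; ring

lemma ell_smul (A : E →L[ℝ] ℝ) (τ : ℂ) (y : E) : ell A (τ • y) = τ * ell A y := by
  have h1 : A (τ • y) = τ.re * A y + τ.im * A (Complex.I • y) := by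
    rw [smul_split]; simp
  have h2 : A (Complex.I • τ • y) = τ.re * A (Complex.I • y) - τ.im * A y := by
    rw [smul_smul, smul_split]; simp; ring
  unfold ell
  rw [h1, h2]
  apply Complex.ext <;> simp <;> ring

/-- complex quadratic part -/
def QQ (H : E →L[ℝ] E →L[ℝ] ℝ) (b : E) : ℂ :=
  ((H b b - H (Complex.I • b) (Complex.I • b)) / 2 : ℝ) - Complex.I * (H b (Complex.I • b) : ℝ)

lemma quad_smul' (H : E →L[ℝ] E →L[ℝ] ℝ) (hs : ∀ y z, H y z = H z y) (τ : ℂ) (b : E) :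
    H (τ • b) (τ • b) = ‖τ‖ ^ 2 * ((H b b + H (Complex.I • b) (Complex.I • b)) / 2)
      + (τ ^ 2 * QQ H b).re := by
  rw [quad_smul H hs, ← Complex.normSq_eq_norm_sq, Complex.normSq_apply]
  simp [QQ, pow_two]
  ring

lemma QQ_add (H : E →L[ℝ] E →L[ℝ] ℝ) (hs : ∀ y z, H y z = H z y) (t : ℂ) (e f : E) :
    QQ H (t • e + f) = QQ H e * (t * t) + 2 * (((H e f - H (Complex.I • e) (Complex.I • f)) / 2 : ℝ)
      - Complex.I * ((H (Complex.I • e) f + H e (Complex.I • f)) / 2 : ℝ)) * t + QQ H f := by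
  have h1 : Complex.I • (t • e + f) = (t.re : ℝ) • (Complex.I • e) - (t.im : ℝ) • e + Complex.I • f := by
    rw [smul_add, smul_smul, smul_split (Complex.I * t)]
    simp
    abel
  have h2 : t • e + f = (t.re : ℝ) • e + (t.im : ℝ) • (Complex.I • e) + f := by rw [smul_split t]
  unfold QQ
  rw [h1, h2]
  simp only [map_add, map_sub, map_smul, add_apply, sub_apply, smul_apply, smul_eq_mul,
    hs f e, hs f (Complex.I • e), hs (Complex.I • e) e, hs (Complex.I • f) e,
    hs (Complex.I • f) (Complex.I • e), hs (Complex.I • f) f]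
  apply Complex.ext <;> simp <;> ring

lemma exists_disc_dir (A : ℂ × ℂ →L[ℝ] ℝ) (H : ℂ × ℂ →L[ℝ] ℂ × ℂ →L[ℝ] ℝ)
    (hs : ∀ y z, H y z = H z y) :
    ∃ b c : ℂ × ℂ, b ≠ 0 ∧ ell A b = 0 ∧ ell A c + QQ H b = 0 := by
  have hlin : ∀ p q : ℂ, ell A (p, q) = p * ell A (1, 0) + q * ell A (0, 1) := by
    intro p q
    rw [← ell_smul, ← ell_smul, ← ell_add]; simp
  by_cases hl : ell A (1, 0) = 0 ∧ ell A (0, 1) = 0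
  · have hz : ∀ b, ell A b = 0 := fun b => by
      obtain ⟨p, q⟩ := b; rw [hlin, hl.1, hl.2]; simp
    suffices ∃ b : ℂ × ℂ, b ≠ 0 ∧ QQ H b = 0 by
      obtain ⟨b, hb, hq⟩ := this
      exact ⟨b, 0, hb, hz b, by rw [hz, hq, add_zero]⟩
    by_cases ha : QQ H (1, 0) = 0
    · exact ⟨(1, 0), by simp, ha⟩
    · have hQ := fun t : ℂ => QQ_add H hs t (1, 0) (0, 1)
      set β := 2 * ((((H (1,0) (0,1) - H (Complex.I • (1,0)) (Complex.I • (0,1))) / 2 : ℝ):ℂ)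
        - Complex.I * ((H (Complex.I • (1,0)) (0,1) + H (1,0) (Complex.I • (0,1))) / 2 : ℝ))
      obtain ⟨t, ht⟩ := exists_quadratic_eq_zero (b := β) (c := QQ H (0, 1)) ha
        (by
          obtain ⟨s, hs⟩ := IsAlgClosed.exists_pow_nat_eq (discrim (QQ H (1,0)) β (QQ H (0, 1))) (n := 2) (by norm_num)
          exact ⟨s, by rw [← hs, pow_two]⟩)
      refine ⟨t • (1, 0) + (0, 1), ?_, ?_⟩
      · intro h
        have := congrArg Prod.snd h
        simp at this
      · rw [hQ]; exact ht
  · have hb : ((ell A (0, 1), - ell A (1, 0)) : ℂ × ℂ) ≠ 0 := by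
      intro h
      rw [Prod.mk_eq_zero] at h
      exact hl ⟨by simpa using h.2, h.1⟩
    have hb0 : ell A (ell A (0, 1), - ell A (1, 0)) = 0 := by rw [hlin]; ring
    obtain ⟨c0, hc0⟩ : ∃ c0, ell A c0 ≠ 0 := by
      by_contra hcon
      push Not at hcon
      exact hl ⟨hcon _, hcon _⟩
    refine ⟨_, (-(QQ H (ell A (0, 1), - ell A (1, 0))) / ell A c0) • c0, hb, hb0, ?_⟩
    rw [ell_smul]; field_simp; ring

set_option maxHeartbeats 1000000 in
lemma good_disc {v : ℂ × ℂ → ℝ} (hC : ContDiff ℝ 2 v) {κ : ℝ} (hκ : 0 < κ)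
    (hsub : ∀ x b : ℂ × ℂ, v x + κ * ‖b‖ ^ 2 ≤
      (2 * Real.pi)⁻¹ * ∫ θ in (0:ℝ)..2 * Real.pi, v (x + Complex.exp (θ * Complex.I) • b)) :
    ∀ x, ∃ b c : ℂ × ℂ, ∃ r0 > (0:ℝ), ∀ τ : ℂ, τ ≠ 0 → ‖τ‖ ≤ r0 → v x < v (qd x b c τ) := by
    intro x
    obtain ⟨A, H, hs, hT⟩ := taylor_two hC x
    have hlev := levi_of_submean hC.continuous hs hT (hsub x)
    obtain ⟨b, c, hb, hb0, hc⟩ := exists_disc_dir A H hs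
    have hbn : 0 < ‖b‖ := norm_pos_iff.2 hb
    set N := ‖b‖ + ‖c‖ with hN
    have hNpos : 0 < N := by positivity
    set K := 2 * ‖H‖ * ‖b‖ * ‖c‖ + ‖H‖ * ‖c‖ ^ 2 with hK
    have hKnn : 0 ≤ K := by positivity
    obtain ⟨δ, hδ, hTy⟩ := hT (κ * ‖b‖ ^ 2 / (4 * N ^ 2)) (by positivity)
    refine ⟨b, c, min 1 (min (δ / N) (κ * ‖b‖ ^ 2 / (4 * (K + 1)))), by positivity, fun τ h0 hτ => ?_⟩
    have hτ1 : ‖τ‖ ≤ 1 := hτ.trans (min_le_left _ _)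
    have hτ2 : ‖τ‖ ≤ δ / N := hτ.trans ((min_le_right _ _).trans (min_le_left _ _))
    have hτ3 : ‖τ‖ ≤ κ * ‖b‖ ^ 2 / (4 * (K + 1)) := hτ.trans ((min_le_right _ _).trans (min_le_right _ _))
    rw [le_div_iff₀ hNpos] at hτ2
    rw [le_div_iff₀ (by positivity)] at hτ3
    have hτpos : 0 < ‖τ‖ := norm_pos_iff.2 h0
    set y := τ • b + τ ^ 2 • c with hy
    have hyn : ‖y‖ ≤ ‖τ‖ * N := by
      calc ‖y‖ ≤ ‖τ‖ * ‖b‖ + ‖τ‖ ^ 2 * ‖c‖ := by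
            refine (norm_add_le _ _).trans ?_
            rw [norm_smul, norm_smul, norm_pow]
        _ ≤ ‖τ‖ * ‖b‖ + ‖τ‖ * ‖c‖ := by gcongr; nlinarith
        _ = _ := by rw [hN]; ring
    have e0 : qd x b c τ = x + y := by rw [qd, hy, add_assoc]
    have h1 := (abs_le.1 (hTy y (hyn.trans hτ2))).1
    have h2 : A y = (τ ^ 2 * ell A c).re := by
      rw [← ell_re, hy, ell_add, ell_smul, ell_smul, hb0]; simp
    have h3 : H y y = H (τ • b) (τ • b) + 2 * H (τ • b) (τ ^ 2 • c) + H (τ ^ 2 • c) (τ ^ 2 • c) := by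
      rw [hy]; simp only [map_add, add_apply, hs (τ ^ 2 • c) (τ • b)]; ring
    have h4 : |H (τ • b) (τ ^ 2 • c)| ≤ ‖H‖ * (‖τ‖ * ‖b‖) * (‖τ‖ ^ 2 * ‖c‖) := by
      have := H.le_opNorm₂ (τ • b) (τ ^ 2 • c)
      rwa [norm_smul, norm_smul, norm_pow, Real.norm_eq_abs] at this
    have h5 : |H (τ ^ 2 • c) (τ ^ 2 • c)| ≤ ‖H‖ * (‖τ‖ ^ 2 * ‖c‖) * (‖τ‖ ^ 2 * ‖c‖) := by
      have := H.le_opNorm₂ (τ ^ 2 • c) (τ ^ 2 • c)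
      rwa [norm_smul, norm_pow, Real.norm_eq_abs] at this
    have h6 : A y + H (τ • b) (τ • b) ≥ ‖τ‖ ^ 2 * (κ * ‖b‖ ^ 2) := by
      rw [quad_smul' H hs, h2]
      have : (τ ^ 2 * ell A c).re + (τ ^ 2 * QQ H b).re = 0 := by
        rw [← Complex.add_re, ← mul_add, hc]; simp
      nlinarith [hlev b, sq_nonneg ‖τ‖]
    have h7 : κ * ‖b‖ ^ 2 / (4 * N ^ 2) * ‖y‖ ^ 2 ≤ ‖τ‖ ^ 2 * (κ * ‖b‖ ^ 2 / 4) := by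
      calc _ ≤ κ * ‖b‖ ^ 2 / (4 * N ^ 2) * (‖τ‖ * N) ^ 2 := by gcongr
        _ = _ := by field_simp
    have h8 : 2 * (‖H‖ * (‖τ‖ * ‖b‖) * (‖τ‖ ^ 2 * ‖c‖)) + ‖H‖ * (‖τ‖ ^ 2 * ‖c‖) * (‖τ‖ ^ 2 * ‖c‖)
        ≤ ‖τ‖ ^ 2 * (κ * ‖b‖ ^ 2 / 4) := by
      calc _ = ‖τ‖ ^ 3 * (2 * ‖H‖ * ‖b‖ * ‖c‖) + ‖τ‖ ^ 4 * (‖H‖ * ‖c‖ ^ 2) := by ring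
        _ ≤ ‖τ‖ ^ 3 * (2 * ‖H‖ * ‖b‖ * ‖c‖) + ‖τ‖ ^ 3 * (‖H‖ * ‖c‖ ^ 2) := by
            have : ‖τ‖ ^ 4 ≤ ‖τ‖ ^ 3 := pow_le_pow_of_le_one hτpos.le hτ1 (by norm_num)
            gcongr
        _ = ‖τ‖ ^ 2 * (‖τ‖ * K) := by rw [hK]; ring
        _ ≤ _ := by
            gcongr
            nlinarith
    rw [e0]
    have h9 : 0 < ‖τ‖ ^ 2 * (κ * ‖b‖ ^ 2) := by positivity
    have := abs_le.1 h4
    have := abs_le.1 h5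
    linarith

set_option maxHeartbeats 1000000 in
lemma good_maxp {v : ℂ × ℂ → ℝ} (hC : ContDiff ℝ 2 v) {κ : ℝ} (hκ : 0 < κ)
    (hsub : ∀ x b : ℂ × ℂ, v x + κ * ‖b‖ ^ 2 ≤
      (2 * Real.pi)⁻¹ * ∫ θ in (0:ℝ)..2 * Real.pi, v (x + Complex.exp (θ * Complex.I) • b)) :
    ∀ (y b c : ℂ × ℂ) (Ω : Set ℂ) (t : ℝ), IsOpen Ω → Bornology.IsBounded Ω →
    (∀ τ ∈ frontier Ω, v (qd y b c τ) ≤ t) → ∀ τ ∈ Ω, v (qd y b c τ) ≤ t := by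
    intro y b c Ω t hΩ hbd hfr τ1 hτ1
    by_contra hcon
    push Not at hcon
    obtain ⟨R, hR⟩ := hbd.closure.exists_norm_le
    set f : ℂ → ℝ := fun τ => v (qd y b c τ) with hf
    have hfc : Continuous f := hC.continuous.comp (by unfold qd; fun_prop)
    set ε := (f τ1 - t) / (2 * (R ^ 2 + 1)) with hε
    have hft : 0 < f τ1 - t := by linarith
    have hεp : 0 < ε := by positivity
    have hεR : ε * R ^ 2 < f τ1 - t := by
      rw [hε, div_mul_eq_mul_div, div_lt_iff₀ (by positivity)]; nlinarith [sq_nonneg R]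
    obtain ⟨τ0, hτ0, hmax⟩ := (hbd.isCompact_closure).exists_isMaxOn (f := fun τ => f τ + ε * ‖τ‖ ^ 2)
      ⟨τ1, subset_closure hτ1⟩ (by fun_prop)
    have hin : τ0 ∈ Ω := by
      by_contra hnot
      have h1 : τ0 ∈ frontier Ω := ⟨hτ0, by rwa [hΩ.interior_eq]⟩
      have h2 := hfr τ0 h1
      have h3 : f τ1 + ε * ‖τ1‖ ^ 2 ≤ f τ0 + ε * ‖τ0‖ ^ 2 := hmax (subset_closure hτ1)
      have h4 : ‖τ0‖ ^ 2 ≤ R ^ 2 := by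
        have := hR τ0 hτ0
        gcongr
      have h5 : f τ0 ≤ t := h2
      nlinarith [sq_nonneg ‖τ1‖]
    set x := qd y b c τ0 with hx
    set b' := b + (2 * τ0) • c with hb'
    have hq : ∀ s, qd y b c (τ0 + s) = x + (s • b' + s ^ 2 • c) := by
      intro s
      simp only [hx, hb', qd]
      module
    obtain ⟨A, H, hs, hT⟩ := taylor_two hC x
    have hlev := levi_of_submean hC.continuous hs hT (hsub x) b'
    set N := ‖b'‖ + ‖c‖ + 1 with hN
    have hNpos : 0 < N := by positivity
    obtain ⟨δ, hδ, hTy⟩ := hT (ε / (4 * N ^ 2)) (by positivity)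
    obtain ⟨η, hη, hball⟩ := Metric.isOpen_iff.1 hΩ τ0 hin
    set ρ := min (min 1 (η / 2)) (min (δ / N) (ε / (4 * (‖H‖ * ‖c‖ ^ 2 + 1)))) with hρ
    have hρpos : 0 < ρ := by positivity
    have r1 : ρ ≤ 1 := (min_le_left _ _).trans (min_le_left _ _)
    have r2 : ρ ≤ η / 2 := (min_le_left _ _).trans (min_le_right _ _)
    have r3 : ρ ≤ δ / N := (min_le_right _ _).trans (min_le_left _ _)
    have r4 : ρ ≤ ε / (4 * (‖H‖ * ‖c‖ ^ 2 + 1)) := (min_le_right _ _).trans (min_le_right _ _)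
    rw [le_div_iff₀ hNpos] at r3
    rw [le_div_iff₀ (by positivity)] at r4
    have main : ∀ s : ℂ, ‖s‖ = ρ → f τ0 + A (s • b' + s ^ 2 • c) + H (s • b' + s ^ 2 • c) (s • b' + s ^ 2 • c)
        - ε / 4 * ρ ^ 2 + ε * ‖τ0 + s‖ ^ 2 ≤ f τ0 + ε * ‖τ0‖ ^ 2 := by
      intro s hsn
      have h1 : τ0 + s ∈ Ω := hball (by simp [hsn]; linarith)
      have h2 : f (τ0 + s) + ε * ‖τ0 + s‖ ^ 2 ≤ f τ0 + ε * ‖τ0‖ ^ 2 := hmax (subset_closure h1)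
      have hyn : ‖s • b' + s ^ 2 • c‖ ≤ ρ * N := by
        calc _ ≤ ‖s‖ * ‖b'‖ + ‖s‖ ^ 2 * ‖c‖ := by
              refine (norm_add_le _ _).trans ?_
              rw [norm_smul, norm_smul, norm_pow]
          _ = ρ * ‖b'‖ + ρ ^ 2 * ‖c‖ := by rw [hsn]
          _ ≤ ρ * ‖b'‖ + ρ * ‖c‖ + ρ := by
              have : ρ ^ 2 ≤ ρ := by nlinarith
              nlinarith [norm_nonneg c]
          _ = _ := by rw [hN]; ring
      have h3 := (abs_le.1 (hTy _ (hyn.trans r3))).1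
      have h4 : ε / (4 * N ^ 2) * ‖s • b' + s ^ 2 • c‖ ^ 2 ≤ ε / 4 * ρ ^ 2 := by
        calc _ ≤ ε / (4 * N ^ 2) * (ρ * N) ^ 2 := by gcongr
          _ = _ := by field_simp
      have h5 : f (τ0 + s) = v (x + (s • b' + s ^ 2 • c)) := by rw [hf]; simp only [hq]
      have h6 : f τ0 = v x := rfl
      linarith
    have m1 := main ρ (by simp [abs_of_pos hρpos])
    have m2 := main (-ρ) (by simp [abs_of_pos hρpos])
    have m3 := main (ρ * Complex.I) (by simp [abs_of_pos hρpos])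
    have m4 := main (-(ρ * Complex.I)) (by simp [abs_of_pos hρpos])
    have n1 : ∀ z : ℂ, ‖z‖ ^ 2 = z.re ^ 2 + z.im ^ 2 := fun z => by
      rw [← Complex.normSq_eq_norm_sq, Complex.normSq_apply]; ring
    have c1 : ((ρ:ℂ)) • b' + (ρ:ℂ) ^ 2 • c = ρ • b' + (ρ ^ 2) • c := by
      rw [← Complex.ofReal_pow, Complex.coe_smul, Complex.coe_smul]
    have c2 : (-(ρ:ℂ)) • b' + (-(ρ:ℂ)) ^ 2 • c = (-ρ) • b' + (ρ ^ 2) • c := by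
      rw [neg_sq, ← Complex.ofReal_pow, ← Complex.ofReal_neg, Complex.coe_smul, Complex.coe_smul]
    have c3 : ((ρ:ℂ) * Complex.I) • b' + ((ρ:ℂ) * Complex.I) ^ 2 • c = ρ • (Complex.I • b') + (-ρ ^ 2) • c := by
      rw [mul_pow, Complex.I_sq, mul_smul, mul_neg_one, ← Complex.ofReal_pow, ← Complex.ofReal_neg, Complex.coe_smul, Complex.coe_smul]
    have c4 : (-((ρ:ℂ) * Complex.I)) • b' + (-((ρ:ℂ) * Complex.I)) ^ 2 • c = (-ρ) • (Complex.I • b') + (-ρ ^ 2) • c := by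
      rw [neg_sq, mul_pow, Complex.I_sq, ← neg_mul, mul_smul, mul_neg_one, ← Complex.ofReal_pow, ← Complex.ofReal_neg, ← Complex.ofReal_neg, Complex.coe_smul, Complex.coe_smul]
    rw [c1, n1, n1 τ0] at m1
    rw [c2, n1, n1 τ0] at m2
    rw [c3, n1, n1 τ0] at m3
    rw [c4, n1, n1 τ0] at m4
    simp only [map_add, map_smul, add_apply, smul_apply, smul_eq_mul] at m1 m2 m3 m4
    simp at m1 m2 m3 m4
    have hcc : |H c c| ≤ ‖H‖ * ‖c‖ * ‖c‖ := H.le_opNorm₂ c c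
    have hcc' := (abs_le.1 hcc).1
    have hfin : ρ ^ 2 * (ρ ^ 2 * (H c c)) ≥ - (ρ ^ 2 * (ε / 4)) := by
      rw [ge_iff_le, ← mul_neg]
      gcongr
      have : ρ ^ 2 ≤ ρ := by nlinarith
      have h0 : 0 ≤ ‖H‖ * ‖c‖ ^ 2 := by positivity
      have h1 : ρ ^ 2 * (‖H‖ * ‖c‖ ^ 2) ≤ ρ * (‖H‖ * ‖c‖ ^ 2) := by gcongr
      have h2 : ρ ^ 2 * (-(‖H‖ * ‖c‖ * ‖c‖)) ≤ ρ ^ 2 * H c c := by gcongr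
      nlinarith
    have hl2 : 0 ≤ ρ ^ 2 * (H b' b' + H (Complex.I • b') (Complex.I • b')) := by
      have : 0 ≤ 2 * κ * ‖b'‖ ^ 2 := by positivity
      have := this.trans hlev
      positivity
    have : 0 < ρ ^ 2 * ε := by positivity
    linarith

lemma good_of_submean {v : ℂ × ℂ → ℝ} (hC : ContDiff ℝ 2 v) {κ : ℝ} (hκ : 0 < κ)
    (hsub : ∀ x b : ℂ × ℂ, v x + κ * ‖b‖ ^ 2 ≤
      (2 * Real.pi)⁻¹ * ∫ θ in (0:ℝ)..2 * Real.pi, v (x + Complex.exp (θ * Complex.I) • b)) :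
    Good v :=
  ⟨hC.continuous, good_disc hC hκ hsub, good_maxp hC hκ hsub⟩
end levi2
end Shch

namespace Shch
open Filter Topology

/-- circular mean over the unit circle -/
def cm (f : ℂ → ℝ) : ℝ := (2 * Real.pi)⁻¹ * ∫ θ in (0:ℝ)..2 * Real.pi, f (Complex.exp (θ * Complex.I))

lemma cm_eq (f : ℂ → ℝ) : cm f = Real.circleAverage f 0 1 := by
  simp [cm, Real.circleAverage_def, circleMap]

lemma cm_poly (p : ℂ[X]) : cm (fun z => (p.eval z).re) = (p.eval 0).re := by
  rw [cm_eq]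
  have h1 : Real.circleAverage (fun z => p.eval z) 0 1 = p.eval 0 :=
    DiffContOnCl.circleAverage (p.differentiable.diffContOnCl)
  have h2 := Complex.reCLM.circleAverage_comp_comm (f := fun z => p.eval z) (c := 0) (R := 1)
    (p.continuous.continuousOn.circleIntegrable' )
  rw [h1] at h2
  exact h2

lemma exists_poly_near {g : ℂ → ℝ} (hg : ContinuousOn g (sphere 0 1)) {ε : ℝ} (hε : 0 < ε) :
    ∃ p : ℂ[X], ∀ z ∈ sphere (0:ℂ) 1, |(p.eval z).re - g z| ≤ ε := by
  have hcont : Continuous (fun x : UnitAddCircle => ((g (AddCircle.toCircle x : ℂ) : ℝ) : ℂ)) := by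
    refine Complex.continuous_ofReal.comp ?_
    refine hg.comp_continuous ?_ (fun x => by rw [mem_sphere_zero_iff_norm]; exact Circle.norm_coe _)
    exact continuous_subtype_val.comp AddCircle.continuous_toCircle
  set G : C(UnitAddCircle, ℂ) := ⟨_, hcont⟩
  have hmem : G ∈ (Submodule.span ℂ (range <| @fourier 1)).topologicalClosure := by
    rw [span_fourier_closure_eq_top]; trivial
  obtain ⟨P, hP, hd⟩ := Metric.mem_closure_iff.1 hmem ε hε
  have key : ∀ P ∈ Submodule.span ℂ (range <| @fourier 1), ∃ p q : ℂ[X], ∀ x : UnitAddCircle,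
      P x = p.eval (AddCircle.toCircle x : ℂ) + (starRingEnd ℂ) (q.eval (AddCircle.toCircle x : ℂ)) := by
    intro P hP
    induction hP using Submodule.span_induction with
    | mem P h =>
      obtain ⟨n, rfl⟩ := h
      obtain ⟨k, rfl | rfl⟩ := n.eq_nat_or_neg
      · refine ⟨X ^ k, 0, fun x => ?_⟩
        simp [fourier_apply, AddCircle.toCircle_nsmul]
      · refine ⟨0, X ^ k, fun x => ?_⟩
        rw [fourier_neg]
        simp [fourier_apply, AddCircle.toCircle_nsmul]
    | zero => exact ⟨0, 0, by simp⟩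
    | add P Q _ _ hP hQ =>
      obtain ⟨p, q, h⟩ := hP
      obtain ⟨p', q', h'⟩ := hQ
      exact ⟨p + p', q + q', fun x => by simp [h, h']; ring⟩
    | smul a P _ hP =>
      obtain ⟨p, q, h⟩ := hP
      exact ⟨C a * p, C ((starRingEnd ℂ) a) * q, fun x => by simp [h]; ring⟩
  obtain ⟨p, q, hpq⟩ := key P hP
  refine ⟨p + q, fun z hz => ?_⟩
  obtain ⟨x, hx⟩ := (AddCircle.homeomorphCircle (T := (1:ℝ)) one_ne_zero).surjective (⟨z, hz⟩ : Circle)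
  have hx' : (AddCircle.toCircle x : ℂ) = z := by
    rw [AddCircle.homeomorphCircle_apply] at hx
    rw [hx]
  have h1 : ‖G x - P x‖ ≤ ε := by
    rw [← dist_eq_norm]
    exact (ContinuousMap.dist_apply_le_dist x).trans hd.le
  have h2 : G x = (g z : ℂ) := by simp only [G, ContinuousMap.coe_mk, hx']
  rw [h2, hpq, hx'] at h1
  have h3 := (Complex.abs_re_le_norm _).trans h1
  rw [abs_sub_comm]
  have e : ((g z : ℂ) - (p.eval z + (starRingEnd ℂ) (q.eval z))).re = g z - ((p + q).eval z).re := by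
    simp
  rw [e] at h3
  exact h3

/-- upper semicontinuous functions are decreasing limits of continuous ones -/
lemma usc_approx {X : Type*} [MetricSpace X] [CompactSpace X] {f : X → ℝ}
    (hf : UpperSemicontinuous f) {M : ℝ} (hM : ∀ x, |f x| ≤ M) :
    ∃ g : ℕ → X → ℝ, (∀ k, Continuous (g k)) ∧ (∀ k x, f x ≤ g k x) ∧ (∀ k x, |g k x| ≤ M) ∧
      ∀ x, Tendsto (fun k => g k x) atTop (𝓝 (f x)) := by
  have hbdd : ∀ (k : ℕ) (x : X), BddAbove (range fun y => f y - k * dist x y) := by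
    intro k x
    refine ⟨M, ?_⟩
    rintro _ ⟨y, rfl⟩
    have := (abs_le.1 (hM y)).2
    have : 0 ≤ (k:ℝ) * dist x y := by positivity
    simp only
    linarith
  set g : ℕ → X → ℝ := fun k x => ⨆ y, (f y - k * dist x y) with hg
  have hle : ∀ k x, f x ≤ g k x := fun k x => by
    have := le_ciSup (hbdd k x) x
    simpa using this
  have hup : ∀ k x, g k x ≤ M := fun k x => by
    have : Nonempty X := ⟨x⟩
    refine ciSup_le (fun y => ?_)
    have := (abs_le.1 (hM y)).2
    have : 0 ≤ (k:ℝ) * dist x y := by positivity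
    linarith
  refine ⟨g, fun k => ?_, hle, fun k x => abs_le.2 ⟨(abs_le.1 (hM x)).1.trans (hle k x), hup k x⟩, fun x => ?_⟩
  · have : LipschitzWith k (g k) := by
      refine LipschitzWith.of_le_add_mul _ (fun x x' => ?_)
      have : Nonempty X := ⟨x⟩
      refine ciSup_le (fun y => ?_)
      have h1 := le_ciSup (hbdd k x') y
      have h2 : dist x' y ≤ dist x x' + dist x y := by rw [dist_comm x x']; exact dist_triangle _ _ _
      have h3 : (k:ℝ) * dist x' y ≤ k * (dist x x' + dist x y) := by gcongr
      simp only [hg] at *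
      push_cast
      linarith
    exact this.continuous
  · rw [Metric.tendsto_atTop]
    intro ε hε
    have h1 := hf x (f x + ε / 2) (by linarith)
    obtain ⟨δ, hδ, hb⟩ := Metric.mem_nhds_iff.1 h1
    obtain ⟨K, hK⟩ := exists_nat_gt (2 * M / δ)
    refine ⟨K, fun k hk => ?_⟩
    have h2 : g k x ≤ f x + ε / 2 := by
      have : Nonempty X := ⟨x⟩
      refine ciSup_le (fun y => ?_)
      by_cases hy : dist x y < δ
      · have : f y < f x + ε / 2 := hb (by rwa [mem_ball, dist_comm])
        have : 0 ≤ (k:ℝ) * dist x y := by positivity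
        linarith
      · push Not at hy
        have h3 : 2 * M / δ < k := hK.trans_le (by exact_mod_cast hk)
        rw [div_lt_iff₀ hδ] at h3
        have h4 : (k:ℝ) * δ ≤ k * dist x y := by gcongr
        have := (abs_le.1 (hM y)).2
        have := (abs_le.1 (hM x)).1
        linarith
    rw [Real.dist_eq, abs_lt]
    constructor <;> linarith [hle k x]

lemma cm_mono {f g : ℂ → ℝ} (hf : IntervalIntegrable (fun θ : ℝ => f (Complex.exp (θ * Complex.I))) MeasureTheory.volume 0 (2 * Real.pi))
    (hg : IntervalIntegrable (fun θ : ℝ => g (Complex.exp (θ * Complex.I))) MeasureTheory.volume 0 (2 * Real.pi))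
    (h : ∀ z ∈ sphere (0:ℂ) 1, f z ≤ g z) : cm f ≤ cm g := by
  unfold cm
  gcongr
  apply intervalIntegral.integral_mono_on (by positivity) hf hg
  intro θ _
  exact h _ (by simp [Complex.norm_exp_ofReal_mul_I])

lemma cm_const (a : ℝ) : cm (fun _ => a) = a := by
  have : Real.pi ≠ 0 := Real.pi_ne_zero
  simp [cm]; field_simp

lemma ii_of_cont {F : ℂ → ℝ} (hF : ContinuousOn F (sphere 0 1)) :
    IntervalIntegrable (fun θ : ℝ => F (Complex.exp (θ * Complex.I))) MeasureTheory.volume 0 (2 * Real.pi) := by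
  apply Continuous.intervalIntegrable
  exact hF.comp_continuous (by fun_prop) (fun θ => by simp [Complex.norm_exp_ofReal_mul_I])

lemma le_cm_cont {f : ℂ → ℝ} {A : ℝ}
    (h : ∀ p : ℂ[X], (∀ z ∈ sphere (0:ℂ) 1, f z ≤ (p.eval z).re) → A ≤ (p.eval 0).re)
    {g : ℂ → ℝ} (hg : ContinuousOn g (sphere 0 1)) (hfg : ∀ z ∈ sphere (0:ℂ) 1, f z ≤ g z) :
    A ≤ cm g := by
  refine le_of_forall_pos_le_add (fun ε hε => ?_)
  obtain ⟨p, hp⟩ := exists_poly_near hg (half_pos hε)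
  have h1 : A ≤ ((p + C ((ε / 2 : ℝ) : ℂ)).eval 0).re := by
    refine h _ (fun z hz => ?_)
    have := (abs_le.1 (hp z hz)).1
    have := hfg z hz
    simp only [eval_add, eval_C, Complex.add_re, Complex.ofReal_re]
    linarith
  have h2 : (p.eval 0).re ≤ cm (fun z => g z + ε / 2) := by
    rw [← cm_poly]
    refine cm_mono (ii_of_cont (Complex.continuous_re.comp p.continuous).continuousOn) (ii_of_cont (hg.add continuousOn_const)) (fun z hz => ?_)
    have := (abs_le.1 (hp z hz)).2
    linarith
  have h3 : cm (fun z => g z + ε / 2) = cm g + ε / 2 := by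
    have := cm_const (ε / 2)
    unfold cm at *
    rw [intervalIntegral.integral_add (ii_of_cont hg) (by simp), mul_add, this]
  simp only [eval_add, eval_C, Complex.add_re, Complex.ofReal_re] at h1
  linarith

lemma le_cm_usc {f : ℂ → ℝ} (hf : UpperSemicontinuous f) {M : ℝ} (hM : ∀ z ∈ sphere (0:ℂ) 1, |f z| ≤ M)
    {A : ℝ} (h : ∀ p : ℂ[X], (∀ z ∈ sphere (0:ℂ) 1, f z ≤ (p.eval z).re) → A ≤ (p.eval 0).re) :
    A ≤ cm f := by
  have : CompactSpace (sphere (0:ℂ) 1) := isCompact_iff_compactSpace.1 (isCompact_sphere _ _)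
  obtain ⟨g, hgc, hfg, hgM, hlim⟩ := usc_approx (X := sphere (0:ℂ) 1) (f := fun z => f z)
    (UpperSemicontinuous.comp hf continuous_subtype_val) (M := M) (fun z => hM z z.2)
  classical
  set G : ℕ → ℂ → ℝ := fun k z => if hz : z ∈ sphere (0:ℂ) 1 then g k ⟨z, hz⟩ else 0 with hG
  have hGc : ∀ k, ContinuousOn (G k) (sphere 0 1) := by
    intro k
    rw [continuousOn_iff_continuous_domRestrict]
    have e : (sphere (0:ℂ) 1).domRestrict (G k) = g k := by
      funext z
      simp only [hG]
      exact dif_pos z.2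
    rw [e]
    exact hgc k
  have h1 : ∀ k, A ≤ cm (G k) := fun k => le_cm_cont h (hGc k) (fun z hz => by
    simp only [hG]; rw [dif_pos hz]; exact hfg k ⟨z, hz⟩)
  refine ge_of_tendsto' (x := atTop) (f := fun k => cm (G k)) ?_ h1
  unfold cm
  refine Tendsto.const_mul _ ?_
  have hs : ∀ θ : ℝ, Complex.exp (θ * Complex.I) ∈ sphere (0:ℂ) 1 := fun θ => by
    simp [Complex.norm_exp_ofReal_mul_I]
  refine intervalIntegral.tendsto_integral_filter_of_dominated_convergence (fun _ => M) ?_ ?_ ?_ ?_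
  · refine Eventually.of_forall (fun k => ?_)
    exact ((hGc k).comp_continuous (by fun_prop) hs).aestronglyMeasurable
  · refine Eventually.of_forall (fun k => Eventually.of_forall (fun θ _ => ?_))
    simp only [hG]; rw [dif_pos (hs θ)]; exact hgM k _
  · simp
  · refine Eventually.of_forall (fun θ _ => ?_)
    have := hlim ⟨_, hs θ⟩
    simp only [hG]
    convert this using 2 with k
    rw [dif_pos (hs θ)]
end Shch

namespace Shch
open Filter Topology MeasureTheory

section psh
variable {E : Type*} [NormedAddCommGroup E] [NormedSpace ℂ E]

def PSH (u : E → EReal) : Prop :=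
  UpperSemicontinuous u ∧ (∀ z, u z ≠ ⊤) ∧
    ∀ a b : E, SubharmonicOn (fun t : ℂ => u (a + t • b)) Set.univ

/-- real valued truncation from below -/
def tr (u : E → EReal) (L : ℝ) (x : E) : ℝ := (max (u x) ((-L : ℝ) : EReal)).toReal

lemma PSH.comp_affine {E' : Type*} [NormedAddCommGroup E'] [NormedSpace ℂ E'] {u : E → EReal} (hu : PSH u)
    (φ : E' → E) (hφ : Continuous φ) (ha : ∀ a b : E', ∃ b' : E, ∀ t : ℂ, φ (a + t • b) = φ a + t • b') :
    PSH (u ∘ φ) := by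
  refine ⟨UpperSemicontinuous.comp hu.1 hφ, fun z => hu.2.1 _, fun a b => ?_⟩
  obtain ⟨b', hb'⟩ := ha a b
  have := hu.2.2 (φ a) b'
  simpa only [Function.comp, hb'] using this

variable {u : E → EReal}

lemma tr_coe (hu : PSH u) (L : ℝ) (x : E) : ((tr u L x : ℝ) : EReal) = max (u x) ((-L : ℝ) : EReal) := by
  refine EReal.coe_toReal ?_ ?_
  · intro h
    rcases max_choice (u x) ((-L : ℝ) : EReal) with h' | h' <;> rw [h'] at h
    · exact hu.2.1 x h
    · exact EReal.coe_ne_top _ h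
  · intro h
    have := le_max_right (u x) ((-L : ℝ) : EReal)
    rw [h] at this
    exact EReal.coe_ne_bot _ (le_bot_iff.1 this)

lemma le_tr (hu : PSH u) (L : ℝ) (x : E) : u x ≤ (tr u L x : ℝ) := by
  rw [tr_coe hu]; exact le_max_left _ _

lemma neg_le_tr (hu : PSH u) (L : ℝ) (x : E) : -L ≤ tr u L x := by
  rw [← EReal.coe_le_coe_iff, tr_coe hu]; exact le_max_right _ _

lemma tr_le (hu : PSH u) {L : ℝ} {x : E} {c : ℝ} (h1 : u x ≤ (c : ℝ)) (h2 : -L ≤ c) : tr u L x ≤ c := by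
  rw [← EReal.coe_le_coe_iff, tr_coe hu]; exact max_le h1 (by exact_mod_cast h2)

lemma tr_usc (hu : PSH u) (L : ℝ) : UpperSemicontinuous (tr u L) := by
  intro x y hxy
  have h1 : u x < (y : ℝ) := lt_of_le_of_lt (le_tr hu L x) (by exact_mod_cast hxy)
  have h2 : -L < y := lt_of_le_of_lt (neg_le_tr hu L x) hxy
  filter_upwards [hu.1 x _ h1] with z hz
  rw [← EReal.coe_lt_coe_iff, tr_coe hu]
  exact max_lt hz (by exact_mod_cast h2)

lemma psh_bdd (hu : PSH u) {K : Set E} (hK : IsCompact K) : ∃ C : ℝ, 0 ≤ C ∧ ∀ x ∈ K, u x ≤ (C : ℝ) := by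
  have h0 := tr_usc hu 0
  have hcov : ∀ x ∈ K, ∃ U ∈ 𝓝[K] x, ∃ C : ℝ, ∀ y ∈ U, tr u 0 y ≤ C := by
    intro x _
    refine ⟨_, mem_nhdsWithin_of_mem_nhds (h0 x (tr u 0 x + 1) (by linarith)), tr u 0 x + 1, fun y hy => ?_⟩
    exact le_of_lt hy
  obtain ⟨C, hC⟩ : ∃ C : ℝ, ∀ y ∈ K, tr u 0 y ≤ C := by
    refine hK.induction_on (p := fun s => ∃ C : ℝ, ∀ y ∈ s, tr u 0 y ≤ C) ⟨0, by simp⟩ ?_ ?_ hcov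
    · rintro s t hst ⟨C, hC⟩; exact ⟨C, fun y hy => hC y (hst hy)⟩
    · rintro s t ⟨C, hC⟩ ⟨C', hC'⟩
      refine ⟨max C C', fun y hy => ?_⟩
      rcases hy with hy | hy
      · exact (hC y hy).trans (le_max_left _ _)
      · exact (hC' y hy).trans (le_max_right _ _)
  refine ⟨max C 0, le_max_right _ _, fun x hx => (le_tr hu 0 x).trans ?_⟩
  exact_mod_cast (hC x hx).trans (le_max_left _ _)

lemma tr_bdd [ProperSpace E] (hu : PSH u) (L : ℝ) (R : ℝ) : ∃ M : ℝ, ∀ x ∈ closedBall (0:E) R, |tr u L x| ≤ M := by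
  obtain ⟨C, hC0, hC⟩ := psh_bdd hu (isCompact_closedBall (0:E) R)
  refine ⟨C + |L|, fun x hx => abs_le.2 ⟨?_, ?_⟩⟩
  · have := neg_le_tr hu L x; have := le_abs_self L; linarith
  · refine tr_le hu ((hC x hx).trans ?_) ?_
    · have := abs_nonneg L
      exact_mod_cast (by linarith : C ≤ C + |L|)
    · have := neg_abs_le L; linarith [neg_le_abs L]

lemma tr_submean [ProperSpace E] (hu : PSH u) (L : ℝ) (x b : E) :
    tr u L x ≤ cm (fun t => tr u L (x + t • b)) := by
  obtain ⟨M, hM⟩ := tr_bdd hu L (‖x‖ + ‖b‖)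
  refine le_cm_usc (M := M) (UpperSemicontinuous.comp (tr_usc hu L) (by fun_prop)) ?_ ?_
  · intro z hz
    refine hM _ ?_
    rw [mem_closedBall_zero_iff]
    refine (norm_add_le _ _).trans ?_
    rw [norm_smul, mem_sphere_zero_iff_norm.1 hz, one_mul]
  · intro p hp
    refine tr_le hu ?_ ?_
    · have := (hu.2.2 x b).2 0 1 one_pos (subset_univ _) p
        (fun z hz => (le_tr hu L _).trans (by exact_mod_cast hp z hz)) 0 (by simp)
      simpa using this
    · rw [← cm_poly, ← cm_const (-L)]
      refine cm_mono (by simp) (ii_of_cont (Complex.continuous_re.comp p.continuous).continuousOn) ?_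
      intro z hz
      exact (neg_le_tr hu L _).trans (hp z hz)

end psh

section vol
variable {E : Type*} [NormedAddCommGroup E] [NormedSpace ℂ E] [FiniteDimensional ℂ E]
  [MeasurableSpace E] [BorelSpace E] (μ : Measure E) [μ.IsAddHaarMeasure]

lemma mp_rot {ζ : ℂ} (hζ : ‖ζ‖ = 1) : MeasurePreserving (fun y : E => ζ • y) μ μ := by
  have : FiniteDimensional ℝ E := FiniteDimensional.complexToReal E
  have hζ0 : ζ ≠ 0 := by rintro rfl; simp at hζ
  refine ⟨by fun_prop, ?_⟩
  set f : E →ₗ[ℝ] E := (LinearMap.lsmul ℂ E ζ).restrictScalars ℝ with hf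
  have hdet : LinearMap.det f ≠ 0 := by
    have : IsUnit f := by
      refine (Module.End.isUnit_iff f).2 ⟨?_, ?_⟩
      · intro x y hxy
        exact smul_right_injective E hζ0 hxy
      · intro y
        exact ⟨ζ⁻¹ • y, by simp [hf, smul_smul, hζ0]⟩
    exact (LinearMap.isUnit_det f this).ne_zero
  have h1 := Measure.map_linearMap_addHaar_eq_smul_addHaar μ hdet
  have h2 : Measure.map (fun y : E => ζ • y) μ = Measure.map f μ := rfl
  have h3 : (Measure.map f μ) (ball 0 1) = μ (ball 0 1) := by
    rw [Measure.map_apply (f := f) (by exact (continuous_const_smul ζ).measurable) measurableSet_ball]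
    congr 1
    ext y
    simp [hf, norm_smul, hζ]
  rw [h1, Measure.smul_apply, smul_eq_mul] at h3
  have hpos : μ (ball (0:E) 1) ≠ 0 := (measure_ball_pos μ 0 one_pos).ne'
  have hfin : μ (ball (0:E) 1) ≠ ⊤ := measure_ball_lt_top.ne
  have h4 : ENNReal.ofReal |(LinearMap.det f)⁻¹| = 1 := by
    have := congrArg (· / μ (ball (0:E) 1)) h3
    simpa [ENNReal.mul_div_cancel_right hpos hfin, ENNReal.div_self hpos hfin] using this
  rw [h2, h1, h4, one_smul]

lemma submean_vol {f : E → ℝ} (hm : Measurable f) {M : ℝ} {a : E} {R : ℝ}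
    (hM : ∀ x ∈ ball a R, |f x| ≤ M) (hs : ∀ b : E, f a ≤ cm (fun t => f (a + t • b))) :
    f a * μ.real (ball a R) ≤ ∫ x in ball a R, f x ∂μ := by
  have : FiniteDimensional ℝ E := FiniteDimensional.complexToReal E
  set g : E → ℝ := (ball (0:E) R).indicator (fun y => f (a + y)) with hg
  have hgm : Measurable g := (hm.comp (by fun_prop)).indicator measurableSet_ball
  have hfin : μ (ball (0:E) R) ≠ ⊤ := measure_ball_lt_top.ne
  have hgb : ∀ y, ‖g y‖ ≤ (ball (0:E) R).indicator (fun _ => M) y := by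
    intro y
    by_cases hy : y ∈ ball (0:E) R
    · rw [hg, indicator_of_mem hy, indicator_of_mem hy]
      exact hM _ (by simpa using hy)
    · rw [hg, indicator_of_notMem hy, indicator_of_notMem hy]; simp
  have hMi : Integrable ((ball (0:E) R).indicator (fun _ => M)) μ :=
    (integrable_indicator_iff measurableSet_ball).2 (integrableOn_const hfin)
  have hgi : Integrable g μ := hMi.mono' hgm.aestronglyMeasurable (Eventually.of_forall hgb)
  have e1 : ∫ x in ball a R, f x ∂μ = ∫ y, g y ∂μ := by
    rw [← integral_indicator measurableSet_ball, ← integral_add_left_eq_self _ a]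
    congr 1
    ext y
    simp only [hg, indicator]
    congr 1
    simp
  have e2 : ∀ θ : ℝ, ∫ y, g (Complex.exp (θ * Complex.I) • y) ∂μ = ∫ y, g y ∂μ := by
    intro θ
    have hz : ‖Complex.exp (θ * Complex.I)‖ = 1 := Complex.norm_exp_ofReal_mul_I θ
    refine (mp_rot μ hz).integral_comp (g := g) ?_
    have h0 : Complex.exp (θ * Complex.I) ≠ 0 := Complex.exp_ne_zero _
    exact (Homeomorph.smulOfNeZero _ h0).measurableEmbedding
  have hcontm : Measurable (fun p : E × ℝ => g (Complex.exp (p.2 * Complex.I) • p.1)) :=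
    hgm.comp (by fun_prop)
  set I2 : Measure ℝ := volume.restrict (Ioc 0 (2 * Real.pi)) with hI2
  have hItg : Integrable (fun p : E × ℝ => g (Complex.exp (p.2 * Complex.I) • p.1)) (μ.prod I2) := by
    have : Integrable (fun p : E × ℝ => (ball (0:E) R).indicator (fun _ => M) p.1) (μ.prod I2) :=
      hMi.comp_fst I2
    refine this.mono' hcontm.aestronglyMeasurable (Eventually.of_forall (fun p => ?_))
    refine (hgb _).trans (le_of_eq ?_)
    simp only [indicator, mem_ball_zero_iff, norm_smul, Complex.norm_exp_ofReal_mul_I, one_mul]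
  have e3 : ∫ y, (∫ θ, g (Complex.exp (θ * Complex.I) • y) ∂I2) ∂μ = (2 * Real.pi) * ∫ y, g y ∂μ := by
    rw [integral_integral_swap (f := fun y (θ : ℝ) => g (Complex.exp (θ * Complex.I) • y)) hItg]
    simp only [e2]
    rw [integral_const]
    simp [hI2, Measure.real, Real.pi_pos.le]
  have e4 : ∀ y, (2 * Real.pi) * ((ball (0:E) R).indicator (fun _ => f a) y) ≤
      ∫ θ, g (Complex.exp (θ * Complex.I) • y) ∂I2 := by
    intro y
    by_cases hy : y ∈ ball (0:E) R
    · rw [indicator_of_mem hy]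
      have h1 := hs y
      unfold cm at h1
      rw [le_inv_mul_iff₀ (by positivity)] at h1
      refine h1.trans (le_of_eq ?_)
      rw [intervalIntegral.integral_of_le (by positivity)]
      congr 1
      ext θ
      rw [hg, indicator_of_mem]
      simpa [norm_smul, Complex.norm_exp_ofReal_mul_I] using hy
    · rw [indicator_of_notMem hy]
      have : ∀ θ : ℝ, g (Complex.exp (θ * Complex.I) • y) = 0 := by
        intro θ
        rw [hg, indicator_of_notMem]
        simpa [norm_smul, Complex.norm_exp_ofReal_mul_I] using hy
      simp [this]
  have e5 := integral_mono (μ := μ) (f := fun y => (2 * Real.pi) * ((ball (0:E) R).indicator (fun _ => f a) y))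
    (((integrable_indicator_iff measurableSet_ball).2 (integrableOn_const hfin)).const_mul _) hItg.integral_prod_left e4
  rw [e3, integral_const_mul, integral_indicator measurableSet_ball, setIntegral_const] at e5
  have h6 := le_of_mul_le_mul_left e5 (by positivity)
  rw [e1]
  have h7 : μ.real (ball a R) = μ.real (ball 0 R) := by
    simp only [Measure.real]
    rw [Measure.addHaar_ball_center]
  rw [h7, mul_comm]
  simpa using h6
end vol
end Shch

namespace Shch
open Filter Topology MeasureTheory

instance instHaarCC : (volume : Measure (ℂ × ℂ)).IsAddHaarMeasure := by
  rw [Measure.volume_eq_prod]; infer_instance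

section vol
variable {E : Type*} [NormedAddCommGroup E] [NormedSpace ℂ E] [FiniteDimensional ℂ E]
  [MeasurableSpace E] [BorelSpace E] (μ : Measure E) [μ.IsAddHaarMeasure]

lemma bdd_integrableOn {f : E → ℝ} (hm : Measurable f) {M : ℝ} {a : E} {R : ℝ}
    (hM : ∀ x ∈ ball a R, |f x| ≤ M) : IntegrableOn f (ball a R) μ := by
  have : FiniteDimensional ℝ E := FiniteDimensional.complexToReal E
  refine Measure.integrableOn_of_bounded (M := M) measure_ball_lt_top.ne hm.aestronglyMeasurable ?_
  exact (ae_restrict_iff' measurableSet_ball).2 (Eventually.of_forall (fun x hx => hM x hx))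

lemma tr_meas {u : E → EReal} (hu : PSH u) (L : ℝ) : Measurable (tr u L) :=
  (tr_usc hu L).measurable

lemma tr_bdd_ball {u : E → EReal} (hu : PSH u) (L : ℝ) (a : E) (R : ℝ) :
    ∃ M : ℝ, ∀ x ∈ ball a R, |tr u L x| ≤ M := by
  have : ProperSpace E := FiniteDimensional.proper ℂ E
  obtain ⟨M, hM⟩ := tr_bdd hu L (‖a‖ + R)
  refine ⟨M, fun x hx => hM x ?_⟩
  rw [mem_closedBall_zero_iff]
  have h1 : ‖x - a‖ < R := by rwa [mem_ball, dist_eq_norm] at hx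
  calc ‖x‖ = ‖a + (x - a)‖ := by congr 1; abel
    _ ≤ _ := (norm_add_le _ _).trans (by linarith)

lemma psh_vol {u : E → EReal} (hu : PSH u) {a : E} (hua : u a ≠ ⊥) {R C : ℝ}
    {L : ℝ} :
    IntegrableOn (tr u L) (ball a R) μ ∧
    ∫ x in ball a R, (C - tr u L x) ∂μ ≤ μ.real (ball a R) * (C - (u a).toReal) := by
  have : ProperSpace E := FiniteDimensional.proper ℂ E
  obtain ⟨M, hM⟩ := tr_bdd_ball hu L a R
  have hi := bdd_integrableOn μ (tr_meas hu L) hM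
  refine ⟨hi, ?_⟩
  have h1 := submean_vol μ (tr_meas hu L) hM (tr_submean hu L a)
  have hfin : μ (ball a R) ≠ ⊤ := measure_ball_lt_top.ne
  have hc : Integrable (fun _ : E => C) (μ.restrict (ball a R)) := integrableOn_const hfin
  rw [integral_sub hc hi, setIntegral_const, smul_eq_mul, mul_sub]
  have h2 : (u a).toReal ≤ tr u L a := by
    have := le_tr hu L a
    rw [← EReal.coe_toReal (hu.2.1 a) hua] at this
    exact_mod_cast this
  have h3 : (u a).toReal * μ.real (ball a R) ≤ tr u L a * μ.real (ball a R) := by gcongr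
  linarith

lemma psh_dense {u : E → EReal} (hu : PSH u) {a : E} (hua : u a ≠ ⊥) {U : Set E} (hU : IsOpen U)
    (hne : U.Nonempty) : ∃ x ∈ U, u x ≠ ⊥ := by
  have : ProperSpace E := FiniteDimensional.proper ℂ E
  borelize E
  by_contra hcon
  push Not at hcon
  obtain ⟨y, hy⟩ := hne
  obtain ⟨δ, hδ, hb⟩ := Metric.isOpen_iff.1 hU y hy
  have : FiniteDimensional ℝ E := FiniteDimensional.complexToReal E
  set μ : Measure E := Measure.addHaar
  set R := dist y a + δ with hR
  have hsub : ball y δ ⊆ ball a R := ball_subset_ball' (by rw [hR]; linarith)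
  obtain ⟨C, hC0, hC⟩ := psh_bdd hu (isCompact_closedBall a R)
  have hpos : 0 < μ.real (ball y δ) := ENNReal.toReal_pos (measure_ball_pos μ y hδ).ne' measure_ball_lt_top.ne
  set T := μ.real (ball a R) * (C - (u a).toReal) with hT
  set L : ℝ := |T| / μ.real (ball y δ) + 1 with hL
  have hLpos : 0 < L := by positivity
  obtain ⟨hi, hle⟩ := psh_vol μ hu hua (R := R) (C := C) (L := L)
  have hfin : μ (ball a R) ≠ ⊤ := measure_ball_lt_top.ne
  have hi2 : IntegrableOn (fun x => C - tr u L x) (ball a R) μ := (integrableOn_const hfin).sub hi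
  have h1 : ∫ x in ball y δ, (C - tr u L x) ∂μ ≤ ∫ x in ball a R, (C - tr u L x) ∂μ := by
    refine setIntegral_mono_set hi2 ?_ (HasSubset.Subset.eventuallyLE hsub)
    refine (ae_restrict_iff' measurableSet_ball).2 (Eventually.of_forall (fun x hx => ?_))
    have := tr_le hu (L := L) (hC x (ball_subset_closedBall hx)) (by linarith)
    simp only [Pi.zero_apply]; linarith
  have h2 : ∫ x in ball y δ, (C - tr u L x) ∂μ = μ.real (ball y δ) * (C + L) := by
    rw [setIntegral_congr_fun (g := fun _ => C + L) measurableSet_ball, setIntegral_const, smul_eq_mul]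
    intro x hx
    have : tr u L x = -L := by
      unfold tr; rw [hcon x (hb hx), max_eq_right bot_le]; rfl
    simp only [this]; ring
  have h3 : μ.real (ball y δ) * L > T := by
    rw [hL, mul_add, mul_div_cancel₀ _ hpos.ne']
    have := le_abs_self T
    linarith
  have h4 : 0 ≤ μ.real (ball y δ) * C := by positivity
  rw [h2] at h1
  linarith
end vol

lemma exists_moll {f : ℂ × ℂ → ℝ} (hm : Measurable f)
    (hb : ∀ a R, ∃ M, ∀ x ∈ ball a R, |f x| ≤ M)
    (hsub : ∀ x b, f x ≤ cm (fun t => f (x + t • b))) {ε : ℝ} (hε : 0 < ε) :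
    ∃ s : ℂ × ℂ → ℝ, ContDiff ℝ 2 s ∧ (∀ x b, s x ≤ cm (fun t => s (x + t • b))) ∧
      (∀ x K, (∀ y ∈ ball x ε, f y ≤ K) → s x ≤ K) ∧
      (∀ x R C, (∀ y ∈ ball x (R + ε), f y ≤ C) →
        ∫ y in ball x R, (C - s y) ≤ ∫ y in ball x (R + ε), (C - f y)) := by
  set φ : ContDiffBump (0 : ℂ × ℂ) := ⟨ε / 2, ε, by positivity, by linarith⟩
  set w : ℂ × ℂ → ℝ := φ.normed volume with hw
  have w0 : ∀ y, 0 ≤ w y := φ.nonneg_normed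
  have w1 : ∫ y, w y = 1 := φ.integral_normed
  have wi : Integrable w := φ.integrable_normed
  have wm : Measurable w := φ.continuous_normed.measurable
  have ws : ∀ y, y ∉ ball (0 : ℂ × ℂ) ε → w y = 0 := by
    intro y hy
    by_contra h
    have : y ∈ Function.support w := h
    rw [hw, φ.support_normed_eq] at this
    exact hy this
  -- dominated integrability
  have wint : ∀ (g : ℂ × ℂ → ℝ) (M : ℝ), Measurable g → (∀ y ∈ ball (0 : ℂ × ℂ) ε, |g y| ≤ M) →
      Integrable (fun y => w y * g y) := by
    intro g M hg hM
    refine (wi.mul_const M).mono' (wm.mul hg).aestronglyMeasurable (Eventually.of_forall (fun y => ?_))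
    by_cases hy : y ∈ ball (0 : ℂ × ℂ) ε
    · rw [norm_mul, Real.norm_eq_abs, Real.norm_eq_abs, abs_of_nonneg (w0 y)]
      exact mul_le_mul_of_nonneg_left (hM y hy) (w0 y)
    · simp [ws y hy]
  have hloc : LocallyIntegrable f volume := by
    intro x
    obtain ⟨M, hM⟩ := hb x 1
    exact ⟨ball x 1, ball_mem_nhds x one_pos, bdd_integrableOn volume hm hM⟩
  have hfb : ∀ x, ∃ M, ∀ y ∈ ball (0 : ℂ × ℂ) ε, |f (x - y)| ≤ M := by
    intro x
    obtain ⟨M, hM⟩ := hb x ε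
    exact ⟨M, fun y hy => hM _ (by simpa using hy)⟩
  have hfi : ∀ x, Integrable (fun y => w y * f (x - y)) := by
    intro x
    obtain ⟨M, hM⟩ := hfb x
    exact wint _ M (hm.comp (by fun_prop)) hM
  set s : ℂ × ℂ → ℝ := fun x => ∫ y, w y * f (x - y) with hs
  have hsC : ContDiff ℝ 2 s := by
    have := (φ.hasCompactSupport_normed (μ := volume)).contDiff_convolution_left
      (ContinuousLinearMap.lsmul ℝ ℝ) (n := 2) φ.contDiff_normed hloc
    exact this
  refine ⟨s, hsC, ?_, ?_, ?_⟩
  · intro x b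
    obtain ⟨M, hM⟩ := hb x (‖b‖ + ε)
    have hM0 : ∀ t : ℂ, ‖t‖ = 1 → ∀ y ∈ ball (0 : ℂ × ℂ) ε, |f (x + t • b - y)| ≤ M := by
      intro t ht y hy
      refine hM _ ?_
      rw [mem_ball, dist_eq_norm]
      have e : x + t • b - y - x = t • b - y := by abel
      rw [e]
      refine lt_of_le_of_lt (norm_sub_le _ _) ?_
      rw [norm_smul, ht, one_mul]
      have := mem_ball_zero_iff.1 hy
      linarith
    set I2 : Measure ℝ := volume.restrict (Ioc 0 (2 * Real.pi)) with hI2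
    have hItg : Integrable (fun p : (ℂ × ℂ) × ℝ => w p.1 * f (x + Complex.exp (p.2 * Complex.I) • b - p.1))
        ((volume : Measure (ℂ × ℂ)).prod I2) := by
      have h0 : Integrable (fun p : (ℂ × ℂ) × ℝ => w p.1 * M) ((volume : Measure (ℂ × ℂ)).prod I2) :=
        (wi.mul_const M).comp_fst I2
      refine h0.mono' (Measurable.aestronglyMeasurable ?_) (Eventually.of_forall (fun p => ?_))
      · exact (wm.comp measurable_fst).mul (hm.comp (by fun_prop))
      · by_cases hy : p.1 ∈ ball (0 : ℂ × ℂ) ε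
        · rw [norm_mul, Real.norm_eq_abs, Real.norm_eq_abs, abs_of_nonneg (w0 _)]
          exact mul_le_mul_of_nonneg_left (hM0 _ (Complex.norm_exp_ofReal_mul_I _) _ hy) (w0 _)
        · simp [ws _ hy]
    have e1 : cm (fun t => s (x + t • b)) = (2 * Real.pi)⁻¹ *
        ∫ y, ∫ θ, w y * f (x + Complex.exp ((θ:ℝ) * Complex.I) • b - y) ∂I2 := by
      unfold cm
      rw [intervalIntegral.integral_of_le (by positivity)]
      rw [integral_integral_swap (f := fun y (θ : ℝ) => w y * f (x + Complex.exp ((θ:ℝ) * Complex.I) • b - y)) hItg]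
    rw [e1, ← integral_const_mul]
    refine integral_mono (hfi x) (hItg.integral_prod_left.const_mul _) (fun y => ?_)
    have h2 := hsub (x - y) b
    simp only
    rw [integral_const_mul, mul_left_comm]
    refine mul_le_mul_of_nonneg_left ?_ (w0 y)
    unfold cm at h2
    rw [intervalIntegral.integral_of_le (by positivity)] at h2
    have e2 : ∀ θ : ℝ, x + Complex.exp (θ * Complex.I) • b - y = x - y + Complex.exp (θ * Complex.I) • b :=
      fun θ => by abel
    simp only [e2]
    exact h2
  · intro x K hK
    calc s x ≤ ∫ y, w y * K := by
          refine integral_mono (hfi x) (wi.mul_const K) (fun y => ?_)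
          by_cases hy : y ∈ ball (0 : ℂ × ℂ) ε
          · exact mul_le_mul_of_nonneg_left (hK _ (by simpa using hy)) (w0 y)
          · simp [ws y hy]
      _ = K := by rw [integral_mul_const, w1, one_mul]
  · intro x R C hC
    set A : Measure (ℂ × ℂ) := volume.restrict (ball x R) with hA
    obtain ⟨M, hM⟩ := hb x (R + ε)
    have : IsFiniteMeasure A := ⟨by simp only [hA, Measure.restrict_apply_univ]; exact measure_ball_lt_top⟩
    have e1 : ∀ z, C - s z = ∫ y, w y * (C - f (z - y)) := by
      intro z
      simp only [mul_sub]
      rw [integral_sub (wi.mul_const C) (hfi z), integral_mul_const, w1, one_mul]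
    have hItg : Integrable (fun p : (ℂ × ℂ) × (ℂ × ℂ) => w p.2 * (C - f (p.1 - p.2))) (A.prod volume) := by
      have h0 : Integrable (fun p : (ℂ × ℂ) × (ℂ × ℂ) => w p.2 * (|C| + M)) (A.prod volume) :=
        (wi.mul_const (|C| + M)).comp_snd A
      refine h0.mono' (Measurable.aestronglyMeasurable ?_) ?_
      · exact (wm.comp measurable_snd).mul (measurable_const.sub (hm.comp (by fun_prop)))
      · have hae : ∀ᵐ p ∂(A.prod (volume : Measure (ℂ × ℂ))), p.1 ∈ ball x R := by
          have : ∀ᵐ z ∂A, z ∈ ball x R := ae_restrict_mem measurableSet_ball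
          exact Measure.quasiMeasurePreserving_fst.ae this
        filter_upwards [hae] with p hp
        by_cases hy : p.2 ∈ ball (0 : ℂ × ℂ) ε
        · rw [norm_mul, Real.norm_eq_abs, Real.norm_eq_abs, abs_of_nonneg (w0 _)]
          refine mul_le_mul_of_nonneg_left ?_ (w0 _)
          refine (abs_sub _ _).trans ?_
          have : |f (p.1 - p.2)| ≤ M := by
            refine hM _ ?_
            rw [mem_ball, dist_eq_norm] at hp ⊢
            have e : p.1 - p.2 - x = (p.1 - x) - p.2 := by abel
            rw [e]
            have := mem_ball_zero_iff.1 hy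
            exact lt_of_le_of_lt (norm_sub_le _ _) (by linarith)
          linarith
        · simp [ws _ hy]
    have hfI : IntegrableOn (fun y => C - f y) (ball x (R + ε)) :=
      (integrableOn_const measure_ball_lt_top.ne).sub (bdd_integrableOn volume hm hM)
    calc ∫ y in ball x R, (C - s y) = ∫ y, ∫ z, w y * (C - f (z - y)) ∂A := by
          simp only [e1]
          exact integral_integral_swap (f := fun z y => w y * (C - f (z - y))) hItg
      _ ≤ ∫ z, w z * ∫ y in ball x (R + ε), (C - f y) := by
          refine integral_mono hItg.integral_prod_right (wi.mul_const _) (fun y => ?_)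
          simp only
          rw [integral_const_mul]
          by_cases hy : y ∈ ball (0 : ℂ × ℂ) ε
          · refine mul_le_mul_of_nonneg_left ?_ (w0 y)
            have e2 : ∫ z, (C - f (z - y)) ∂A = ∫ z in ball (x - y) R, (C - f z) := by
              rw [hA, ← integral_indicator measurableSet_ball, ← integral_indicator measurableSet_ball,
                ← integral_sub_right_eq_self ((ball (x - y) R).indicator (fun z => C - f z)) y]
              congr 1
              ext z
              simp only [indicator, mem_ball, dist_eq_norm]
              congr 2
              rw [sub_sub_sub_cancel_right]
            rw [e2]
            have hsubs : ball (x - y) R ⊆ ball x (R + ε) := by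
              refine ball_subset_ball' ?_
              have := mem_ball_zero_iff.1 hy
              simp [dist_eq_norm]; linarith
            refine setIntegral_mono_set hfI ?_ (HasSubset.Subset.eventuallyLE hsubs)
            refine (ae_restrict_iff' measurableSet_ball).2 (Eventually.of_forall (fun z hz => ?_))
            have := hC z hz
            simp only [Pi.zero_apply]; linarith
          · simp [ws y hy]
      _ = _ := by rw [integral_mul_const, w1, one_mul]
end Shch

namespace Shch
open Filter Topology MeasureTheory

def lap (f : ℂ → ℝ) (z : ℂ) : ℝ :=
  fderiv ℝ (fun y => fderiv ℝ f y 1) z 1 + fderiv ℝ (fun y => fderiv ℝ f y Complex.I) z Complex.I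

lemma contDiff_one_dir {f : ℂ → ℝ} (hf : ContDiff ℝ 2 f) (v : ℂ) : ContDiff ℝ 1 (fun y => fderiv ℝ f y v) :=
  (hf.fderiv_right (by norm_num)).clm_apply contDiff_const

lemma cont_dir2 {f : ℂ → ℝ} (hf : ContDiff ℝ 2 f) (v : ℂ) :
    Continuous (fun z => fderiv ℝ (fun y => fderiv ℝ f y v) z v) :=
  ((contDiff_one_dir hf v).continuous_fderiv (by norm_num)).clm_apply continuous_const

lemma lap_cont {f : ℂ → ℝ} (hf : ContDiff ℝ 2 f) : Continuous (lap f) :=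
  (cont_dir2 hf 1).add (cont_dir2 hf Complex.I)

lemma ibp_dir {φ σ : ℂ → ℝ} (hφ : ContDiff ℝ 1 φ) (hσ : ContDiff ℝ 1 σ) (v : ℂ)
    (hc : HasCompactSupport φ ∨ HasCompactSupport σ) :
    ∫ z, φ z * fderiv ℝ σ z v = - ∫ z, fderiv ℝ φ z v * σ z := by
  have c1 : Continuous (fun z => fderiv ℝ φ z v) := (hφ.continuous_fderiv (by norm_num)).clm_apply continuous_const
  have c2 : Continuous (fun z => fderiv ℝ σ z v) := (hσ.continuous_fderiv (by norm_num)).clm_apply continuous_const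
  have hd1 := hφ.differentiable (by norm_num)
  have hd2 := hσ.differentiable (by norm_num)
  refine integral_mul_fderiv_eq_neg_fderiv_mul_of_integrable ?_ ?_ ?_ (fun x _ => hd1 x) (fun x _ => hd2 x)
  · refine (c1.mul hσ.continuous).integrable_of_hasCompactSupport ?_
    rcases hc with hc | hc
    · exact (hc.fderiv_apply ℝ v).mul_right
    · exact hc.mul_left
  · refine (hφ.continuous.mul c2).integrable_of_hasCompactSupport ?_
    rcases hc with hc | hc
    · exact hc.mul_right
    · exact (hc.fderiv_apply ℝ v).mul_left
  · refine (hφ.continuous.mul hσ.continuous).integrable_of_hasCompactSupport ?_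
    rcases hc with hc | hc
    · exact hc.mul_right
    · exact hc.mul_left

lemma ibp_lap {φ σ : ℂ → ℝ} (hφ : ContDiff ℝ 2 φ) (hσ : ContDiff ℝ 2 σ) (hc : HasCompactSupport φ) :
    ∫ z, φ z * lap σ z = ∫ z, lap φ z * σ z := by
  have h2 : ∀ v, ∫ z, φ z * fderiv ℝ (fun y => fderiv ℝ σ y v) z v =
      ∫ z, fderiv ℝ (fun y => fderiv ℝ φ y v) z v * σ z := by
    intro v
    rw [ibp_dir (hφ.of_le (by norm_num)) (contDiff_one_dir hσ v) v (Or.inl hc),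
      ibp_dir (contDiff_one_dir hφ v) (hσ.of_le (by norm_num)) v (Or.inl (hc.fderiv_apply ℝ v)), neg_neg]
  have i1 : ∀ v, Integrable (fun z => φ z * fderiv ℝ (fun y => fderiv ℝ σ y v) z v) := fun v =>
    (hφ.continuous.mul (cont_dir2 hσ v)).integrable_of_hasCompactSupport hc.mul_right
  have i2 : ∀ v, Integrable (fun z => fderiv ℝ (fun y => fderiv ℝ φ y v) z v * σ z) := fun v =>
    ((cont_dir2 hφ v).mul hσ.continuous).integrable_of_hasCompactSupport
      ((hc.fderiv_apply ℝ v).fderiv_apply ℝ v).mul_right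
  unfold lap
  simp only [mul_add, add_mul]
  rw [integral_add (i1 _) (i1 _), integral_add (i2 _) (i2 _), h2, h2]

lemma exists_ell : ∃ (l l1 l2 : ℝ → ℝ) (B0 : ℝ), 0 ≤ B0 ∧ (∀ x > 0, HasDerivAt l (l1 x) x) ∧
    (∀ x > 0, HasDerivAt l1 (l2 x) x) ∧ (∀ x > 0, ContDiffAt ℝ 2 l x) ∧
    (∀ x, 0 < x → x < 1/2 → l1 x = x⁻¹ ∧ l2 x = -(x ^ 2)⁻¹) ∧
    (∀ x, 1/4 ≤ x → x ≤ 1 → |l1 x| ≤ B0 ∧ |l2 x| ≤ B0) ∧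
    (∀ x, 1 ≤ x → l x = 0 ∧ l1 x = 0 ∧ l2 x = 0) ∧
    (∀ x, 0 < x → x ≤ 1 → Real.log x ≤ l x) := by
  set χ : ℝ → ℝ := fun x => 1 - Real.smoothTransition (4 * x - 2) with hχ
  have hχs : ContDiff ℝ 4 χ := contDiff_const.sub
    (Real.smoothTransition.contDiff.comp ((contDiff_const.mul contDiff_id).sub contDiff_const))
  set l : ℝ → ℝ := fun x => χ x * Real.log x with hl
  have hc4 : ∀ x > 0, ContDiffAt ℝ 4 l x := fun x hx =>
    hχs.contDiffAt.mul (Real.contDiffAt_log.2 hx.ne')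
  have hon : ContDiffOn ℝ 4 l (Ioi 0) := fun x hx => (hc4 x hx).contDiffWithinAt
  have hon1 : ContDiffOn ℝ 3 (deriv l) (Ioi 0) := hon.deriv_of_isOpen isOpen_Ioi (by norm_num)
  have hon2 : ContDiffOn ℝ 2 (deriv (deriv l)) (Ioi 0) := hon1.deriv_of_isOpen isOpen_Ioi (by norm_num)
  have hsub : Icc (1/4:ℝ) 1 ⊆ Ioi 0 := fun x hx => lt_of_lt_of_le (by norm_num) hx.1
  obtain ⟨B1, hB1⟩ := isCompact_Icc.exists_bound_of_continuousOn (hon1.continuousOn.mono hsub)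
  obtain ⟨B2, hB2⟩ := isCompact_Icc.exists_bound_of_continuousOn (hon2.continuousOn.mono hsub)
  have hχ01 : ∀ x, 0 ≤ χ x ∧ χ x ≤ 1 := fun x =>
    ⟨by simp only [hχ]; linarith [Real.smoothTransition.le_one (4 * x - 2)],
     by simp only [hχ]; linarith [Real.smoothTransition.nonneg (4 * x - 2)]⟩
  have hχ1 : ∀ x, x ≤ 1/2 → χ x = 1 := fun x hx => by
    simp only [hχ]; rw [Real.smoothTransition.zero_of_nonpos (by linarith)]; ring
  have hχ0 : ∀ x, 3/4 ≤ x → χ x = 0 := fun x hx => by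
    simp only [hχ]; rw [Real.smoothTransition.one_of_one_le (by linarith)]; ring
  refine ⟨l, deriv l, deriv (deriv l), max 0 (max B1 B2), le_max_left _ _, ?_, ?_, ?_, ?_, ?_, ?_, ?_⟩
  · intro x hx
    exact ((hc4 x hx).differentiableAt (by norm_num)).hasDerivAt
  · intro x hx
    exact ((hon1.contDiffAt (Ioi_mem_nhds hx)).differentiableAt (by norm_num)).hasDerivAt
  · intro x hx
    exact (hc4 x hx).of_le (by norm_num)
  · intro x h0 hx
    have e1 : ∀ y, 0 < y → y < 1/2 → deriv l y = y⁻¹ := by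
      intro y hy0 hy
      have : l =ᶠ[𝓝 y] Real.log := by
        filter_upwards [Iio_mem_nhds hy] with w hw
        simp only [hl]; rw [hχ1 w (le_of_lt hw), one_mul]
      rw [this.deriv_eq, Real.deriv_log]
    refine ⟨e1 x h0 hx, ?_⟩
    have : deriv l =ᶠ[𝓝 x] fun y => y⁻¹ := by
      filter_upwards [Iio_mem_nhds hx, Ioi_mem_nhds h0] with w hw hw'
      exact e1 w hw' hw
    rw [this.deriv_eq, deriv_inv]
  · intro x hx hx1
    have a1 := hB1 x ⟨hx, hx1⟩
    have a2 := hB2 x ⟨hx, hx1⟩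
    rw [Real.norm_eq_abs] at a1 a2
    exact ⟨a1.trans ((le_max_left _ _).trans (le_max_right _ _)), a2.trans ((le_max_right _ _).trans (le_max_right _ _))⟩
  · intro x hx
    have e0 : ∀ y, 3/4 ≤ y → l y = 0 := fun y hy => by simp only [hl]; rw [hχ0 y hy, zero_mul]
    have e1 : ∀ y, 3/4 < y → deriv l y = 0 := by
      intro y hy
      have : l =ᶠ[𝓝 y] fun _ => 0 := by
        filter_upwards [Ioi_mem_nhds hy] with w hw
        exact e0 w (le_of_lt hw)
      rw [this.deriv_eq, deriv_const]
    refine ⟨e0 x (by linarith), e1 x (by linarith), ?_⟩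
    have : deriv l =ᶠ[𝓝 x] fun _ => 0 := by
      filter_upwards [Ioi_mem_nhds (show (3/4:ℝ) < x by linarith)] with w hw
      exact e1 w hw
    rw [this.deriv_eq, deriv_const]
  · intro x h0 hx
    have h1 : Real.log x ≤ 0 := Real.log_nonpos h0.le hx
    simp only [hl]
    nlinarith [(hχ01 x).2]

/-- squared distance -/
def ns (W ζ : ℂ) : ℝ := (ζ - W).re ^ 2 + (ζ - W).im ^ 2

lemma ns_eq (W ζ : ℂ) : ns W ζ = ‖ζ - W‖ ^ 2 := by
  rw [← Complex.normSq_eq_norm_sq, Complex.normSq_apply, ns]; ring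

lemma ns_contDiff (W : ℂ) : ContDiff ℝ 2 (ns W) := by
  have h1 : ContDiff ℝ 2 (fun ζ : ℂ => (ζ - W).re) := Complex.reCLM.contDiff.comp (contDiff_id.sub contDiff_const)
  have h2 : ContDiff ℝ 2 (fun ζ : ℂ => (ζ - W).im) := Complex.imCLM.contDiff.comp (contDiff_id.sub contDiff_const)
  exact (h1.pow 2).add (h2.pow 2)

lemma hasFDerivAt_ns (W ζ : ℂ) : HasFDerivAt (ns W)
    ((2 * (ζ - W).re) • Complex.reCLM + (2 * (ζ - W).im) • Complex.imCLM) ζ := by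
  have h1 : HasFDerivAt (fun ζ : ℂ => (ζ - W).re) Complex.reCLM ζ :=
    HasFDerivAt.congr_fderiv (f := fun ζ : ℂ => (ζ - W).re)
      (Complex.reCLM.hasFDerivAt.comp ζ ((hasFDerivAt_id ζ).sub_const W)) (by ext; simp)
  have h2 : HasFDerivAt (fun ζ : ℂ => (ζ - W).im) Complex.imCLM ζ :=
    HasFDerivAt.congr_fderiv (f := fun ζ : ℂ => (ζ - W).im)
      (Complex.imCLM.hasFDerivAt.comp ζ ((hasFDerivAt_id ζ).sub_const W)) (by ext; simp)
  have := (h1.pow 2).add (h2.pow 2)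
  refine HasFDerivAt.congr_fderiv (f := ns W) this ?_
  ext <;> simp

lemma lap_radial {l l1 l2 : ℝ → ℝ} (h1 : ∀ x > 0, HasDerivAt l (l1 x) x)
    (h2 : ∀ x > 0, HasDerivAt l1 (l2 x) x) {W : ℂ} {κ k : ℝ} (hκ : 0 < κ) (hk : 0 < k) (ζ : ℂ) :
    lap (fun ζ => l (k * (ns W ζ + κ))) ζ =
      4 * k * l1 (k * (ns W ζ + κ)) + 4 * k ^ 2 * ns W ζ * l2 (k * (ns W ζ + κ)) := by
  have hpos : ∀ ζ, 0 < k * (ns W ζ + κ) := fun ζ => by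
    have : 0 ≤ ns W ζ := by unfold ns; positivity
    positivity
  set N : ℂ → ℝ := fun ζ => k * (ns W ζ + κ) with hN
  have hNd : ∀ ζ, HasFDerivAt N (k • ((2 * (ζ - W).re) • Complex.reCLM + (2 * (ζ - W).im) • Complex.imCLM)) ζ :=
    fun ζ => ((hasFDerivAt_ns W ζ).add_const κ).const_mul k
  have hd : ∀ y, HasFDerivAt (fun ζ => l (N ζ)) (l1 (N y) •
      (k • ((2 * (y - W).re) • Complex.reCLM + (2 * (y - W).im) • Complex.imCLM))) y := fun y =>
    (h1 (N y) (hpos y)).comp_hasFDerivAt y (hNd y)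
  have hd1 : ∀ y, HasFDerivAt (fun ζ => l1 (N ζ)) (l2 (N y) •
      (k • ((2 * (y - W).re) • Complex.reCLM + (2 * (y - W).im) • Complex.imCLM))) y := fun y =>
    (h2 (N y) (hpos y)).comp_hasFDerivAt y (hNd y)
  have r1 : HasFDerivAt (fun ζ : ℂ => (ζ - W).re) Complex.reCLM ζ :=
    HasFDerivAt.congr_fderiv (f := fun ζ : ℂ => (ζ - W).re)
      (Complex.reCLM.hasFDerivAt.comp ζ ((hasFDerivAt_id ζ).sub_const W)) (by ext; simp)
  have r2 : HasFDerivAt (fun ζ : ℂ => (ζ - W).im) Complex.imCLM ζ :=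
    HasFDerivAt.congr_fderiv (f := fun ζ : ℂ => (ζ - W).im)
      (Complex.imCLM.hasFDerivAt.comp ζ ((hasFDerivAt_id ζ).sub_const W)) (by ext; simp)
  have e1 : (fun y => fderiv ℝ (fun ζ => l (N ζ)) y 1) = fun y => l1 (N y) * ((2 * k) * (y - W).re) := by
    funext y; rw [(hd y).fderiv]; simp; exact Or.inl (by ring)
  have e2 : (fun y => fderiv ℝ (fun ζ => l (N ζ)) y Complex.I) = fun y => l1 (N y) * ((2 * k) * (y - W).im) := by
    funext y; rw [(hd y).fderiv]; simp; exact Or.inl (by ring)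
  unfold lap
  have g1 : HasFDerivAt (fun y => l1 (N y) * ((2 * k) * (y - W).re)) _ ζ := (hd1 ζ).mul (r1.const_mul (2 * k))
  have g2 : HasFDerivAt (fun y => l1 (N y) * ((2 * k) * (y - W).im)) _ ζ := (hd1 ζ).mul (r2.const_mul (2 * k))
  rw [e1, e2, g1.fderiv, g2.fderiv]
  simp [ns, hN]
  ring
end Shch

namespace Shch
open Filter Topology MeasureTheory

lemma lap_nonneg {σ : ℂ → ℝ} (hσ : ContDiff ℝ 2 σ)
    (hsub : ∀ x b, σ x ≤ cm (fun t => σ (x + t • b))) (z : ℂ) : 0 ≤ lap σ z := by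
  obtain ⟨A, H, hH, hs, hT⟩ := taylor_two_expl hσ z
  have h := levi_of_submean (κ := 0) hσ.continuous hs hT (fun b => by
    have := hsub z b
    simpa [cm] using this) 1
  have hF1 : ContDiff ℝ 1 (fderiv ℝ σ) := hσ.fderiv_right (by norm_num)
  have hd2 : HasFDerivAt (fderiv ℝ σ) (fderiv ℝ (fderiv ℝ σ) z) z :=
    ((hF1.differentiable (by norm_num)) z).hasFDerivAt
  have e : ∀ v : ℂ, fderiv ℝ (fun y => fderiv ℝ σ y v) z v = fderiv ℝ (fderiv ℝ σ) z v v := by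
    intro v
    have := hd2.clm_apply (hasFDerivAt_const v z)
    rw [this.fderiv]
    simp
  unfold lap
  rw [e, e]
  rw [hH] at h
  simp at h
  linarith

lemma mass_bound (W1 : ℂ) {r0 : ℝ} (hr : 0 < r0) : ∃ B2, 0 ≤ B2 ∧ ∀ σ : ℂ → ℝ, ContDiff ℝ 2 σ →
    (∀ z, 0 ≤ lap σ z) → (∀ z ∈ ball W1 (5 * r0), σ z ≤ 0) →
    ∫ z in closedBall W1 (4 * r0), lap σ z ≤ B2 * ∫ z in ball W1 (5 * r0), (- σ z) := by
  set χ : ContDiffBump W1 := ⟨4 * r0, 9 / 2 * r0, by positivity, by linarith⟩ with hχ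
  have hχs : ContDiff ℝ 2 χ := χ.contDiff
  have hχc : HasCompactSupport χ := χ.hasCompactSupport
  have hzero : ∀ z, z ∉ ball W1 (5 * r0) → lap χ z = 0 := by
    intro z hz
    have hz' : 9 / 2 * r0 < dist z W1 := by
      rw [mem_ball, not_lt] at hz; linarith
    have hev : ∀ᶠ y in 𝓝 z, (χ : ℂ → ℝ) y = 0 := by
      filter_upwards [(isOpen_lt continuous_const (continuous_id.dist continuous_const)).mem_nhds hz'] with y hy
      exact χ.zero_of_le_dist (le_of_lt hy)
    have hf : ∀ᶠ y in 𝓝 z, fderiv ℝ χ y = 0 := by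
      filter_upwards [hev.eventually_nhds] with y hy
      have : (χ : ℂ → ℝ) =ᶠ[𝓝 y] fun _ => 0 := hy
      rw [this.fderiv_eq]; simp
    have h2 : ∀ v, fderiv ℝ (fun y => fderiv ℝ χ y v) z = 0 := by
      intro v
      have : (fun y => fderiv ℝ χ y v) =ᶠ[𝓝 z] fun _ => 0 := by
        filter_upwards [hf] with y hy; rw [hy]; rfl
      rw [this.fderiv_eq]; simp
    unfold lap
    rw [h2, h2]; simp
  have hcl : Continuous (lap χ) := lap_cont hχs
  obtain ⟨B, hB⟩ := (isCompact_closedBall W1 (5 * r0)).exists_bound_of_continuousOn hcl.continuousOn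
  refine ⟨max B 0, le_max_right _ _, fun σ hσ hl hneg => ?_⟩
  have hlc := lap_cont hσ
  have iK : IntegrableOn (lap σ) (closedBall W1 (4 * r0)) := hlc.continuousOn.integrableOn_compact (isCompact_closedBall _ _)
  have i1 : Integrable (fun z => χ z * lap σ z) :=
    (hχs.continuous.mul hlc).integrable_of_hasCompactSupport hχc.mul_right
  have s1 : ∫ z in closedBall W1 (4 * r0), lap σ z ≤ ∫ z, χ z * lap σ z := by
    rw [← integral_indicator measurableSet_closedBall]
    refine integral_mono (iK.integrable_indicator measurableSet_closedBall) i1 fun z => ?_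
    by_cases hz : z ∈ closedBall W1 (4 * r0)
    · simp only [indicator_of_mem hz]
      rw [χ.one_of_mem_closedBall hz, one_mul]
    · simp only [indicator_of_notMem hz]
      exact mul_nonneg χ.nonneg (hl z)
  have s2 : ∫ z, lap χ z * σ z = ∫ z in ball W1 (5 * r0), lap χ z * σ z := by
    rw [setIntegral_eq_integral_of_forall_compl_eq_zero]
    intro z hz; rw [hzero z hz, zero_mul]
  have io : ∀ g : ℂ → ℝ, Continuous g → IntegrableOn g (ball W1 (5 * r0)) := fun g hg =>
    (hg.continuousOn.integrableOn_compact (isCompact_closedBall W1 (5 * r0))).mono_set ball_subset_closedBall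
  rw [ibp_lap hχs hσ hχc, s2] at s1
  refine s1.trans ?_
  rw [← integral_const_mul]
  refine setIntegral_mono_on (io _ (hcl.mul hσ.continuous)) (io _ (continuous_const.mul hσ.continuous.neg)) measurableSet_ball ?_
  intro z hz
  have h1 := hB z (ball_subset_closedBall hz)
  rw [Real.norm_eq_abs] at h1
  have h2 := hneg z hz
  have h3 := neg_abs_le (lap χ z)
  have h4 := le_max_left B 0
  nlinarith

set_option maxHeartbeats 1000000 in
lemma test_lower {R : ℝ} (hR : 0 < R) : ∃ B, 0 ≤ B ∧ ∀ (W : ℂ) (σ : ℂ → ℝ), ContDiff ℝ 2 σ →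
    (∀ z ∈ closedBall W R, σ z ≤ 0) → σ W < -1 → ∃ ψ : ℂ → ℝ, Continuous ψ ∧
      (∀ ζ ∈ closedBall W R, ζ ≠ W → ψ ζ ≤ Real.log (2 * R ^ 2) - 2 * Real.log ‖ζ - W‖) ∧
      Real.pi * (- σ W - 1) ≤ B * (∫ z in closedBall W R, (- σ z)) + ∫ z in closedBall W R, ψ z * lap σ z := by
  obtain ⟨l, l1, l2, B0, hB0, hl, hl1, hlC, hlog, hbd, hz, hge⟩ := exists_ell
  refine ⟨8 * B0 / R ^ 2, by positivity, fun W σ hσ hneg hW => ?_⟩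
  obtain ⟨δ, hδ, hδσ⟩ : ∃ δ > 0, ∀ y, dist y W < δ → σ y ≤ σ W + 1 := by
    obtain ⟨δ, hδ, h⟩ := Metric.continuous_iff.1 hσ.continuous W 1 one_pos
    refine ⟨δ, hδ, fun y hy => ?_⟩
    have := h y hy
    rw [Real.dist_eq] at this
    linarith [(abs_lt.1 this).2]
  obtain ⟨κ, hκ, hκR, hκδ⟩ : ∃ κ : ℝ, 0 < κ ∧ κ ≤ R ^ 2 / 8 ∧ κ < δ ^ 2 :=
    ⟨min (R ^ 2 / 8) (δ ^ 2 / 2), by positivity, min_le_left _ _,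
      lt_of_le_of_lt (min_le_right _ _) (by nlinarith [sq_pos_of_pos hδ])⟩
  set k : ℝ := 1 / (R ^ 2 + κ) with hk
  have hR2 : 0 < R ^ 2 := by positivity
  have hkpos : 0 < k := by positivity
  have hkR : k * (R ^ 2 + κ) = 1 := by rw [hk]; field_simp
  have hns0 : ∀ ζ, 0 ≤ ns W ζ := fun ζ => by unfold ns; positivity
  have hpos : ∀ ζ, 0 < k * (ns W ζ + κ) := fun ζ => by have := hns0 ζ; positivity
  set φ : ℂ → ℝ := fun ζ => l (k * (ns W ζ + κ)) with hφ
  have hφC : ContDiff ℝ 2 φ := by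
    rw [contDiff_iff_contDiffAt]
    intro ζ
    exact (hlC _ (hpos ζ)).comp ζ (contDiffAt_const.mul ((ns_contDiff W).contDiffAt.add contDiffAt_const))
  have hlap : ∀ ζ, lap φ ζ = 4 * k * l1 (k * (ns W ζ + κ)) + 4 * k ^ 2 * ns W ζ * l2 (k * (ns W ζ + κ)) :=
    fun ζ => lap_radial hl hl1 hκ hkpos ζ
  have hout : ∀ ζ, ζ ∉ closedBall W R → 1 ≤ k * (ns W ζ + κ) := by
    intro ζ hζ
    rw [mem_closedBall, not_le, Complex.dist_eq] at hζ
    rw [ns_eq, ← hkR]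
    gcongr
  have hin : ∀ ζ ∈ closedBall W R, k * (ns W ζ + κ) ≤ 1 := by
    intro ζ hζ
    rw [mem_closedBall, Complex.dist_eq] at hζ
    rw [ns_eq, ← hkR]
    gcongr
  have hφ0 : ∀ ζ, ζ ∉ closedBall W R → φ ζ = 0 := fun ζ hζ => (hz _ (hout ζ hζ)).1
  have hlap0 : ∀ ζ, ζ ∉ closedBall W R → lap φ ζ = 0 := fun ζ hζ => by
    rw [hlap, (hz _ (hout ζ hζ)).2.1, (hz _ (hout ζ hζ)).2.2]; ring
  have hφc : HasCompactSupport φ := HasCompactSupport.intro (isCompact_closedBall W R) hφ0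
  refine ⟨fun z => - φ z, hφC.continuous.neg, ?_, ?_⟩
  · intro ζ hζ hne
    have hp : 0 < ‖ζ - W‖ := norm_pos_iff.2 (sub_ne_zero.2 hne)
    have h1 := hge _ (hpos ζ) (hin ζ hζ)
    have h2 : Real.log (‖ζ - W‖ ^ 2 / (2 * R ^ 2)) ≤ Real.log (k * (ns W ζ + κ)) := by
      apply Real.log_le_log (by positivity)
      rw [ns_eq, hk, div_mul_eq_mul_div, one_mul]
      apply div_le_div₀ (by positivity) (by linarith) (by positivity) (by linarith)
    rw [Real.log_div (by positivity) (by positivity), Real.log_pow] at h2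
    push_cast at h2
    simp only [hφ]
    linarith
  · have e1 := ibp_lap hφC hσ hφc
    have e2 : ∫ z, φ z * lap σ z = - ∫ z in closedBall W R, (- φ z) * lap σ z := by
      rw [← integral_neg, ← setIntegral_eq_integral_of_forall_compl_eq_zero (s := closedBall W R)]
      · simp
      · intro z hz; rw [hφ0 z hz, zero_mul]
    have e3 : ∫ z, lap φ z * σ z = ∫ z in closedBall W R, lap φ z * σ z := by
      rw [setIntegral_eq_integral_of_forall_compl_eq_zero]
      intro z hz; rw [hlap0 z hz, zero_mul]
    have io : ∀ g : ℂ → ℝ, Continuous g → IntegrableOn g (closedBall W R) := fun g hg =>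
      hg.continuousOn.integrableOn_compact (isCompact_closedBall W R)
    set S := closedBall W (Real.sqrt κ) with hS
    have hSsub : S ⊆ closedBall W R := by
      apply closedBall_subset_closedBall
      rw [Real.sqrt_le_left hR.le]
      linarith
    have iS : IntegrableOn (S.indicator fun _ => (1 / κ) * (σ W + 1)) (closedBall W R) :=
      (io _ continuous_const).indicator measurableSet_closedBall
    have e4 : ∫ z in closedBall W R, lap φ z * σ z ≤
        ∫ z in closedBall W R, (S.indicator (fun _ => (1 / κ) * (σ W + 1)) z + 8 * B0 / R ^ 2 * (- σ z)) := by
      refine setIntegral_mono_on (io _ ((lap_cont hφC).mul hσ.continuous))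
        (iS.add (io _ (continuous_const.mul hσ.continuous.neg))) measurableSet_closedBall ?_
      intro z hzR
      have hσ0 := hneg z hzR
      have hBσ : 0 ≤ 8 * B0 / R ^ 2 * (- σ z) := mul_nonneg (by positivity) (by linarith)
      have hs0 := hns0 z
      set s := ns W z with hs
      rw [hlap z, ← hs]
      by_cases hN : k * (s + κ) < 1 / 2
      · obtain ⟨f1, f2⟩ := hlog _ (hpos z) hN
        rw [← hs] at f1 f2
        have hval : 4 * k * l1 (k * (s + κ)) + 4 * k ^ 2 * s * l2 (k * (s + κ)) = 4 * κ / (s + κ) ^ 2 := by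
          rw [f1, f2]
          have : 0 < s + κ := by linarith
          field_simp
          ring
        rw [hval]
        by_cases hzS : z ∈ S
        · rw [indicator_of_mem hzS]
          rw [hS, mem_closedBall, Complex.dist_eq] at hzS
          have hsk : s ≤ κ := by
            rw [hs, ns_eq]
            calc ‖z - W‖ ^ 2 ≤ Real.sqrt κ ^ 2 := by gcongr
              _ = κ := Real.sq_sqrt hκ.le
          have hdist : dist z W < δ := by
            rw [Complex.dist_eq]
            refine lt_of_le_of_lt hzS ?_
            rw [Real.sqrt_lt' hδ]; exact hκδ
          have h5 := hδσ z hdist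
          have h6 : 1 / κ ≤ 4 * κ / (s + κ) ^ 2 := by
            rw [div_le_div_iff₀ hκ (by positivity)]
            nlinarith
          have h7 : 0 < 1 / κ := by positivity
          nlinarith
        · rw [indicator_of_notMem hzS]
          have : 0 ≤ 4 * κ / (s + κ) ^ 2 := by positivity
          nlinarith
      · push Not at hN
        have hzS : z ∉ S := by
          intro hzS
          rw [hS, mem_closedBall, Complex.dist_eq] at hzS
          have hsk : s ≤ κ := by
            rw [hs, ns_eq]
            calc ‖z - W‖ ^ 2 ≤ Real.sqrt κ ^ 2 := by gcongr
              _ = κ := Real.sq_sqrt hκ.le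
          nlinarith
        rw [indicator_of_notMem hzS, zero_add]
        obtain ⟨b1, b2⟩ := hbd _ (by linarith) (hin z hzR)
        rw [← hs] at b1 b2
        have hks : k * s ≤ 1 := by
          have := hin z hzR
          rw [← hs] at this
          nlinarith
        have hkR' : k ≤ 1 / R ^ 2 := by
          rw [hk]; apply one_div_le_one_div_of_le hR2; linarith
        have h8 : - (8 * B0 / R ^ 2) ≤ 4 * k * l1 (k * (s + κ)) + 4 * k ^ 2 * s * l2 (k * (s + κ)) := by
          have a1 : -(k * B0) ≤ k * l1 (k * (s + κ)) := by
            have := neg_le_of_abs_le b1; nlinarith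
          have a2 : -(k * B0) ≤ k * ((k * s) * l2 (k * (s + κ))) := by
            have h9 := neg_le_of_abs_le b2
            have : 0 ≤ k * s := by positivity
            have h10 : -B0 ≤ (k * s) * l2 (k * (s + κ)) := by nlinarith
            nlinarith
          have a3 : k * B0 ≤ B0 / R ^ 2 := by
            rw [div_eq_mul_one_div, mul_comm]; gcongr
          have : 8 * B0 / R ^ 2 = 8 * (B0 / R ^ 2) := by ring
          rw [this]; nlinarith
        nlinarith
    have iB : IntegrableOn (fun z => 8 * B0 / R ^ 2 * (- σ z)) (closedBall W R) := io _ (continuous_const.mul hσ.continuous.neg)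
    rw [integral_add iS iB, integral_const_mul,
      setIntegral_indicator measurableSet_closedBall, inter_eq_self_of_subset_right hSsub, setIntegral_const] at e4
    have hvol : volume.real S = κ * Real.pi := by
      rw [Measure.real, hS, Complex.volume_closedBall]
      rw [← ENNReal.ofReal_pow (by positivity), Real.sq_sqrt hκ.le]
      simp [hκ.le]
    rw [hvol, smul_eq_mul, ← e3, ← e1, e2] at e4
    have e5 : κ * Real.pi * (1 / κ * (σ W + 1)) = Real.pi * (σ W + 1) := by field_simp
    rw [e5] at e4
    linarith
end Shch

namespace Shch
open Filter Topology MeasureTheory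

lemma choose_rho (W1 : ℂ) {r0 : ℝ} (hr : 0 < r0) {lam : ℝ → ENNReal} (hm : Measurable lam)
    {f : ℂ → ENNReal} (hf : Measurable f) :
    ∃ ρ ∈ Icc r0 (2 * r0), ∫⁻ ζ in closedBall W1 (4 * r0), lam (‖ζ - W1‖ - ρ) * f ζ ≤
      ((∫⁻ d in Icc (-(4 * r0)) (4 * r0), lam d) * ∫⁻ ζ in closedBall W1 (4 * r0), f ζ) / ENNReal.ofReal r0 := by
  have hvol : volume (Icc r0 (2 * r0)) = ENNReal.ofReal r0 := by
    rw [Real.volume_Icc]; congr 1; ring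
  have hmeas : Measurable (fun p : ℝ × ℂ => lam (‖p.2 - W1‖ - p.1) * f p.2) := by
    refine (hm.comp ?_).mul (hf.comp measurable_snd)
    fun_prop
  obtain ⟨ρ, hρ, h⟩ := exists_le_setLAverage (μ := volume) (s := Icc r0 (2 * r0))
    (f := fun ρ => ∫⁻ ζ in closedBall W1 (4 * r0), lam (‖ζ - W1‖ - ρ) * f ζ)
    (by rw [hvol]; simpa using hr) (by rw [hvol]; simp) (Measurable.lintegral_prod_right hmeas).aemeasurable
  refine ⟨ρ, hρ, h.trans ?_⟩
  rw [setLAverage_eq, hvol]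
  gcongr
  rw [lintegral_lintegral_swap hmeas.aemeasurable, ← lintegral_const_mul _ hf]
  refine setLIntegral_mono (hf.const_mul _) fun ζ hζ => ?_
  have hmm : Measurable (fun x : ℝ => lam (‖ζ - W1‖ - x)) := hm.comp (by fun_prop)
  rw [lintegral_mul_const _ hmm]
  refine mul_le_mul_left ?_ _
  rw [mem_closedBall, Complex.dist_eq] at hζ
  set t := ‖ζ - W1‖ with ht
  have ht0 : 0 ≤ t := norm_nonneg _
  rw [← lintegral_indicator measurableSet_Icc, ← lintegral_indicator measurableSet_Icc,
    ← lintegral_sub_left_eq_self _ t]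
  refine lintegral_mono fun ρ => ?_
  by_cases hρ : t - ρ ∈ Icc r0 (2 * r0)
  · rw [indicator_of_mem hρ, indicator_of_mem]
    · simp
    exact ⟨by linarith [hρ.2], by linarith [hρ.1]⟩
  · rw [indicator_of_notMem hρ]; exact zero_le

lemma good_circle (W1 : ℂ) {r0 I' : ℝ} (hr : 0 < r0) (hI : 0 ≤ I') : ∃ C1, 0 ≤ C1 ∧ ∀ σ : ℂ → ℝ,
    ContDiff ℝ 2 σ → (∀ x b, σ x ≤ cm (fun t => σ (x + t • b))) → (∀ z ∈ ball W1 (5 * r0), σ z ≤ 0) →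
    (∫ z in ball W1 (5 * r0), (- σ z)) ≤ I' →
    ∃ ρ ∈ Icc r0 (2 * r0), ∀ W ∈ sphere W1 ρ, - C1 ≤ σ W := by
  obtain ⟨B2, hB2, hmass⟩ := mass_bound W1 hr
  obtain ⟨B, hB, htest⟩ := test_lower (R := 2 * r0) (by positivity)
  set lr : ℝ → ℝ := fun d => Real.log (2 * (2 * r0) ^ 2) - 2 * Real.log d with hlr
  set lam : ℝ → ENNReal := fun d => ENNReal.ofReal (lr d) with hlam
  have hlrm : Measurable lr := measurable_const.sub (measurable_const.mul Real.measurable_log)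
  have hm : Measurable lam := hlrm.ennreal_ofReal
  have hΛ : ∫⁻ d in Icc (-(4 * r0)) (4 * r0), lam d ≠ ⊤ := by
    have i1 : IntegrableOn lr (Icc (-(4 * r0)) (4 * r0)) := by
      have h1 : IntervalIntegrable Real.log volume (-(4 * r0)) (4 * r0) := intervalIntegral.intervalIntegrable_log'
      rw [intervalIntegrable_iff_integrableOn_Icc_of_le (by linarith)] at h1
      exact (integrableOn_const (by simp)).sub (h1.const_mul 2)
    exact i1.lintegral_lt_top.ne
  set Λ := ∫⁻ d in Icc (-(4 * r0)) (4 * r0), lam d with hΛdef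
  set T := (Λ * ENNReal.ofReal (B2 * I')) / ENNReal.ofReal r0 with hT
  have hTtop : T ≠ ⊤ := by
    rw [hT]
    exact ENNReal.div_ne_top (ENNReal.mul_ne_top hΛ ENNReal.ofReal_ne_top) (by simpa using hr)
  refine ⟨1 + (B * I' + T.toReal) / Real.pi, by positivity, fun σ hσ hsub hneg hItg => ?_⟩
  have hl := lap_nonneg hσ hsub
  have hlc := lap_cont hσ
  obtain ⟨ρ, hρ, h⟩ := choose_rho W1 hr hm (f := fun z => ENNReal.ofReal (lap σ z)) hlc.measurable.ennreal_ofReal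
  refine ⟨ρ, hρ, fun W hW => ?_⟩
  have hWd : ‖W - W1‖ = ρ := by rwa [mem_sphere, Complex.dist_eq] at hW
  have hmassσ : ∫⁻ ζ in closedBall W1 (4 * r0), ENNReal.ofReal (lap σ ζ) ≤ ENNReal.ofReal (B2 * I') := by
    rw [← ofReal_integral_eq_lintegral_ofReal (hlc.continuousOn.integrableOn_compact (isCompact_closedBall _ _))
      (ae_of_all _ hl)]
    exact ENNReal.ofReal_le_ofReal ((hmass σ hσ hl hneg).trans (by gcongr))
  have hT' : ∫⁻ ζ in closedBall W1 (4 * r0), lam (‖ζ - W1‖ - ρ) * ENNReal.ofReal (lap σ ζ) ≤ T := by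
    refine h.trans ?_
    rw [hT]
    gcongr
  by_cases hlt : σ W < -1
  swap
  · push Not at hlt
    have : 0 ≤ (B * I' + T.toReal) / Real.pi := by positivity
    linarith
  have hsubR : closedBall W (2 * r0) ⊆ closedBall W1 (4 * r0) := by
    apply closedBall_subset_closedBall'
    rw [Complex.dist_eq, hWd]; linarith [hρ.2]
  have hsub5 : closedBall W (2 * r0) ⊆ ball W1 (5 * r0) :=
    hsubR.trans (closedBall_subset_ball (by linarith))
  obtain ⟨ψ, hψc, hψ, hfin⟩ := htest W σ hσ (fun z hz => hneg z (hsub5 hz)) hlt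
  have b1 : ∫ z in closedBall W (2 * r0), (- σ z) ≤ I' := by
    refine le_trans ?_ hItg
    refine setIntegral_mono_set ?_ ?_ (Filter.Eventually.of_forall hsub5)
    · exact (hσ.continuous.neg.continuousOn.integrableOn_compact (isCompact_closedBall W1 (5 * r0))).mono_set
        ball_subset_closedBall
    · filter_upwards [ae_restrict_mem measurableSet_ball] with z hz
      have := hneg z hz
      simpa using this
  have b2 : ∫ z in closedBall W (2 * r0), ψ z * lap σ z ≤ T.toReal := by
    have hcont : Continuous fun z => ψ z * lap σ z := hψc.mul hlc
    rw [integral_eq_lintegral_pos_part_sub_lintegral_neg_part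
      (hcont.continuousOn.integrableOn_compact (isCompact_closedBall _ _))]
    have : (∫⁻ z in closedBall W (2 * r0), ENNReal.ofReal (ψ z * lap σ z)) ≤ T := by
      refine le_trans ?_ hT'
      refine le_trans ?_ (lintegral_mono_set hsubR)
      refine lintegral_mono_ae ?_
      have hnull : ∀ᵐ z ∂(volume : Measure ℂ), z ∉ sphere W1 ρ :=
        measure_eq_zero_iff_ae_notMem.1 (Measure.addHaar_sphere volume W1 ρ)
      filter_upwards [ae_restrict_mem measurableSet_closedBall, ae_restrict_of_ae hnull] with z hz hzn
      rw [mem_sphere, Complex.dist_eq] at hzn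
      have hne : z ≠ W := by rintro rfl; exact hzn hWd
      rw [ENNReal.ofReal_mul' (hl z)]
      gcongr
      refine ENNReal.ofReal_le_ofReal ((hψ z hz hne).trans ?_)
      simp only [hlr]
      have h1 : Real.log (‖z - W1‖ - ρ) ≤ Real.log ‖z - W‖ := by
        rw [← Real.log_abs]
        apply Real.log_le_log (abs_pos.2 (sub_ne_zero.2 hzn))
        rw [← hWd]
        refine (abs_norm_sub_norm_le _ _).trans ?_
        simp
      linarith
    have := ENNReal.toReal_mono hTtop this
    have h0 := ENNReal.toReal_nonneg (a := ∫⁻ z in closedBall W (2 * r0), ENNReal.ofReal (-(ψ z * lap σ z)))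
    linarith
  have : Real.pi * (- σ W - 1) ≤ B * I' + T.toReal := by
    refine hfin.trans (add_le_add (by gcongr) b2)
  have hpi := Real.pi_pos
  rw [mul_comm, ← le_div_iff₀ hpi] at this
  linarith
end Shch

namespace Shch
open Filter Topology MeasureTheory

lemma cm_add {f g : ℂ → ℝ} (hf : Continuous f) (hg : Continuous g) :
    cm (fun t => f t + g t) = cm f + cm g := by
  unfold cm
  rw [intervalIntegral.integral_add (ii_of_cont hf.continuousOn) (ii_of_cont hg.continuousOn), mul_add]

lemma cm_const_mul (c : ℝ) (f : ℂ → ℝ) : cm (fun t => c * f t) = c * cm f := by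
  unfold cm
  rw [intervalIntegral.integral_const_mul]; ring

lemma cm_hol {f : ℂ → ℂ} (hf : Differentiable ℂ f) : cm (fun t => (f t).re) = (f 0).re := by
  rw [cm_eq]
  have h1 : Real.circleAverage f 0 1 = f 0 := DiffContOnCl.circleAverage hf.diffContOnCl
  have h2 := Complex.reCLM.circleAverage_comp_comm (f := f) (c := 0) (R := 1)
    (hf.continuous.continuousOn.circleIntegrable')
  rw [h1] at h2
  exact h2

lemma cm_normsq (a b : ℂ) : cm (fun t => ‖a + t * b‖ ^ 2) = ‖a‖ ^ 2 + ‖b‖ ^ 2 := by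
  have h1 : ∀ t ∈ sphere (0:ℂ) 1, ‖a + t * b‖ ^ 2 = (‖a‖ ^ 2 + ‖b‖ ^ 2) + 2 * ((starRingEnd ℂ a) * (t * b)).re := by
    intro t ht
    have ht : ‖t‖ = 1 := by simpa using ht
    have : ‖a + t * b‖ ^ 2 = ‖a‖ ^ 2 + ‖t * b‖ ^ 2 + 2 * ((starRingEnd ℂ a) * (t * b)).re := by
      simp only [← Complex.normSq_eq_norm_sq, Complex.normSq_apply, Complex.add_re, Complex.add_im,
        Complex.mul_re, Complex.mul_im, Complex.conj_re, Complex.conj_im]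
      ring
    rw [this, norm_mul, ht, one_mul]
  have c0 : Continuous fun t : ℂ => 2 * ((starRingEnd ℂ a) * (t * b)).re :=
    continuous_const.mul (Complex.continuous_re.comp (by fun_prop))
  have h2 : cm (fun t => ‖a + t * b‖ ^ 2) = cm (fun t => (‖a‖ ^ 2 + ‖b‖ ^ 2) + 2 * ((starRingEnd ℂ a) * (t * b)).re) := by
    have c1 : Continuous fun t : ℂ => ‖a + t * b‖ ^ 2 := by fun_prop
    exact le_antisymm (cm_mono (ii_of_cont c1.continuousOn) (ii_of_cont (continuous_const.add c0).continuousOn) fun z hz => (h1 z hz).le)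
      (cm_mono (ii_of_cont (continuous_const.add c0).continuousOn) (ii_of_cont c1.continuousOn) fun z hz => (h1 z hz).ge)
  rw [h2, cm_add continuous_const c0, cm_const,
    cm_const_mul, cm_hol (f := fun t => (starRingEnd ℂ a) * (t * b)) (by fun_prop)]
  simp

lemma exists_good_s {u : ℂ × ℂ → EReal} (hu : PSH u) {a : ℂ × ℂ} (hua : u a ≠ ⊥) (c W1 : ℂ) {β r0 : ℝ}
    (hβ : 0 < β) (hr0 : 0 < r0) {K Γ : Set (ℂ × ℂ)} (hK : IsCompact K) (hΓ : IsCompact Γ)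
    (hΓu : ∀ x ∈ Γ, u x = ⊥) :
    ∃ C0 C1 : ℝ, 0 ≤ C0 ∧ 0 ≤ C1 ∧ ∀ M : ℝ, 0 ≤ M → ∃ s : ℂ × ℂ → ℝ, ContDiff ℝ 2 s ∧
      (∀ x b, s x ≤ cm (fun t => s (x + t • b))) ∧ (∀ x ∈ K, s x ≤ C0) ∧ (∀ x ∈ Γ, s x ≤ -M) ∧
      ∃ z0 ∈ ball c β, ∃ ρ ∈ Icc r0 (2 * r0), ∀ W ∈ sphere W1 ρ, - C1 ≤ s (z0, W) - C0 := by
  obtain ⟨R, hRK⟩ : ∃ R : ℝ, K ∪ closedBall c β ×ˢ closedBall W1 (5 * r0) ⊆ ball a R := by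
    have : Bornology.IsBounded (K ∪ closedBall c β ×ˢ closedBall W1 (5 * r0)) :=
      hK.isBounded.union ((isCompact_closedBall _ _).prod (isCompact_closedBall _ _)).isBounded
    exact this.subset_ball a
  obtain ⟨C0, hC0, hC0u⟩ := psh_bdd hu (isCompact_closedBall a (R + 1))
  set I := volume.real (ball a (R + 1)) * (C0 - (u a).toReal) with hI
  have hRpos : 0 < R := by
    have h1 : (c, W1) ∈ ball a R := hRK (Or.inr ⟨mem_closedBall_self hβ.le, mem_closedBall_self (by positivity)⟩)
    exact pos_of_mem_ball h1
  have hua' : (u a).toReal ≤ C0 := by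
    have h1 := hC0u a (mem_closedBall_self (by linarith))
    have h2 : ((u a).toReal : EReal) = u a := EReal.coe_toReal (hu.2.1 a) hua
    rw [← h2] at h1
    exact_mod_cast h1
  have hI0 : 0 ≤ I := mul_nonneg measureReal_nonneg (by linarith)
  have hvβ : 0 < volume.real (ball c β) := by
    rw [Measure.real]
    exact ENNReal.toReal_pos (measure_ball_pos volume c hβ).ne' measure_ball_lt_top.ne
  obtain ⟨C1, hC1, hgc⟩ := good_circle W1 (I' := I / volume.real (ball c β)) hr0 (by positivity)
  refine ⟨C0, C1, hC0, hC1, fun M hM => ?_⟩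
  obtain ⟨ε, hε, hε1, hεΓ⟩ : ∃ ε > 0, ε ≤ 1 ∧ ∀ x ∈ Γ, ∀ y ∈ ball x ε, u y < ((-M : ℝ) : EReal) := by
    have hop : IsOpen {x | u x < ((-M : ℝ) : EReal)} := hu.1.isOpen_preimage _
    obtain ⟨ε, hε, hsub⟩ := hΓ.exists_thickening_subset_open hop (fun x hx => by
      show u x < _
      rw [hΓu x hx]; exact EReal.bot_lt_coe _)
    refine ⟨min ε 1, by positivity, min_le_right _ _, fun x hx y hy => hsub ?_⟩
    exact mem_thickening_iff.2 ⟨x, hx, lt_of_lt_of_le hy (min_le_left _ _)⟩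
  obtain ⟨s, hsC, hsub, hsle, hsint⟩ := exists_moll (tr_meas hu M) (fun a R => tr_bdd_ball hu M a R)
    (tr_submean hu M) hε
  have htr : ∀ y ∈ ball a (R + 1), tr u M y ≤ C0 := fun y hy =>
    tr_le hu (hC0u y (ball_subset_closedBall hy)) (by linarith)
  have hsC0 : ∀ x ∈ ball a R, s x ≤ C0 := fun x hx => hsle x C0 fun y hy => htr y (by
    rw [mem_ball] at *
    linarith [dist_triangle y x a])
  have hItg : ∫ y in ball a R, (C0 - s y) ≤ I := by
    refine (hsint a R C0 fun y hy => htr y (ball_subset_ball (by linarith) hy)).trans ?_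
    refine (psh_vol volume hu hua).2.trans ?_
    rw [hI]
    refine mul_le_mul_of_nonneg_right ?_ (by linarith)
    rw [Measure.real, Measure.real]
    exact ENNReal.toReal_mono measure_ball_lt_top.ne (measure_mono (ball_subset_ball (by linarith)))
  refine ⟨s, hsC, hsub, fun x hx => hsC0 x (hRK (Or.inl hx)), fun x hx => hsle x _ fun y hy =>
    tr_le hu (le_of_lt (hεΓ x hx y hy)) le_rfl, ?_⟩
  set g : ℂ × ℂ → ℝ := fun y => C0 - s y with hg
  have hgc' : Continuous g := continuous_const.sub hsC.continuous
  have hprod : ball c β ×ˢ ball W1 (5 * r0) ⊆ ball a R := fun x hx =>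
    hRK (Or.inr ⟨ball_subset_closedBall hx.1, ball_subset_closedBall hx.2⟩)
  have iR : IntegrableOn g (ball a R) :=
    (hgc'.continuousOn.integrableOn_compact (isCompact_closedBall a R)).mono_set ball_subset_closedBall
  have hg2 : ∫ y in ball c β ×ˢ ball W1 (5 * r0), g y ≤ I := by
    refine le_trans (setIntegral_mono_set iR ?_ (Filter.Eventually.of_forall hprod)) hItg
    filter_upwards [ae_restrict_mem measurableSet_ball] with z hz
    have := hsC0 z hz
    simpa [hg] using this
  have ip : IntegrableOn g (ball c β ×ˢ ball W1 (5 * r0)) := iR.mono_set hprod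
  rw [Measure.volume_eq_prod] at hg2 ip
  rw [setIntegral_prod _ ip] at hg2
  have ip' : Integrable g ((volume.restrict (ball c β)).prod (volume.restrict (ball W1 (5 * r0)))) := by
    rw [Measure.prod_restrict]; exact ip
  obtain ⟨z0, hz0, hz0i⟩ := exists_le_setAverage (μ := volume) (s := ball c β)
    (f := fun z => ∫ W in ball W1 (5 * r0), g (z, W)) (measure_ball_pos volume c hβ).ne' measure_ball_lt_top.ne
    ip'.integral_prod_left
  refine ⟨z0, hz0, ?_⟩
  refine hgc (fun W => s (z0, W) - C0) ?_ ?_ ?_ ?_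
  · exact (hsC.comp (contDiff_const.prodMk contDiff_id)).sub contDiff_const
  · intro x b
    have h1 := hsub (z0, x) (0, b)
    have hcont : Continuous fun t : ℂ => s ((z0, x) + t • ((0:ℂ), b)) := hsC.continuous.comp (by fun_prop)
    have h2 : cm (fun t => s (z0, x + t • b) - C0) = cm (fun t => s ((z0, x) + t • ((0:ℂ), b))) - C0 := by
      have : (fun t : ℂ => s (z0, x + t • b) - C0) = fun t => s ((z0, x) + t • ((0:ℂ), b)) + (fun _ => -C0) t := by
        funext t; simp [sub_eq_add_neg]
      rw [this, cm_add hcont continuous_const, cm_const]; ring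
    rw [h2]; linarith
  · intro W hW
    have := hsC0 (z0, W) (hprod ⟨hz0, hW⟩)
    linarith
  · simp only [neg_sub]
    refine hz0i.trans ?_
    rw [setAverage_eq, smul_eq_mul, inv_mul_eq_div]
    gcongr

lemma no_log_circle {W1 h0 F0 : ℂ} {ρ : ℝ} (hh : ‖h0 - W1‖ < ρ) (hF : ρ < ‖F0 - W1‖) {θ : ℂ → ℂ}
    (hθ : ContinuousOn θ (sphere W1 ρ))
    (he : ∀ W ∈ sphere W1 ρ, Complex.exp (θ W) = (W - h0) / (W - F0)) : False := by
  have hρ : 0 < ρ := lt_of_le_of_lt (norm_nonneg _) hh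
  set E : ℝ → ℂ := fun t => Complex.exp (t * Complex.I) with hE
  have hEn : ∀ t, ‖E t‖ = 1 := fun t => Complex.norm_exp_ofReal_mul_I t
  have hE0 : ∀ t, E t ≠ 0 := fun t => Complex.exp_ne_zero _
  have hEc : Continuous E := by simp only [hE]; fun_prop
  have hmem : ∀ t, W1 + ρ * E t ∈ sphere W1 ρ := fun t => by
    simp [hEn, abs_of_pos hρ]
  have hF1 : F0 - W1 ≠ 0 := by rw [← norm_pos_iff]; linarith
  set A : ℝ → ℂ := fun t => 1 - (h0 - W1) / (ρ * E t) with hA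
  set B : ℝ → ℂ := fun t => 1 - (ρ * E t) / (F0 - W1) with hB
  have hre : ∀ w : ℂ, ‖w‖ < 1 → 1 - w ∈ Complex.slitPlane := fun w hw => by
    left
    have := Complex.abs_re_le_norm w
    have := le_abs_self w.re
    simp; linarith
  have hAs : ∀ t, A t ∈ Complex.slitPlane := fun t => hre _ (by
    rw [norm_div, norm_mul, hEn]; simp [abs_of_pos hρ]; rwa [div_lt_one hρ])
  have hBs : ∀ t, B t ∈ Complex.slitPlane := fun t => hre _ (by
    rw [norm_div, norm_mul, hEn]; simp [abs_of_pos hρ]; rwa [div_lt_one (by linarith)])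
  have hAc : Continuous A := continuous_const.sub (continuous_const.div (continuous_const.mul hEc)
    (fun t => mul_ne_zero (by exact_mod_cast hρ.ne') (hE0 t)))
  have hBc : Continuous B := continuous_const.sub ((continuous_const.mul hEc).div_const _)
  have hρ' : (ρ:ℂ) ≠ 0 := by exact_mod_cast hρ.ne'
  set c0 := Complex.log (- ρ / (F0 - W1)) with hc0
  set k : ℝ → ℂ := fun t => θ (W1 + ρ * E t) - Complex.log (A t) + Complex.log (B t) - c0 - t * Complex.I with hk
  have hkc : Continuous k := by
    have h1 : Continuous (fun t => θ (W1 + ρ * E t)) :=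
      hθ.comp_continuous (by fun_prop) hmem
    have h2 : Continuous fun t => Complex.log (A t) := hAc.clog hAs
    have h3 : Continuous fun t => Complex.log (B t) := hBc.clog hBs
    have h4 : Continuous fun t : ℝ => (t:ℂ) * Complex.I := by fun_prop
    exact (((h1.sub h2).add h3).sub continuous_const).sub h4
  have hek : ∀ t, Complex.exp (k t) = 1 := by
    intro t
    have hA0 : A t ≠ 0 := Complex.slitPlane_ne_zero (hAs t)
    have hB0 : B t ≠ 0 := Complex.slitPlane_ne_zero (hBs t)
    have hn0 : W1 + ρ * E t - F0 ≠ 0 := by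
      intro h
      have : B t = 0 := by
        simp only [hB]
        have : ρ * E t = F0 - W1 := by linear_combination h
        rw [this, div_self hF1, sub_self]
      exact hB0 this
    simp only [hk]
    rw [Complex.exp_sub, Complex.exp_sub, Complex.exp_add, Complex.exp_sub, he _ (hmem t), Complex.exp_log hA0,
      Complex.exp_log hB0, hc0, Complex.exp_log (by simp [hρ', hF1])]
    change _ / E t = 1
    have h1 : W1 + ρ * E t - h0 = ρ * E t * A t := by
      simp only [hA]; field_simp [hE0 t]; ring
    have h2 : W1 + ρ * E t - F0 = - (F0 - W1) * B t := by
      simp only [hB]; field_simp; ring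
    rw [h1, h2]
    have := hE0 t
    field_simp
  choose n hn using fun t => Complex.exp_eq_one_iff.1 (hek t)
  have hloc : k 0 = k (2 * Real.pi) := by
    refine eq_of_locally_eq (S := univ) isPreconnected_univ (fun p _ => ?_) (mem_univ _) (mem_univ _)
    refine ⟨_, hkc.continuousAt.preimage_mem_nhds (ball_mem_nhds (k p) one_pos), fun q hq _ => ?_⟩
    exact eq_of_exp_eq_of_dist (by rw [hek, hek]) hq
  have hE1 : E (2 * Real.pi) = E 0 := by
    simp only [hE]; push_cast; rw [Complex.exp_two_pi_mul_I]; simp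
  have hA1 : A (2 * Real.pi) = A 0 := by simp only [hA, hE1]
  have hB1 : B (2 * Real.pi) = B 0 := by simp only [hB, hE1]
  simp only [hk, hE1, hA1, hB1] at hloc
  have : (2 * Real.pi : ℂ) * Complex.I = 0 := by
    push_cast at hloc
    simp only [Complex.ofReal_zero, zero_mul, sub_zero] at hloc
    linear_combination hloc
  simp [Real.pi_ne_zero] at this
end Shch

namespace Shch
open Filter Topology MeasureTheory

lemma normsq_contDiff {E : Type*} [NormedAddCommGroup E] [NormedSpace ℝ E] {f : E → ℂ} (hf : ContDiff ℝ 2 f) :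
    ContDiff ℝ 2 (fun x => ‖f x‖ ^ 2) := hf.norm_sq ℝ

lemma norm_sq_le_sum (b : ℂ × ℂ) : ‖b‖ ^ 2 ≤ ‖b.1‖ ^ 2 + ‖b.2‖ ^ 2 := by
  rw [Prod.norm_def]
  rcases max_choice ‖b.1‖ ‖b.2‖ with h | h <;> rw [h]
  · nlinarith [sq_nonneg ‖b.2‖]
  · nlinarith [sq_nonneg ‖b.1‖]

lemma core_top {v : ℂ × ℂ → ℝ} (hv : Good v) {c : ℂ} {r : ℝ} (hr : 0 < r) {h F : ℂ → ℂ}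
    (hh : Continuous h) (hF : Continuous F) (hFh : ∀ z, z ∉ closedBall c r → F z = h z)
    (h1 : ∀ z ∈ closedBall c r, v (z, h z) ≤ 0) (h2 : ∀ z ∈ closedBall c r, v (z, F z) ≤ 0)
    {z0 W1 : ℂ} (hz0 : z0 ∈ closedBall c r) {ρ : ℝ} (ha : ‖h z0 - W1‖ < ρ) (hb : ρ < ‖F z0 - W1‖)
    (hc : ∀ W ∈ sphere W1 ρ, 0 < v (z0, W)) : False := by
  obtain ⟨K, hK0, hKh, hKF⟩ : ∃ K : ℝ, 0 < K ∧ (∀ z ∈ closedBall c r, ‖h z‖ ≤ K) ∧ (∀ z ∈ closedBall c r, ‖F z‖ ≤ K) := by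
    obtain ⟨K1, hK1⟩ := (isCompact_closedBall c r).exists_bound_of_continuousOn hh.continuousOn
    obtain ⟨K2, hK2⟩ := (isCompact_closedBall c r).exists_bound_of_continuousOn hF.continuousOn
    refine ⟨max 1 (max K1 K2), by positivity, fun z hz => (hK1 z hz).trans ?_, fun z hz => (hK2 z hz).trans ?_⟩ <;> simp
  set η : ℝ := 1 / K ^ 2 with hη
  have hηpos : 0 < η := by positivity
  set ψ : ℂ × ℂ → ℝ := fun x => ‖x.1 - c‖ ^ 2 + η * ‖x.2‖ ^ 2 - (r + 1) ^ 2 with hψ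
  have hψC : ContDiff ℝ 2 ψ :=
    ((normsq_contDiff (contDiff_fst.sub contDiff_const)).add (contDiff_const.mul (normsq_contDiff contDiff_snd))).sub
      contDiff_const
  have hψg : Good ψ := by
    refine good_of_submean hψC (κ := min 1 η) (by positivity) fun x b => ?_
    change _ ≤ cm (fun t => ψ (x + t • b))
    have e : (fun t : ℂ => ψ (x + t • b)) = fun t => (‖(x.1 - c) + t * b.1‖ ^ 2 + η * ‖x.2 + t * b.2‖ ^ 2) + -(r + 1) ^ 2 := by
      funext t
      simp only [hψ, Prod.fst_add, Prod.snd_add, Prod.smul_fst, Prod.smul_snd, smul_eq_mul]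
      rw [show x.1 + t * b.1 - c = x.1 - c + t * b.1 by ring]; ring
    have c1 : Continuous fun t : ℂ => ‖(x.1 - c) + t * b.1‖ ^ 2 := by fun_prop
    have c2 : Continuous fun t : ℂ => η * ‖x.2 + t * b.2‖ ^ 2 := by fun_prop
    have c12 : Continuous fun t : ℂ => ‖(x.1 - c) + t * b.1‖ ^ 2 + η * ‖x.2 + t * b.2‖ ^ 2 := c1.add c2
    rw [e, cm_add c12 continuous_const, cm_add c1 c2, cm_const_mul, cm_normsq, cm_normsq, cm_const]
    simp only [hψ]
    have h3 := norm_sq_le_sum b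
    have h4 : min 1 η * ‖b‖ ^ 2 ≤ min 1 η * (‖b.1‖ ^ 2 + ‖b.2‖ ^ 2) := by gcongr
    have h5 : min 1 η * ‖b.1‖ ^ 2 ≤ 1 * ‖b.1‖ ^ 2 := by gcongr; exact min_le_left _ _
    have h6 : min 1 η * ‖b.2‖ ^ 2 ≤ η * ‖b.2‖ ^ 2 := by gcongr; exact min_le_right _ _
    linarith
  set V : ℂ × ℂ → ℝ := fun x => max (v x) (ψ x) with hV
  have hVg : Good V := good_max hv hψg
  have hψneg : ∀ z ∈ closedBall c r, ∀ W : ℂ, ‖W‖ ≤ K → ψ (z, W) ≤ 0 := by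
    intro z hz W hW
    rw [mem_closedBall, Complex.dist_eq] at hz
    have e1 : ‖z - c‖ ^ 2 ≤ r ^ 2 := by gcongr
    have e2 : η * ‖W‖ ^ 2 ≤ 1 := by
      calc η * ‖W‖ ^ 2 ≤ η * K ^ 2 := by gcongr
        _ = 1 := by rw [hη]; field_simp
    simp only [hψ]; nlinarith
  have hnF : ∀ x : ℂ × ℂ, 0 < V x → x.1 ∈ closedBall c r → x.2 - F x.1 ≠ 0 := by
    intro x hx hx1 h0
    have e : x = (x.1, F x.1) := Prod.ext rfl (sub_eq_zero.1 h0)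
    rw [e] at hx
    exact absurd hx (not_lt.2 (max_le (h2 _ hx1) (hψneg _ hx1 _ (hKF _ hx1))))
  have hnh : ∀ x : ℂ × ℂ, 0 < V x → x.1 ∈ closedBall c r → x.2 - h x.1 ≠ 0 := by
    intro x hx hx1 h0
    have e : x = (x.1, h x.1) := Prod.ext rfl (sub_eq_zero.1 h0)
    rw [e] at hx
    exact absurd hx (not_lt.2 (max_le (h1 _ hx1) (hψneg _ hx1 _ (hKh _ hx1))))
  set Θ : ℂ × ℂ → ℂ := fun x => 1 + (F x.1 - h x.1) / (x.2 - F x.1) with hΘ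
  have hΘ1 : ∀ x : ℂ × ℂ, x.1 ∉ closedBall c r → Θ x = 1 := fun x hx => by
    simp only [hΘ]; rw [hFh _ hx, sub_self, zero_div, add_zero]
  have hΘc : ContinuousOn Θ {x | 0 < V x} := by
    intro x hx
    apply ContinuousAt.continuousWithinAt
    by_cases hx1 : x.1 ∈ closedBall c r
    · refine continuousAt_const.add (ContinuousAt.div ?_ ?_ (hnF x hx hx1)) <;> fun_prop
    · have : Θ =ᶠ[𝓝 x] fun _ => 1 := by
        have hop : IsOpen {y : ℂ × ℂ | y.1 ∉ closedBall c r} :=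
          (isClosed_closedBall.isOpen_compl).preimage continuous_fst
        filter_upwards [hop.mem_nhds hx1] with y hy
        exact hΘ1 y hy
      exact continuousAt_const.congr this.symm
  have hΘq : ∀ x : ℂ × ℂ, 0 < V x → x.1 ∈ closedBall c r → Θ x = (x.2 - h x.1) / (x.2 - F x.1) := by
    intro x hx hx1
    have := hnF x hx hx1
    simp only [hΘ]; field_simp; ring
  have hΘ0 : ∀ x, 0 < V x → Θ x ≠ 0 := by
    intro x hx
    by_cases hx1 : x.1 ∈ closedBall c r
    · rw [hΘq x hx hx1]; exact div_ne_zero (hnh x hx hx1) (hnF x hx hx1)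
    · rw [hΘ1 x hx1]; exact one_ne_zero
  obtain ⟨t1, ht1⟩ := ((isCompact_closedBall c r).prod (isCompact_closedBall (0:ℂ) (4 * K))).exists_bound_of_continuousOn
    hVg.cont.continuousOn
  have hpr : Bornology.IsBounded {x | V x ≤ max t1 1} := by
    set T := max t1 1 with hT
    refine (((isCompact_closedBall c (Real.sqrt (T + (r + 1) ^ 2))).prod
      (isCompact_closedBall (0:ℂ) (Real.sqrt ((T + (r + 1) ^ 2) / η)))).isBounded).subset ?_
    intro x hx
    have hx' : ψ x ≤ T := (le_max_right _ _).trans hx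
    simp only [hψ] at hx'
    refine ⟨?_, ?_⟩
    · rw [mem_closedBall, Complex.dist_eq]
      apply Real.le_sqrt_of_sq_le
      have : 0 ≤ η * ‖x.2‖ ^ 2 := by positivity
      linarith
    · rw [mem_closedBall_zero_iff]
      apply Real.le_sqrt_of_sq_le
      rw [le_div_iff₀ hηpos]
      have : 0 ≤ ‖x.1 - c‖ ^ 2 := by positivity
      linarith
  obtain ⟨θ, hθc, hθe⟩ := hVg.exists_log (t1 := max t1 1) (by positivity) hpr hΘc hΘ0 (by
    intro x hx
    by_cases hx1 : x.1 ∈ closedBall c r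
    · have hx2 : 4 * K < ‖x.2‖ := by
        by_contra hcon
        push Not at hcon
        have := ht1 x ⟨hx1, mem_closedBall_zero_iff.2 hcon⟩
        rw [Real.norm_eq_abs] at this
        have h5 := le_abs_self (V x)
        have h6 := le_max_left t1 1
        linarith
      have e1 := hKF _ hx1
      have e2 := hKh _ hx1
      have e3 : 3 * K < ‖x.2 - F x.1‖ := by
        have := norm_sub_norm_le x.2 (F x.1); linarith
      have e4 : ‖F x.1 - h x.1‖ ≤ 2 * K := (norm_sub_le _ _).trans (by linarith)
      have e5 : ‖(F x.1 - h x.1) / (x.2 - F x.1)‖ < 1 := by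
        rw [norm_div, div_lt_one (by linarith)]; linarith
      have e6 := Complex.abs_re_le_norm ((F x.1 - h x.1) / (x.2 - F x.1))
      have e7 := neg_abs_le ((F x.1 - h x.1) / (x.2 - F x.1)).re
      simp only [hΘ, Complex.add_re, Complex.one_re]
      linarith
    · rw [hΘ1 x hx1]; simp)
  refine no_log_circle ha hb (θ := fun W => θ (z0, W)) ?_ ?_
  · refine hθc.comp (by fun_prop) fun W hW => ?_
    exact lt_of_lt_of_le (hc W hW) (le_max_left _ _)
  · intro W hW
    have hp : 0 < V (z0, W) := lt_of_lt_of_le (hc W hW) (le_max_left _ _)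
    rw [hθe _ hp, hΘq _ hp hz0]

lemma core {u : ℂ × ℂ → EReal} (hu : PSH u) {a : ℂ × ℂ} (hua : u a ≠ ⊥) {c : ℂ} {r : ℝ} (hr : 0 < r) {h : ℂ → ℂ}
    (hh : Continuous h) (hub : ∀ z ∈ closedBall c r, u (z, h z) = ⊥) {q p : ℂ[X]}
    (hq : ∀ z ∈ closedBall c r, q.eval z ≠ 0)
    (hs : ∀ z ∈ sphere c r, 0 < (q.eval z * h z + p.eval z).re) :
    0 ≤ (q.eval c * h c + p.eval c).re := by
  classical
  by_contra hneg
  push Not at hneg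
  set G : ℂ × ℂ → ℂ := fun x => q.eval x.1 * x.2 + p.eval x.1 with hG
  have hGC : ContDiff ℂ 2 G :=
    ((q.differentiable.contDiff.comp contDiff_fst).mul contDiff_snd).add (p.differentiable.contDiff.comp contDiff_fst)
  have hGc : Continuous G := hGC.continuous
  set g : ℂ → ℝ := fun z => (G (z, h z)).re with hg
  have hgc : Continuous g := Complex.continuous_re.comp (hGc.comp (by fun_prop))
  have hgneg : g c < 0 := hneg
  set D : ℂ → ℂ := fun z => if z ∈ ball c r then ((max (- g z) 0 : ℝ) : ℂ) / q.eval z else 0 with hD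
  have hDc : Continuous D := by
    refine continuous_if ?_ ?_ continuousOn_const
    · intro z hz
      have : frontier {x | x ∈ ball c r} = sphere c r := frontier_ball c hr.ne'
      rw [this] at hz
      have h3 : 0 < g z := hs z hz
      rw [max_eq_right (by linarith)]; simp
    · have : closure {x | x ∈ ball c r} = closedBall c r := closure_ball c hr.ne'
      rw [this]
      exact (Complex.continuous_ofReal.comp (hgc.neg.max continuous_const)).continuousOn.div q.continuous.continuousOn hq
  set F : ℂ → ℂ := fun z => h z + D z with hF
  have hFc : Continuous F := hh.add hDc
  have hFh : ∀ z, z ∉ closedBall c r → F z = h z := by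
    intro z hz
    have : z ∉ ball c r := fun hz' => hz (ball_subset_closedBall hz')
    simp only [hF, hD, if_neg this, add_zero]
  have hGF : ∀ z ∈ closedBall c r, 0 ≤ (G (z, F z)).re := by
    intro z hz
    by_cases hz' : z ∈ ball c r
    · have e : G (z, F z) = G (z, h z) + ((max (- g z) 0 : ℝ) : ℂ) := by
        simp only [hG, hF, hD, hz', if_true]
        field_simp [hq z hz]; ring
      rw [e, Complex.add_re, Complex.ofReal_re]
      have := le_max_left (- g z) 0
      simp only [hg] at this ⊢; linarith
    · have hzs : z ∈ sphere c r := by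
        rw [mem_sphere]; rw [mem_closedBall] at hz; rw [mem_ball] at hz'
        exact le_antisymm hz (not_lt.1 hz')
      have e : F z = h z := by simp only [hF, hD, if_neg hz', add_zero]
      rw [e]; exact (hs z hzs).le
  set μ : ℝ := - g c / 2 with hμ
  have hμ0 : 0 < μ := by rw [hμ]; linarith
  obtain ⟨β, r0, hβ, hr0, hβr, hGμ, hhr⟩ : ∃ β r0 : ℝ, 0 < β ∧ 0 < r0 ∧ β ≤ r ∧
      (∀ z ∈ ball c β, ∀ W ∈ closedBall (h c) (2 * r0), (G (z, W)).re ≤ - μ) ∧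
      (∀ z ∈ ball c β, ‖h z - h c‖ < r0) := by
    have hop : IsOpen {x : ℂ × ℂ | (G x).re < - μ} := isOpen_lt (Complex.continuous_re.comp hGc) continuous_const
    have hin : (c, h c) ∈ {x : ℂ × ℂ | (G x).re < - μ} := by
      change g c < - μ
      rw [hμ]; linarith
    obtain ⟨e, he, hsub⟩ := Metric.isOpen_iff.1 hop _ hin
    obtain ⟨d, hd, hdh⟩ := Metric.continuous_iff.1 hh c (e / 4) (by positivity)
    refine ⟨min (min e d) r, e / 4, by positivity, by positivity, min_le_right _ _, fun z hz W hW => ?_, fun z hz => ?_⟩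
    · have : (z, W) ∈ ball (c, h c) e := by
        rw [mem_ball, Prod.dist_eq, max_lt_iff]
        exact ⟨lt_of_lt_of_le hz ((min_le_left _ _).trans (min_le_left _ _)),
          lt_of_le_of_lt hW (by linarith)⟩
      exact le_of_lt (hsub this)
    · have := hdh z (lt_of_lt_of_le hz ((min_le_left _ _).trans (min_le_right _ _)))
      rwa [dist_eq_norm] at this
  set Γ : Set (ℂ × ℂ) := Set.image (fun z => (z, h z)) (closedBall c r) with hΓ
  set ΓF : Set (ℂ × ℂ) := Set.image (fun z => (z, F z)) (closedBall c r) with hΓF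
  have hΓc : IsCompact Γ := (isCompact_closedBall c r).image (by fun_prop)
  have hΓFc : IsCompact ΓF := (isCompact_closedBall c r).image (by fun_prop)
  obtain ⟨C0, C1, hC0, hC1, hex⟩ := exists_good_s hu hua c (h c) hβ hr0 (K := ΓF) (Γ := Γ) hΓFc hΓc (by
    rintro _ ⟨z, hz, rfl⟩; exact hub z hz)
  set δ : ℝ := μ / 4 / (C1 + 1) with hδ
  have hδ0 : 0 < δ := by positivity
  have hδC : δ * C1 ≤ μ / 4 := by
    rw [hδ, div_mul_eq_mul_div, div_le_iff₀ (by positivity)]; nlinarith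
  obtain ⟨B1, hB1⟩ := (hΓc.union hΓFc).exists_bound_of_continuousOn
    (f := fun x : ℂ × ℂ => ‖x.1‖ ^ 2 + ‖x.2‖ ^ 2) (by fun_prop)
  obtain ⟨B2, hB2⟩ := hΓc.exists_bound_of_continuousOn (f := fun x : ℂ × ℂ => (G x).re)
    (Complex.continuous_re.comp hGc).continuousOn
  set κ : ℝ := μ / 8 / (|B1| + 1) with hκ
  have hκ0 : 0 < κ := by positivity
  have hκB : ∀ x ∈ Γ ∪ ΓF, κ * (‖x.1‖ ^ 2 + ‖x.2‖ ^ 2) ≤ μ / 8 := by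
    intro x hx
    have h3 := hB1 x hx
    rw [Real.norm_eq_abs] at h3
    have h4 := (le_abs_self _).trans (h3.trans (le_abs_self B1))
    rw [hκ, div_mul_eq_mul_div, div_le_iff₀ (by positivity)]
    nlinarith
  obtain ⟨s, hsC, hsub, hsK, hsΓ, z0, hz0, ρ, hρ, hcirc⟩ := hex (|B2| / δ) (by positivity)
  set v : ℂ × ℂ → ℝ := fun x => (- (G x).re - (μ / 4 + δ * C0)) + (δ * s x + κ * (‖x.1‖ ^ 2 + ‖x.2‖ ^ 2)) with hv
  have hGre : ContDiff ℝ 2 (fun x => (G x).re) := Complex.reCLM.contDiff.comp (hGC.restrict_scalars ℝ)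
  have hvC : ContDiff ℝ 2 v :=
    (hGre.neg.sub contDiff_const).add ((contDiff_const.mul hsC).add
      (contDiff_const.mul ((normsq_contDiff contDiff_fst).add (normsq_contDiff contDiff_snd))))
  have hvg : Good v := by
    refine good_of_submean hvC hκ0 fun x b => ?_
    change _ ≤ cm (fun t => v (x + t • b))
    have e : (fun t : ℂ => v (x + t • b)) = fun t => (- (G (x + t • b)).re + - (μ / 4 + δ * C0)) +
        (δ * s (x + t • b) + κ * (‖x.1 + t * b.1‖ ^ 2 + ‖x.2 + t * b.2‖ ^ 2)) := by
      funext t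
      simp only [hv, Prod.fst_add, Prod.snd_add, Prod.smul_fst, Prod.smul_snd, smul_eq_mul]
      ring
    have hline : Continuous fun t : ℂ => x + t • b := by fun_prop
    have hhol : Differentiable ℂ fun t : ℂ => G (x + t • b) :=
      (hGC.differentiable (by norm_num)).comp (by fun_prop)
    have c1 : Continuous fun t : ℂ => - (G (x + t • b)).re := (Complex.continuous_re.comp (hGc.comp hline)).neg
    have c2 : Continuous fun t : ℂ => δ * s (x + t • b) := continuous_const.mul (hsC.continuous.comp hline)
    have c3 : Continuous fun t : ℂ => ‖x.1 + t * b.1‖ ^ 2 := by fun_prop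
    have c4 : Continuous fun t : ℂ => ‖x.2 + t * b.2‖ ^ 2 := by fun_prop
    have c5 : Continuous fun t : ℂ => κ * (‖x.1 + t * b.1‖ ^ 2 + ‖x.2 + t * b.2‖ ^ 2) := by fun_prop
    have e1 : cm (fun t : ℂ => - (G (x + t • b)).re) = - (G x).re := by
      have := cm_const_mul (-1) (fun t : ℂ => (G (x + t • b)).re)
      rw [cm_hol hhol] at this
      simpa using this
    have c6 : Continuous fun t : ℂ => - (G (x + t • b)).re + - (μ / 4 + δ * C0) := c1.add continuous_const
    have c7 : Continuous fun t : ℂ => δ * s (x + t • b) + κ * (‖x.1 + t * b.1‖ ^ 2 + ‖x.2 + t * b.2‖ ^ 2) := c2.add c5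
    rw [e, cm_add c6 c7, cm_add c1 continuous_const, cm_add c2 c5, cm_const_mul,
      cm_const_mul, cm_add c3 c4, cm_normsq, cm_normsq, cm_const, e1]
    have h3 := norm_sq_le_sum b
    have h4 := hsub x b
    have h5 : δ * s x ≤ δ * cm (fun t => s (x + t • b)) := by gcongr
    have h6 : κ * ‖b‖ ^ 2 ≤ κ * (‖b.1‖ ^ 2 + ‖b.2‖ ^ 2) := by gcongr
    simp only [hv]; linarith
  have hz0r : z0 ∈ closedBall c r := ball_subset_closedBall (ball_subset_ball hβr hz0)
  refine core_top hvg hr hh hFc hFh ?_ ?_ hz0r (lt_of_lt_of_le (hhr z0 hz0) hρ.1) ?_ (fun W hW => ?_)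
  · intro z hz
    have hm : (z, h z) ∈ Γ := ⟨z, hz, rfl⟩
    have e1 := hκB _ (Or.inl hm)
    have e2 := hsΓ _ hm
    have e3 := hB2 _ hm
    rw [Real.norm_eq_abs] at e3
    have e4 := neg_le_of_abs_le (e3.trans (le_abs_self B2))
    have e5 : δ * s (z, h z) ≤ - |B2| := by
      calc δ * s (z, h z) ≤ δ * -(|B2| / δ) := by gcongr
        _ = _ := by field_simp
    have e6 : 0 ≤ δ * C0 := by positivity
    simp only [hv]
    linarith
  · intro z hz
    have hm : (z, F z) ∈ ΓF := ⟨z, hz, rfl⟩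
    have e1 := hκB _ (Or.inr hm)
    have e2 := hsK _ hm
    have e3 := hGF z hz
    have e5 : δ * s (z, F z) ≤ δ * C0 := by gcongr
    simp only [hv]
    linarith
  · by_contra hcon
    push Not at hcon
    have h3 := hGμ z0 hz0 (F z0) (by rw [mem_closedBall, dist_eq_norm]; exact hcon.trans hρ.2)
    have h4 := hGF z0 hz0r
    linarith
  · have h3 := hGμ z0 hz0 W (by rw [mem_closedBall]; rw [mem_sphere] at hW; rw [hW]; exact hρ.2)
    have h4 := hcirc W hW
    have h5 : δ * (- C1) ≤ δ * (s (z0, W) - C0) := by gcongr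
    have h6 : 0 ≤ κ * (‖z0‖ ^ 2 + ‖W‖ ^ 2) := by positivity
    simp only [hv]
    linarith
end Shch

namespace Shch
open Filter Topology MeasureTheory

/-- the half-plane property of `h` on the disc `(c, r)` -/
def HP (h : ℂ → ℂ) (c : ℂ) (r : ℝ) : Prop := ∀ q p : ℂ[X], (∀ z ∈ closedBall c r, q.eval z ≠ 0) →
    (∀ z ∈ sphere c r, 0 < (q.eval z * h z + p.eval z).re) → 0 ≤ (q.eval c * h c + p.eval c).re

lemma circ_le {h : ℂ → ℂ} {c : ℂ} {r : ℝ} (hr : 0 < r) (hh : ContinuousOn h (sphere c r)) (H : HP h c r)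
    {q : ℂ[X]} (hq : ∀ z ∈ closedBall c r, q.eval z ≠ 0) :
    cm (fun t => (q.eval (c + r * t) * h (c + r * t)).re) ≤ (q.eval c * h c).re := by
  set g : ℂ → ℝ := fun t => (q.eval (c + r * t) * h (c + r * t)).re with hg
  have hmap : MapsTo (fun t : ℂ => c + r * t) (sphere 0 1) (sphere c r) := by
    intro t ht
    have : ‖t‖ = 1 := by simpa using ht
    rw [mem_sphere, Complex.dist_eq]; simp [this, abs_of_pos hr]
  have hgc : ContinuousOn g (sphere 0 1) := by
    refine Complex.continuous_re.comp_continuousOn (ContinuousOn.mul ?_ (hh.comp (by fun_prop) hmap))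
    exact (q.continuous.comp (by fun_prop : Continuous fun t : ℂ => c + r * t)).continuousOn
  refine le_of_forall_pos_le_add (fun ε hε => ?_)
  obtain ⟨p, hp⟩ := exists_poly_near hgc (ε := ε / 3) (by positivity)
  have hrC : (r : ℂ) ≠ 0 := by exact_mod_cast hr.ne'
  have h1 := H q (C ((2 * (ε / 3) : ℝ) : ℂ) - p.comp (C (r : ℂ)⁻¹ * (X - C c))) hq (by
    intro z hz
    have ht : (r : ℂ)⁻¹ * (z - c) ∈ sphere (0:ℂ) 1 := by
      have : ‖z - c‖ = r := by rwa [mem_sphere, Complex.dist_eq] at hz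
      rw [mem_sphere_zero_iff_norm, norm_mul, this]; simp [abs_of_pos hr, hr.ne']
    have h2 := hp _ ht
    have e : c + r * ((r : ℂ)⁻¹ * (z - c)) = z := by field_simp; ring
    simp only [hg, e] at h2
    simp only [eval_sub, eval_C, eval_comp, eval_mul, eval_X, Complex.add_re, Complex.sub_re, Complex.ofReal_re]
    have := (abs_le.1 h2).2
    linarith)
  have h3 : cm g ≤ (p.eval 0).re + ε / 3 := by
    rw [← cm_poly, ← cm_const (ε / 3)]
    have e : cm (fun z => (p.eval z).re) + cm (fun _ => ε / 3) = cm (fun z => (p.eval z).re + ε / 3) :=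
      (cm_add (Complex.continuous_re.comp p.continuous) continuous_const).symm
    rw [cm_const] at e ⊢
    rw [e]
    have c3 : Continuous (fun z => (p.eval z).re + ε / 3) := (Complex.continuous_re.comp p.continuous).add continuous_const
    refine cm_mono (ii_of_cont hgc) (ii_of_cont c3.continuousOn) fun z hz => ?_
    have := (abs_le.1 (hp z hz)).1
    linarith
  simp only [eval_sub, eval_C, eval_comp, eval_mul, eval_X, Complex.add_re, Complex.sub_re, Complex.ofReal_re, sub_self, mul_zero] at h1
  linarith

lemma circ_eq {h : ℂ → ℂ} {c : ℂ} {r : ℝ} (hr : 0 < r) (hh : ContinuousOn h (sphere c r)) (H : HP h c r)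
    {q : ℂ[X]} (hq : ∀ z ∈ closedBall c r, q.eval z ≠ 0) :
    cm (fun t => (q.eval (c + r * t) * h (c + r * t)).re) = (q.eval c * h c).re := by
  refine le_antisymm (circ_le hr hh H hq) ?_
  have h1 := circ_le hr hh H (q := -q) (fun z hz => by simpa using hq z hz)
  have h2 := cm_const_mul (-1) (fun t => (q.eval (c + r * t) * h (c + r * t)).re)
  simp only [eval_neg, neg_mul, Complex.neg_re, one_mul] at h1 h2
  linarith

lemma circ_re {h : ℂ → ℂ} {c : ℂ} {r : ℝ} (hr : 0 < r) (hh : ContinuousOn h (sphere c r)) (H : HP h c r)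
    {ω : ℂ} (hω : ω ≠ 0) :
    cm (fun t => (ω * (t * h (c + r * t))).re) = 0 := by
  have hrC : (r : ℂ) ≠ 0 := by exact_mod_cast hr.ne'
  have hmap : MapsTo (fun t : ℂ => c + r * t) (sphere 0 1) (sphere c r) := by
    intro t ht
    have : ‖t‖ = 1 := by simpa using ht
    rw [mem_sphere, Complex.dist_eq]; simp [this, abs_of_pos hr]
  have hc1 : ContinuousOn (fun t : ℂ => h (c + r * t)) (sphere 0 1) := hh.comp (by fun_prop) hmap
  have h1 := circ_eq hr hh H (q := C ω * (C ((2:ℝ):ℂ) + C (r : ℂ)⁻¹ * (X - C c))) (by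
    intro z hz
    simp only [eval_mul, eval_C, eval_add, eval_sub, eval_X]
    refine mul_ne_zero hω fun h0 => ?_
    have h2 : (r : ℂ)⁻¹ * (z - c) = - ((2:ℝ):ℂ) := by linear_combination h0
    have h3 := congrArg norm h2
    rw [norm_mul, norm_neg, norm_inv, Complex.norm_real, Complex.norm_real] at h3
    rw [mem_closedBall, Complex.dist_eq] at hz
    simp only [Real.norm_eq_abs, abs_of_pos hr] at h3
    have h4 : r⁻¹ * ‖z - c‖ ≤ 1 := by
      rw [inv_mul_le_iff₀ hr]; linarith
    norm_num at h3; linarith)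
  have h2 := circ_eq hr hh H (q := C ω * C ((2:ℝ):ℂ)) (by
    intro z hz; simp [hω])
  simp only [eval_mul, eval_C, eval_add, eval_sub, eval_X, sub_self, mul_zero, add_zero] at h1 h2
  rw [← h2] at h1
  unfold cm at h1 h2 ⊢
  have hpi : (2 * Real.pi)⁻¹ ≠ 0 := by positivity
  have h3 := mul_left_cancel₀ hpi h1
  have hcl : ContinuousOn (fun t : ℂ => (ω * ((2:ℝ):ℂ) * h (c + r * t)).re) (sphere 0 1) :=
    Complex.continuous_re.comp_continuousOn (continuousOn_const.mul hc1)
  have hcl2 : ContinuousOn (fun t : ℂ => (ω * (t * h (c + r * t))).re) (sphere 0 1) :=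
    Complex.continuous_re.comp_continuousOn (continuousOn_const.mul (continuousOn_id.mul hc1))
  have h4 := intervalIntegral.integral_add (ii_of_cont hcl) (ii_of_cont hcl2)
  rw [show (∫ x in (0:ℝ)..2 * Real.pi, ((ω * ((2:ℝ):ℂ) * h (c + r * Complex.exp (x * Complex.I))).re +
     (ω * (Complex.exp (x * Complex.I) * h (c + r * Complex.exp (x * Complex.I)))).re)) = ∫ x in (0:ℝ)..2 * Real.pi, (ω * (((2:ℝ):ℂ) + (r:ℂ)⁻¹ * (c + r * Complex.exp (x * Complex.I) - c)) * h (c + r * Complex.exp (x * Complex.I))).re by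
      congr 1; funext x
      rw [← Complex.add_re]; congr 1
      field_simp; ring, h3] at h4
  have h5 : (∫ x in (0:ℝ)..2 * Real.pi, (ω * (Complex.exp (x * Complex.I) * h (c + r * Complex.exp (x * Complex.I)))).re) = 0 := by
    linarith
  rw [h5, mul_zero]

lemma circ_zero {h : ℂ → ℂ} {c : ℂ} {r : ℝ} (hr : 0 < r) (hh : ContinuousOn h (sphere c r)) (H : HP h c r) :
    (∮ z in C(c, r), h z) = 0 := by
  have h1 := circ_re hr hh H (ω := r * Complex.I) (by simp [hr.ne'])
  have h2 := circ_re hr hh H (ω := r) (by simp [hr.ne'])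
  have hItg : IntervalIntegrable (fun θ : ℝ => deriv (circleMap c r) θ • h (circleMap c r θ)) volume 0 (2 * Real.pi) := by
    apply Continuous.intervalIntegrable
    simp only [deriv_circleMap, smul_eq_mul]
    exact (((continuous_circleMap 0 r).mul continuous_const).mul
      (hh.comp_continuous (continuous_circleMap c r) fun θ => circleMap_mem_sphere c hr.le θ))
  have hpi : (2 * Real.pi)⁻¹ ≠ 0 := by positivity
  apply Complex.ext
  · have e := Complex.reCLM.intervalIntegral_comp_comm hItg
    simp only [Complex.reCLM_apply] at e
    rw [circleIntegral, ← e, Complex.zero_re]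
    unfold cm at h1
    refine Eq.trans ?_ ((mul_eq_zero.1 h1).resolve_left hpi)
    congr 1; funext x; beta_reduce; congr 1
    simp [deriv_circleMap, circleMap]; ring
  · have e := Complex.imCLM.intervalIntegral_comp_comm hItg
    simp only [Complex.imCLM_apply] at e
    rw [circleIntegral, ← e, Complex.zero_im]
    unfold cm at h2
    refine Eq.trans ?_ ((mul_eq_zero.1 h2).resolve_left hpi)
    congr 1; funext x; beta_reduce
    have : ∀ w : ℂ, (Complex.I * w).im = w.re := by intro w; simp
    rw [← this]; congr 1
    simp [deriv_circleMap, circleMap]; ring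

/-- real differentiable + vanishing circle integrals implies complex differentiable -/
lemma diffAt_of_circ {F : ℂ → ℂ} {c : ℂ} (hd : DifferentiableAt ℝ F c) (hF : Continuous F)
    (H : ∀ᶠ r in 𝓝[>] (0:ℝ), (∮ z in C(c, r), F z) = 0) : DifferentiableAt ℂ F c := by
  set A := fderiv ℝ F c with hA
  set α : ℂ := (A 1 - Complex.I * A Complex.I) / 2 with hα
  set β : ℂ := (A 1 + Complex.I * A Complex.I) / 2 with hβ
  have hAv : ∀ v : ℂ, A v = α * v + β * (starRingEnd ℂ v) := by
    intro v
    have e : v = v.re • (1:ℂ) + v.im • Complex.I := by simp [Complex.re_add_im]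
    have e2 : A v = v.re * A 1 + v.im * A Complex.I := by
      conv_lhs => rw [e, map_add, map_smul, map_smul]
      simp
    have e3 : (starRingEnd ℂ v) = v.re - v.im * Complex.I := by
      apply Complex.ext <;> simp
    have e4 : v = v.re + v.im * Complex.I := (Complex.re_add_im v).symm
    rw [e2, e3, hα, hβ]
    nth_rewrite 3 [e4]
    linear_combination ((v.im : ℂ) * A Complex.I) * Complex.I_sq
  have hβ0 : β = 0 := by
    by_contra hne
    have hpos : 0 < ‖β‖ / 2 := by positivity
    have hlo := (hasFDerivAt_iff_isLittleO_nhds_zero.1 hd.hasFDerivAt).def hpos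
    rw [Metric.eventually_nhds_iff] at hlo
    obtain ⟨δ, hδ, hlo⟩ := hlo
    obtain ⟨r, hr0, hrδ, hrc⟩ : ∃ r : ℝ, 0 < r ∧ r < δ ∧ (∮ z in C(c, r), F z) = 0 := by
      have h3 : ∀ᶠ r in 𝓝[>] (0:ℝ), r < δ := nhdsWithin_le_nhds (gt_mem_nhds hδ)
      obtain ⟨r, h⟩ := ((h3.and H).and self_mem_nhdsWithin).exists
      exact ⟨r, h.2, h.1.1, h.1.2⟩
    -- integral of the linear part
    have e1 : (∮ z in C(c, r), (β * (starRingEnd ℂ (z - c)))) = 2 * Real.pi * Complex.I * r ^ 2 * β := by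
      rw [circleIntegral]
      have : ∀ θ : ℝ, deriv (circleMap c r) θ • (β * (starRingEnd ℂ (circleMap c r θ - c))) = Complex.I * r ^ 2 * β := by
        intro θ
        rw [deriv_circleMap, smul_eq_mul, circleMap_sub_center]
        have h4 : circleMap 0 r θ * starRingEnd ℂ (circleMap 0 r θ) = r ^ 2 := by
          rw [Complex.mul_conj, Complex.normSq_eq_norm_sq, norm_circleMap_zero, sq_abs]; push_cast; ring
        linear_combination (Complex.I * β) * h4
      simp only [this, intervalIntegral.integral_const, sub_zero]
      rw [Complex.real_smul]; push_cast; ring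
    have e2 : (∮ z in C(c, r), (F c + α * (z - c))) = 0 := by
      have : Differentiable ℂ fun z : ℂ => F c + α * (z - c) := by fun_prop
      exact this.diffContOnCl.circleIntegral_eq_zero hr0.le
    have i0 : CircleIntegrable F c r := hF.continuousOn.circleIntegrable hr0.le
    have i1 : CircleIntegrable (fun z => β * (starRingEnd ℂ (z - c))) c r := by
      apply ContinuousOn.circleIntegrable hr0.le
      exact (continuous_const.mul (Complex.continuous_conj.comp (continuous_id.sub continuous_const))).continuousOn
    have i2 : CircleIntegrable (fun z => F c + α * (z - c)) c r := by
      apply ContinuousOn.circleIntegrable hr0.le; fun_prop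
    have i3 : CircleIntegrable (fun z => (F c + α * (z - c)) + β * (starRingEnd ℂ (z - c))) c r := i2.add i1
    have e3 := circleIntegral.integral_sub i0 i3
    rw [circleIntegral.integral_add i2 i1, hrc, e1, e2] at e3
    have e4 : ‖∮ z in C(c, r), (F z - ((F c + α * (z - c)) + β * (starRingEnd ℂ (z - c))))‖ ≤ 2 * Real.pi * r * (‖β‖ / 2 * r) := by
      apply circleIntegral.norm_integral_le_of_norm_le_const hr0.le
      intro z hz
      have hz' : ‖z - c‖ = r := by rwa [mem_sphere, Complex.dist_eq] at hz
      have h5 := hlo (y := z - c) (by rw [dist_zero_right, hz']; exact hrδ)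
      rw [← hA, hAv, hz', add_sub_cancel] at h5
      rw [show F z - ((F c + α * (z - c)) + β * (starRingEnd ℂ (z - c))) = F z - F c - (α * (z - c) + β * (starRingEnd ℂ (z - c))) by ring]
      exact h5
    rw [e3, zero_add, zero_sub, norm_neg] at e4
    simp only [norm_mul, Complex.norm_I, norm_pow, Complex.norm_real, Real.norm_eq_abs, abs_of_pos hr0, abs_of_pos Real.pi_pos, mul_one] at e4
    have e5 : ‖(2:ℂ)‖ = 2 := by simp
    rw [e5] at e4
    have : 0 < Real.pi * r ^ 2 * ‖β‖ := by positivity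
    nlinarith
  have hd2 : HasFDerivAt F (A : ℂ →L[ℝ] ℂ) c := hd.hasFDerivAt
  have : HasFDerivAt F (ContinuousLinearMap.toSpanSingleton ℂ α) c := by
    refine hasFDerivAt_of_restrictScalars ℝ hd2 ?_
    ext v; simp [hAv, hβ0, mul_comm]
  exact this.differentiableAt

lemma hol_of_circ_cont {f : ℂ → ℂ} {c0 : ℂ} {R : ℝ} (hf : Continuous f)
    (H : ∀ c r, 0 < r → closedBall c r ⊆ ball c0 R → (∮ z in C(c, r), f z) = 0) :
    DifferentiableOn ℂ f (ball c0 R) := by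
  suffices hs : ∀ R' < R, DifferentiableOn ℂ f (ball c0 R') by
    intro z hz
    obtain ⟨R', h1, h2⟩ := exists_between (mem_ball.1 hz)
    exact ((hs R' h2).differentiableAt (isOpen_ball.mem_nhds h1)).differentiableWithinAt
  intro R' hR'
  set φ : ℕ → ContDiffBump (0:ℂ) := fun n => ⟨1 / (n + 1) / 2, 1 / (n + 1), by positivity,
    half_lt_self (by positivity)⟩ with hφ
  set Φ : ℕ → ℂ → ℂ := fun n => convolution ((φ n).normed volume) f (ContinuousLinearMap.lsmul ℝ ℝ) volume with hΦ
  have hΦs : ∀ n, ContDiff ℝ 1 (Φ n) := fun n =>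
    (φ n).hasCompactSupport_normed.contDiff_convolution_left _ ((φ n).contDiff_normed) hf.locallyIntegrable
  have hlim : TendstoUniformlyOn Φ f atTop (ball c0 R') := by
    rw [Metric.tendstoUniformlyOn_iff]
    intro ε hε
    have huc := (isCompact_closedBall c0 (R' + 1)).uniformContinuousOn_of_continuous hf.continuousOn
    rw [Metric.uniformContinuousOn_iff] at huc
    obtain ⟨δ, hδ, huc⟩ := huc (ε / 2) (by positivity)
    have ht : Tendsto (fun n : ℕ => (1:ℝ) / (n + 1)) atTop (𝓝 0) := tendsto_one_div_add_atTop_nhds_zero_nat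
    filter_upwards [ht.eventually_lt_const (show (0:ℝ) < min δ 1 by positivity)] with n hn z hz
    rw [dist_comm]
    refine lt_of_le_of_lt (ContDiffBump.dist_normed_convolution_le hf.aestronglyMeasurable (fun x hx => ?_)) (half_lt_self hε)
    have hx' : dist x z < min δ 1 := lt_trans hx hn
    refine (huc x ?_ z ?_ (hx'.trans_le (min_le_left _ _))).le
    · rw [mem_closedBall]
      have := dist_triangle x z c0
      have := hx'.trans_le (min_le_right _ _)
      have := mem_ball.1 hz
      linarith
    · rw [mem_closedBall]; have := mem_ball.1 hz; linarith
  refine hlim.tendstoLocallyUniformlyOn.differentiableOn ?_ isOpen_ball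
  have ht : Tendsto (fun n : ℕ => (1:ℝ) / (n + 1)) atTop (𝓝 0) := tendsto_one_div_add_atTop_nhds_zero_nat
  filter_upwards [ht.eventually_lt_const (show (0:ℝ) < R - R' by linarith)] with n hn c hc
  refine (diffAt_of_circ ((hΦs n).differentiable (by norm_num) c) (hΦs n).continuous ?_).differentiableWithinAt
  have hc' := mem_ball.1 hc
  have h3 : ∀ᶠ r in 𝓝[>] (0:ℝ), r < R - 1 / (n + 1) - dist c c0 :=
    nhdsWithin_le_nhds (gt_mem_nhds (by linarith))
  filter_upwards [h3, self_mem_nhdsWithin] with r hr hr0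
  have hr0 : 0 < r := hr0
  set δ : ℝ := 1 / (n + 1) with hδ
  set k : ℂ → ℝ := (φ n).normed volume with hk
  have hkc : Continuous k := (φ n).continuous_normed
  have hks : ∀ y, y ∉ closedBall (0:ℂ) δ → k y = 0 := by
    intro y hy
    have h4 := (φ n).tsupport_normed_eq (μ := volume)
    by_contra hne
    exact hy (h4 ▸ subset_tsupport _ hne)
  have hΦe : ∀ z, Φ n z = ∫ y in closedBall (0:ℂ) δ, (k y : ℂ) * f (z - y) := by
    intro z
    rw [setIntegral_eq_integral_of_forall_compl_eq_zero]
    · simp only [hΦ, convolution]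
      congr 1
    · intro y hy; rw [hks y hy]; simp
  rw [circleIntegral, intervalIntegral.integral_of_le (by positivity)]
  have e0 : ∀ θ : ℝ, deriv (circleMap c r) θ • Φ n (circleMap c r θ) =
      ∫ y in closedBall (0:ℂ) δ, deriv (circleMap c r) θ • ((k y : ℂ) * f (circleMap c r θ - y)) := by
    intro θ; rw [hΦe, integral_smul]
  simp only [e0]
  rw [integral_integral_swap]
  · apply integral_eq_zero_of_ae
    refine (ae_restrict_iff' measurableSet_closedBall).2 (Eventually.of_forall fun y hy => ?_)
    have h6 := H (c - y) r hr0 (by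
      refine closedBall_subset_ball' ?_
      have h7 : dist (c - y) c0 ≤ dist c c0 + δ := by
        calc dist (c - y) c0 ≤ dist (c - y) c + dist c c0 := dist_triangle _ _ _
          _ ≤ _ := by rw [dist_eq_norm, sub_sub_cancel_left, norm_neg]; rw [mem_closedBall_zero_iff] at hy; linarith
      linarith)
    rw [circleIntegral, intervalIntegral.integral_of_le (by positivity)] at h6
    have e7 : ∀ θ : ℝ, deriv (circleMap c r) θ • ((k y : ℂ) * f (circleMap c r θ - y)) =
        (k y : ℂ) * (deriv (circleMap (c - y) r) θ • f (circleMap (c - y) r θ)) := by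
      intro θ
      rw [deriv_circleMap, deriv_circleMap, show circleMap (c - y) r θ = circleMap c r θ - y by simp [circleMap]; ring]
      simp only [smul_eq_mul]; ring
    simp only [e7, integral_const_mul, h6, mul_zero, Pi.zero_apply]
  · rw [Measure.prod_restrict, ← IntegrableOn]
    have hcj : Continuous (Function.uncurry fun (θ : ℝ) (y : ℂ) => deriv (circleMap c r) θ • ((k y : ℂ) * f (circleMap c r θ - y))) := by
      simp only [deriv_circleMap, smul_eq_mul, Function.uncurry_def]
      have a1 : Continuous fun x : ℝ × ℂ => circleMap 0 r x.1 := (continuous_circleMap 0 r).comp continuous_fst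
      have a2 : Continuous fun x : ℝ × ℂ => circleMap c r x.1 := (continuous_circleMap c r).comp continuous_fst
      exact (a1.mul continuous_const).mul ((Complex.continuous_ofReal.comp (hkc.comp continuous_snd)).mul
        (hf.comp (a2.sub continuous_snd)))
    exact (hcj.continuousOn.integrableOn_compact (isCompact_Icc.prod (isCompact_closedBall (0:ℂ) δ))).mono_set
      (prod_mono Ioc_subset_Icc_self le_rfl)

lemma exists_ext {X : Type*} [TopologicalSpace X] [NormalSpace X] {s : Set X} (hs : IsClosed s) {f : X → ℂ} (hf : ContinuousOn f s) :
    ∃ g : X → ℂ, Continuous g ∧ ∀ x ∈ s, g x = f x := by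
  obtain ⟨g, hg⟩ := ContinuousMap.exists_restrict_eq hs ⟨s.domRestrict f, continuousOn_iff_continuous_domRestrict.1 hf⟩
  exact ⟨g, g.continuous, fun x hx => congrArg (fun k => k ⟨x, hx⟩) hg⟩

lemma hol_of_circ {f : ℂ → ℂ} {c0 : ℂ} {R : ℝ} (hf : ContinuousOn f (closedBall c0 R))
    (H : ∀ c r, 0 < r → closedBall c r ⊆ ball c0 R → (∮ z in C(c, r), f z) = 0) :
    DifferentiableOn ℂ f (ball c0 R) := by
  obtain ⟨g, hg, hgf⟩ := exists_ext isClosed_closedBall hf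
  refine (hol_of_circ_cont hg (R := R) fun c r hr hcr => ?_).congr fun z hz => (hgf z (ball_subset_closedBall hz)).symm
  rw [← H c r hr hcr]
  exact circleIntegral.integral_congr hr.le fun z hz => hgf z (ball_subset_closedBall (hcr (sphere_subset_closedBall hz)))

lemma core_hol {u : ℂ × ℂ → EReal} (hu : PSH u) {a : ℂ × ℂ} (hua : u a ≠ ⊥) {c : ℂ} {R : ℝ} {h : ℂ → ℂ}
    (hh : ContinuousOn h (closedBall c R)) (hub : ∀ z ∈ ball c R, u (z, h z) = ⊥) :
    DifferentiableOn ℂ h (ball c R) := by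
  refine hol_of_circ hh fun c1 r hr hcr => ?_
  obtain ⟨g, hg, hgf⟩ := exists_ext isClosed_closedBall (hh.mono (hcr.trans ball_subset_closedBall))
  have h1 := circ_zero hr hg.continuousOn (c := c1) (r := r) (fun q p hq hs =>
    core hu hua hr hg (fun z hz => by rw [hgf z hz]; exact hub z (hcr hz)) hq hs)
  rw [← h1]
  exact circleIntegral.integral_congr hr.le fun z hz => (hgf z (sphere_subset_closedBall hz)).symm
end Shch

namespace Shch
open Filter Topology

/-- the monic polynomial with lower coefficients `b` -/
def PP {m : ℕ} (b : Fin m → ℂ) : ℂ[X] := X ^ m + ∑ i : Fin m, C (b i) * X ^ (m - ((i : ℕ) + 1))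

lemma PP_eval {m : ℕ} (b : Fin m → ℂ) (w : ℂ) :
    (PP b).eval w = w ^ m + ∑ i : Fin m, b i * w ^ (m - ((i : ℕ) + 1)) := by
  simp [PP, eval_finset_sum]

lemma PP_deg {m : ℕ} (b : Fin m → ℂ) : (∑ i : Fin m, C (b i) * X ^ (m - ((i : ℕ) + 1))).degree < (m : WithBot ℕ) := by
  refine lt_of_le_of_lt (degree_sum_le _ _) ?_
  rw [Finset.sup_lt_iff (by exact WithBot.bot_lt_coe m)]
  intro i _
  refine lt_of_le_of_lt (degree_C_mul_X_pow_le _ _) ?_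
  have := i.2
  exact_mod_cast (by omega : m - ((i : ℕ) + 1) < m)

lemma PP_monic {m : ℕ} (b : Fin m → ℂ) : (PP b).Monic := monic_X_pow_add (PP_deg b)

lemma PP_natDegree {m : ℕ} (b : Fin m → ℂ) : (PP b).natDegree = m := by
  apply natDegree_eq_of_degree_eq_some
  rw [PP, degree_add_eq_left_of_degree_lt (by rw [degree_X_pow]; exact PP_deg b), degree_X_pow]

lemma PP_coeff {m : ℕ} (b : Fin m → ℂ) (i : Fin m) : (PP b).coeff (m - ((i : ℕ) + 1)) = b i := by
  have := i.2
  rw [PP, coeff_add, coeff_X_pow, if_neg (by omega), zero_add, finsetSum_coeff, Finset.sum_eq_single i]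
  · simp
  · intro j _ hj
    have := j.2
    rw [coeff_C_mul_X_pow, if_neg]
    intro h; apply hj; ext; omega
  · simp

lemma PP_card {m : ℕ} (b : Fin m → ℂ) : Multiset.card (PP b).roots = m := by
  rw [← (IsAlgClosed.splits (PP b)).natDegree_eq_card_roots, PP_natDegree]

lemma PP_prod {m : ℕ} (b : Fin m → ℂ) : ((PP b).roots.map (fun x => X - C x)).prod = PP b :=
  prod_multiset_X_sub_C_of_monic_of_roots_card_eq (PP_monic b) (by rw [PP_card, PP_natDegree])

lemma PP_eval_prod {m : ℕ} (b : Fin m → ℂ) (w : ℂ) : (PP b).eval w = ((PP b).roots.map (fun x => w - x)).prod := by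
  conv_lhs => rw [← PP_prod b]
  rw [eval_multiset_prod, Multiset.map_map]; simp

lemma PP_mem {m : ℕ} (b : Fin m → ℂ) (w : ℂ) : w ∈ (PP b).roots ↔ (PP b).eval w = 0 := by
  rw [mem_roots (PP_monic b).ne_zero]; rfl

lemma prod_lower {s : Multiset ℂ} {w : ℂ} {ε : ℝ} (hε : 0 ≤ ε) (h : ∀ x ∈ s, ε ≤ ‖w - x‖) :
    ε ^ (Multiset.card s) ≤ ‖(s.map (fun x => w - x)).prod‖ := by
  induction s using Multiset.induction_on with
  | empty => simp
  | cons a s ih =>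
    rw [Multiset.card_cons, Multiset.map_cons, Multiset.prod_cons, norm_mul, pow_succ, mul_comm]
    have h1 := h a (Multiset.mem_cons_self a s)
    have h2 := ih fun x hx => h x (Multiset.mem_cons_of_mem hx)
    exact mul_le_mul h1 h2 (by positivity) (by positivity)

lemma root_near {m : ℕ} {b : Fin m → ℂ} {w : ℂ} {ε : ℝ} (hε : 0 ≤ ε) (h : ‖(PP b).eval w‖ < ε ^ m) :
    ∃ x, (PP b).eval x = 0 ∧ dist x w < ε := by
  by_contra hcon
  push Not at hcon
  rw [PP_eval_prod] at h
  have h1 := prod_lower (s := (PP b).roots) (w := w) hε fun x hx => by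
    have := hcon x ((PP_mem b x).1 hx)
    rwa [dist_comm, dist_eq_norm] at this
  rw [PP_card] at h1
  linarith

/-- the set of distinct roots -/
def rt {m : ℕ} (b : Fin m → ℂ) : Finset ℂ := (PP b).roots.toFinset

lemma mem_rt {m : ℕ} {b : Fin m → ℂ} {w : ℂ} : w ∈ rt b ↔ (PP b).eval w = 0 := by
  rw [rt, Multiset.mem_toFinset, PP_mem]

lemma rt_card_le {m : ℕ} (b : Fin m → ℂ) : (rt b).card ≤ m :=
  (Multiset.toFinset_card_le _).trans (PP_card b).le

lemma PP_cont {m : ℕ} {a : Fin m → ℂ → ℂ} {U : Set ℂ} (ha : ∀ i, ContinuousOn (a i) U) (w : ℂ) :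
    ContinuousOn (fun z => (PP (fun i => a i z)).eval w) U := by
  simp only [PP_eval]
  exact continuousOn_const.add (continuousOn_finsetSum _ fun i _ => (ha i).mul continuousOn_const)

def DC (p : ℂ → ℂ[X]) (z1 : ℂ) : Prop := ∀ n, DifferentiableAt ℂ (fun z => (p z).coeff n) z1

lemma DC.mul {p q : ℂ → ℂ[X]} {z1 : ℂ} (hp : DC p z1) (hq : DC q z1) : DC (fun z => p z * q z) z1 := by
  intro n
  simp only [coeff_mul]
  exact DifferentiableAt.fun_sum fun i _ => (hp _).mul (hq _)

lemma DC.pow {p : ℂ → ℂ[X]} {z1 : ℂ} (hp : DC p z1) (n : ℕ) : DC (fun z => p z ^ n) z1 := by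
  induction n with
  | zero => intro n; simp
  | succ n ih => simp only [pow_succ]; exact ih.mul hp

lemma DC.prod {ι : Type*} (s : Finset ι) {p : ι → ℂ → ℂ[X]} {z1 : ℂ} (hp : ∀ i, DC (p i) z1) :
    DC (fun z => ∏ i ∈ s, p i z) z1 := by
  classical
  induction s using Finset.induction_on with
  | empty => intro n; simp
  | insert a s ha ih => simp only [Finset.prod_insert ha]; exact (hp a).mul ih

lemma DC.lin {h : ℂ → ℂ} {z1 : ℂ} (hh : DifferentiableAt ℂ h z1) : DC (fun z => X - C (h z)) z1 := by
  intro n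
  simp only [coeff_sub, coeff_C]
  by_cases hn : n = 0
  · simp only [hn, if_true]; fun_prop
  · simp [hn]

lemma pow_eq_zero_imp {x : ℂ} {n : ℕ} (h : x ^ n = 0) : x = 0 := by
  by_contra hx
  exact pow_ne_zero n hx h

lemma roots_prod_pow {ι : Type*} [Fintype ι] {h : ι → ℂ} (hinj : Function.Injective h) (κ : ι → ℕ) (i : ι) :
    (∏ j, (X - C (h j)) ^ κ j : ℂ[X]).rootMultiplicity (h i) = κ i := by
  classical
  have hne : ∀ s : Finset ι, (∏ j ∈ s, (X - C (h j)) ^ κ j : ℂ[X]) ≠ 0 := fun s =>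
    Finset.prod_ne_zero_iff.2 fun j _ => pow_ne_zero _ (X_sub_C_ne_zero _)
  rw [← Finset.mul_prod_erase Finset.univ _ (Finset.mem_univ i), rootMultiplicity_mul
    (mul_ne_zero (pow_ne_zero _ (X_sub_C_ne_zero _)) (hne _)), rootMultiplicity_X_sub_C_pow,
    rootMultiplicity_eq_zero, add_zero]
  rw [IsRoot, eval_prod, Finset.prod_eq_zero_iff]
  rintro ⟨j, hj, h0⟩
  simp only [eval_pow, eval_sub, eval_X, eval_C] at h0
  exact (Finset.mem_erase.1 hj).1 (hinj (sub_eq_zero.1 (pow_eq_zero_imp h0)).symm)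

lemma PP_factor {m : ℕ} {b : Fin m → ℂ} {ι : Type*} [Fintype ι] {h : ι → ℂ} (hinj : Function.Injective h)
    (hr : ∀ w, (PP b).eval w = 0 ↔ ∃ i, h i = w) :
    PP b = ∏ j, (X - C (h j)) ^ ((PP b).rootMultiplicity (h j)) := by
  classical
  conv_lhs => rw [← PP_prod b]
  rw [Finset.prod_multiset_map_count]
  have : (PP b).roots.toFinset = Finset.univ.image h := by
    ext w; rw [Multiset.mem_toFinset, PP_mem, hr]; simp
  rw [this, Finset.prod_image (fun x _ y _ hxy => hinj hxy)]
  simp [count_roots]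

lemma loc_hol {u : ℂ × ℂ → EReal} (hu : PSH u) {e : ℂ × ℂ} (hue : u e ≠ ⊥) {m : ℕ} {a : Fin m → ℂ → ℂ} {U : Set ℂ} (hU : IsOpen U)
    (ha : ∀ i, ContinuousOn (a i) U) (hub : ∀ z ∈ U, ∀ w, (PP fun i => a i z).eval w = 0 → u (z, w) = ⊥)
    {z1 : ℂ} (hz1 : z1 ∈ U) (hmax : ∀ z ∈ U, (rt fun i => a i z).card ≤ (rt fun i => a i z1).card) (i : Fin m) :
    DifferentiableAt ℂ (a i) z1 := by
  classical
  set S := rt fun i => a i z1 with hS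
  obtain ⟨ε0, hε0, hsep⟩ : ∃ ε0 : ℝ, 0 < ε0 ∧ ∀ w ∈ S, ∀ w' ∈ S, w ≠ w' → 2 * ε0 ≤ dist w w' := by
    have : ∀ᶠ ε in 𝓝[>] (0:ℝ), ∀ w ∈ S, ∀ w' ∈ S, w ≠ w' → 2 * ε ≤ dist w w' := by
      refine (Finset.eventually_all S).2 fun w _ => (Finset.eventually_all S).2 fun w' _ => ?_
      by_cases hw : w = w'
      · simp [hw]
      · have h1 : 0 < dist w w' / 2 := by have := dist_pos.2 hw; positivity
        filter_upwards [nhdsWithin_le_nhds (gt_mem_nhds h1)] with ε hε _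
        linarith
    obtain ⟨ε, h1, h2⟩ := (this.and self_mem_nhdsWithin).exists
    exact ⟨ε, h2, h1⟩
  obtain ⟨δ, hδ, hδU, hδe⟩ : ∃ δ : ℝ, 0 < δ ∧ closedBall z1 δ ⊆ U ∧
      ∀ z ∈ closedBall z1 δ, ∀ w ∈ S, ‖(PP fun i => a i z).eval w‖ < ε0 ^ m := by
    have h1 : ∀ᶠ z in 𝓝 z1, z ∈ U ∧ ∀ w ∈ S, ‖(PP fun i => a i z).eval w‖ < ε0 ^ m := by
      refine Eventually.and (hU.mem_nhds hz1) ((Finset.eventually_all S).2 fun w hw => ?_)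
      have h2 := ((PP_cont ha w).continuousAt (hU.mem_nhds hz1)).norm
      refine h2.eventually_lt_const ?_
      beta_reduce; rw [mem_rt.1 hw, norm_zero]; positivity
    obtain ⟨δ, hδ, h⟩ := Metric.nhds_basis_closedBall.eventually_iff.1 h1
    exact ⟨δ, hδ, fun z hz => (h hz).1, fun z hz => (h hz).2⟩
  have hex : ∀ z : ℂ, ∀ w : S, ∃ x, z ∈ closedBall z1 δ → (PP fun i => a i z).eval x = 0 ∧ dist x w < ε0 := by
    intro z w
    by_cases hz : z ∈ closedBall z1 δ
    · obtain ⟨x, h1, h2⟩ := root_near hε0.le (hδe z hz w w.2)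
      exact ⟨x, fun _ => ⟨h1, h2⟩⟩
    · exact ⟨0, fun h => absurd h hz⟩
  choose H hH using hex
  have hdis : ∀ w w' : S, ∀ x : ℂ, dist x w < ε0 → dist x w' < ε0 → w = w' := by
    intro w w' x h1 h2
    by_contra hne
    have h3 := hsep w w.2 w' w'.2 fun h => hne (Subtype.ext h)
    have h4 := dist_triangle_left (w : ℂ) w' x
    linarith
  have hinj : ∀ z ∈ closedBall z1 δ, Function.Injective (H z) := by
    intro z hz w w' hww
    exact hdis w w' (H z w) (hH z w hz).2 (hww ▸ (hH z w' hz).2)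
  have hroots : ∀ z ∈ closedBall z1 δ, ∀ x, (PP fun i => a i z).eval x = 0 ↔ ∃ w, H z w = x := by
    intro z hz x
    constructor
    · intro hx
      have hsub : Finset.univ.image (H z) ⊆ rt fun i => a i z := by
        intro y hy
        obtain ⟨w, _, rfl⟩ := Finset.mem_image.1 hy
        exact mem_rt.2 (hH z w hz).1
      have hcard : (rt fun i => a i z).card ≤ (Finset.univ.image (H z)).card := by
        rw [Finset.card_image_of_injective _ (hinj z hz)]
        simpa using hmax z (hδU hz)
      rw [← mem_rt, ← Finset.eq_of_subset_of_card_le hsub hcard] at hx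
      obtain ⟨w, _, h⟩ := Finset.mem_image.1 hx
      exact ⟨w, h⟩
    · rintro ⟨w, rfl⟩; exact (hH z w hz).1
  have huniq : ∀ z ∈ closedBall z1 δ, ∀ x, (PP fun i => a i z).eval x = 0 → ∀ w : S, dist x w < ε0 → x = H z w := by
    intro z hz x hx w hw
    obtain ⟨w', rfl⟩ := (hroots z hz x).1 hx
    rw [hdis w w' _ hw (hH z w' hz).2]
  have hHc : ∀ w, ContinuousOn (fun z => H z w) (closedBall z1 δ) := by
    intro w z2 hz2
    rw [ContinuousWithinAt, Metric.tendsto_nhds]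
    intro ε hε
    have hd := (hH z2 w hz2).2
    have hpos : 0 < min ε (ε0 - dist (H z2 w) w) := lt_min hε (by linarith)
    have h2 := ((PP_cont ha (H z2 w)).mono hδU z2 hz2).norm
    have h3 : ∀ᶠ z in 𝓝[closedBall z1 δ] z2, ‖(PP fun i => a i z).eval (H z2 w)‖ < (min ε (ε0 - dist (H z2 w) w)) ^ m := by
      refine h2.eventually_lt_const ?_
      beta_reduce; rw [(hH z2 w hz2).1, norm_zero]; positivity
    filter_upwards [h3, self_mem_nhdsWithin] with z hz hzm
    obtain ⟨x, hx1, hx2⟩ := root_near hpos.le hz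
    have h4 : dist x w < ε0 := by
      have := dist_triangle x (H z2 w) w
      have := hx2.trans_le (min_le_right _ _)
      linarith
    rw [← huniq z hzm x hx1 w h4]
    exact hx2.trans_le (min_le_left _ _)
  have hz1b : z1 ∈ closedBall z1 δ := mem_closedBall_self hδ.le
  have hHd : ∀ w, DifferentiableAt ℂ (fun z => H z w) z1 := by
    intro w
    have := core_hol hu hue (hHc w) (fun z hz => hub z (hδU (ball_subset_closedBall hz)) _ (hH z w (ball_subset_closedBall hz)).1)
    exact this.differentiableAt (ball_mem_nhds z1 hδ)
  set μ : S → ℕ := fun w => (PP fun i => a i z1).rootMultiplicity (H z1 w) with hμ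
  have hnb : closedBall z1 δ ∈ 𝓝 z1 := closedBall_mem_nhds z1 hδ
  have hev : ∀ᶠ z in 𝓝 z1, ∀ κ : S → Fin (m + 1), (fun w => (κ w : ℕ)) ≠ μ →
      PP (fun i => a i z) ≠ ∏ w, (X - C (H z w)) ^ (κ w : ℕ) := by
    refine eventually_all.2 fun κ => ?_
    by_cases hκ : (fun w => (κ w : ℕ)) = μ
    · simp [hκ]
    have h1 : PP (fun i => a i z1) ≠ ∏ w, (X - C (H z1 w)) ^ (κ w : ℕ) := by
      intro h2
      apply hκ
      funext w
      rw [hμ]; simp only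
      rw [h2, roots_prod_pow (hinj z1 hz1b)]
    obtain ⟨x, hx⟩ : ∃ x, (PP fun i => a i z1).eval x ≠ (∏ w, (X - C (H z1 w)) ^ (κ w : ℕ)).eval x := by
      by_contra hcon
      push Not at hcon
      exact h1 (Polynomial.funext hcon)
    have c1 : ContinuousAt (fun z => (PP fun i => a i z).eval x) z1 := (PP_cont ha x).continuousAt (hU.mem_nhds hz1)
    have c2 : ContinuousAt (fun z => (∏ w, (X - C (H z w)) ^ (κ w : ℕ)).eval x) z1 := by
      simp only [eval_prod, eval_pow, eval_sub, eval_X, eval_C]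
      refine tendsto_finset_prod _ fun w _ => ?_
      exact (continuousAt_const.sub ((hHc w).continuousAt hnb)).pow _
    filter_upwards [(Tendsto.eventually_ne (c1.sub c2) (sub_ne_zero.2 hx))] with z hz _ hcon
    exact hz (sub_eq_zero.2 (congrArg (eval x) hcon))
  have hev2 : ∀ᶠ z in 𝓝 z1, PP (fun i => a i z) = ∏ w, (X - C (H z w)) ^ μ w := by
    filter_upwards [hev, hnb] with z hz hzb
    have hf := PP_factor (hinj z hzb) (hroots z hzb)
    have hle : ∀ w, (PP fun i => a i z).rootMultiplicity (H z w) < m + 1 := fun w => by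
      rw [← count_roots]
      exact Nat.lt_succ_of_le ((Multiset.count_le_card _ _).trans (PP_card _).le)
    by_contra hcon
    have h1 := hz (fun w => ⟨_, hle w⟩) (by
      intro h2
      apply hcon
      rw [← h2]; exact hf)
    exact h1 hf
  have hdc : DC (fun z => ∏ w, (X - C (H z w)) ^ μ w) z1 := DC.prod _ fun w => (DC.lin (hHd w)).pow _
  refine (hdc (m - ((i : ℕ) + 1))).congr_of_eventuallyEq ?_
  filter_upwards [hev2] with z hz
  rw [← hz, PP_coeff]
end Shch

namespace Shch
open Filter Topology

lemma exists_enum (s : Multiset ℂ) {m : ℕ} (h : Multiset.card s = m) : ∃ x : Fin m → ℂ, Finset.univ.val.map x = s := by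
  have hl : s.toList.length = m := by rw [Multiset.length_toList, h]
  subst hl
  exact ⟨s.toList.get, by rw [Fin.univ_val_map, List.ofFn_get, Multiset.coe_toList]⟩

/-- subdiscriminant as a polynomial -/
def sdp (m k : ℕ) : MvPolynomial (Fin m) ℂ :=
  ∑ S ∈ Finset.powersetCard k Finset.univ, ∏ p ∈ S.offDiag, (MvPolynomial.X p.1 - MvPolynomial.X p.2)

lemma sdp_symm (m k : ℕ) : (sdp m k).IsSymmetric := by
  intro e
  rw [sdp, map_sum]
  refine Finset.sum_bij' (fun S _ => S.map e.toEmbedding) (fun S _ => S.map e.symm.toEmbedding) ?_ ?_ ?_ ?_ ?_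
  · intro S hS; simpa [Finset.mem_powersetCard] using hS
  · intro S hS; simpa [Finset.mem_powersetCard] using hS
  · intro S hS; ext; simp
  · intro S hS; ext; simp
  · intro S hS
    rw [map_prod]
    refine Finset.prod_bij (fun p _ => (e p.1, e p.2)) ?_ ?_ ?_ ?_
    · intro p hp; simpa using hp
    · rintro ⟨a, b⟩ _ ⟨c, d⟩ _ h; simpa using h
    · rintro ⟨a, b⟩ h
      refine ⟨(e.symm a, e.symm b), ?_, by simp⟩
      simpa using h
    · intro p hp; simp

lemma exists_sd (m k : ℕ) : ∃ Q : MvPolynomial (Fin m) ℂ, ∀ b : Fin m → ℂ,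
    ((rt b).card = k → MvPolynomial.eval b Q ≠ 0) ∧ ((rt b).card < k → MvPolynomial.eval b Q = 0) := by
  classical
  obtain ⟨Q0, hQ0⟩ := MvPolynomial.esymmAlgHom_surjective (σ := Fin m) (R := ℂ) (n := m) (by simp) ⟨sdp m k, sdp_symm m k⟩
  have hQ1 : MvPolynomial.aeval (fun i : Fin m => MvPolynomial.esymm (Fin m) ℂ (i + 1)) Q0 = sdp m k := by
    have := congrArg Subtype.val hQ0
    rw [MvPolynomial.esymmAlgHom_apply] at this
    exact this
  refine ⟨MvPolynomial.aeval (fun i : Fin m => MvPolynomial.C ((-1) ^ ((i:ℕ) + 1)) * MvPolynomial.X i) Q0, fun b => ?_⟩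
  obtain ⟨x, hx⟩ := exists_enum (PP b).roots (PP_card b)
  have hrt : rt b = Finset.univ.image x := by
    rw [rt, ← hx]; rfl
  have hval : MvPolynomial.eval b (MvPolynomial.aeval (fun i : Fin m => MvPolynomial.C ((-1) ^ ((i:ℕ) + 1)) * MvPolynomial.X i) Q0)
      = ∑ S ∈ Finset.powersetCard k Finset.univ, ∏ p ∈ S.offDiag, (x p.1 - x p.2) := by
    have h1 : MvPolynomial.eval x (sdp m k) = ∑ S ∈ Finset.powersetCard k Finset.univ, ∏ p ∈ S.offDiag, (x p.1 - x p.2) := by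
      simp [sdp]
    rw [← h1, ← hQ1, ← MvPolynomial.coe_aeval_eq_eval, ← MvPolynomial.coe_aeval_eq_eval]
    change (MvPolynomial.aeval b) _ = (MvPolynomial.aeval x) _
    rw [← AlgHom.comp_apply, ← AlgHom.comp_apply, MvPolynomial.comp_aeval, MvPolynomial.comp_aeval]
    congr 2
    funext i
    rw [MvPolynomial.aeval_esymm_eq_multiset_esymm, hx]
    have h2 := coeff_eq_esymm_roots_of_card (p := PP b) (by rw [PP_card, PP_natDegree]) (k := m - ((i : ℕ) + 1)) (by rw [PP_natDegree]; omega)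
    rw [PP_coeff, PP_natDegree, (PP_monic b).leadingCoeff, show m - (m - ((i : ℕ) + 1)) = (i:ℕ) + 1 by omega, one_mul] at h2
    simp only [map_mul, MvPolynomial.aeval_C, MvPolynomial.aeval_X, Algebra.algebraMap_self, RingHom.id_apply]
    rw [h2, ← mul_assoc, ← mul_pow]; simp
  have hnz : ∀ S : Finset (Fin m), (∏ p ∈ S.offDiag, (x p.1 - x p.2)) ≠ 0 → Set.InjOn x S := by
    intro S h i hi j hj hij
    by_contra hne
    exact h (Finset.prod_eq_zero (i := (i, j)) (by simpa using ⟨hi, hj, hne⟩) (by simp [hij]))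
  rw [hval, hrt]
  constructor
  · intro hk
    set V : ℂ := ∏ p ∈ (Finset.univ.image x).offDiag, (p.1 - p.2) with hV
    have hV0 : V ≠ 0 := by
      refine Finset.prod_ne_zero_iff.2 fun p hp => ?_
      rw [Finset.mem_offDiag] at hp
      exact sub_ne_zero.2 hp.2.2
    have hSV : ∀ S ∈ Finset.powersetCard k Finset.univ, (∏ p ∈ S.offDiag, (x p.1 - x p.2)) = if Set.InjOn x S then V else 0 := by
      intro S hS
      split_ifs with hinj
      · have him : S.image x = Finset.univ.image x := by
          apply Finset.eq_of_subset_of_card_le (Finset.image_subset_image (Finset.subset_univ S))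
          rw [Finset.card_image_of_injOn hinj, hk, (Finset.mem_powersetCard.1 hS).2]
        rw [hV, ← him]
        refine Finset.prod_bij (fun p _ => (x p.1, x p.2)) ?_ ?_ ?_ ?_
        · intro p hp
          rw [Finset.mem_offDiag] at hp ⊢
          exact ⟨Finset.mem_image_of_mem x hp.1, Finset.mem_image_of_mem x hp.2.1, fun h => hp.2.2 (hinj hp.1 hp.2.1 h)⟩
        · rintro ⟨a, b⟩ h1 ⟨c, d⟩ h2 h
          rw [Finset.mem_offDiag] at h1 h2
          simp only [Prod.mk.injEq] at h
          exact Prod.ext (hinj h1.1 h2.1 h.1) (hinj h1.2.1 h2.2.1 h.2)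
        · rintro ⟨a, b⟩ h
          rw [Finset.mem_offDiag] at h
          obtain ⟨i, hi, hia⟩ := Finset.mem_image.1 h.1
          obtain ⟨j, hj, hjb⟩ := Finset.mem_image.1 h.2.1
          refine ⟨(i, j), ?_, by simp only [hia, hjb]⟩
          rw [Finset.mem_offDiag]
          refine ⟨hi, hj, fun hij => h.2.2 ?_⟩
          simp only at hij
          rw [← hia, ← hjb, hij]
        · intro p _; rfl
      · by_contra h; exact hinj (hnz S h)
    rw [Finset.sum_congr rfl hSV, ← Finset.sum_filter, Finset.sum_const, nsmul_eq_mul]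
    refine mul_ne_zero ?_ hV0
    rw [Nat.cast_ne_zero, Finset.card_ne_zero]
    obtain ⟨S, hS2⟩ : ∃ S : Finset (Fin m), Set.BijOn x S (Set.image x Set.univ) := by
      obtain ⟨S, _, hS2⟩ := Set.SurjOn.exists_bijOn_subset (Set.surjOn_image x Set.univ)
      exact ⟨S.toFinite.toFinset, by simpa using hS2⟩
    refine ⟨S, Finset.mem_filter.2 ⟨Finset.mem_powersetCard.2 ⟨Finset.subset_univ _, ?_⟩, hS2.injOn⟩⟩
    rw [← hk, ← Finset.card_image_of_injOn hS2.injOn]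
    congr 1
    have := hS2.image_eq
    apply Finset.coe_injective
    simpa using this
  · intro hk
    refine Finset.sum_eq_zero fun S hS => ?_
    by_contra h
    have h1 := Finset.card_image_of_injOn (hnz S h)
    have h2 := Finset.card_le_card (Finset.image_subset_image (f := x) (Finset.subset_univ S))
    rw [h1, (Finset.mem_powersetCard.1 hS).2] at h2
    omega

lemma mv_diff {m : ℕ} (Q : MvPolynomial (Fin m) ℂ) {a : Fin m → ℂ → ℂ} {z : ℂ} (ha : ∀ i, DifferentiableAt ℂ (a i) z) :
    DifferentiableAt ℂ (fun z => MvPolynomial.eval (fun i => a i z) Q) z := by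
  induction Q using MvPolynomial.induction_on with
  | C c => simp
  | add p q hp hq => simp only [map_add]; exact hp.add hq
  | mul_X p i hp => simp only [map_mul, MvPolynomial.eval_X]; exact hp.mul (ha i)

lemma mv_cont {m : ℕ} (Q : MvPolynomial (Fin m) ℂ) {a : Fin m → ℂ → ℂ} {U : Set ℂ} (ha : ∀ i, ContinuousOn (a i) U) :
    ContinuousOn (fun z => MvPolynomial.eval (fun i => a i z) Q) U := by
  induction Q using MvPolynomial.induction_on with
  | C c => simp only [MvPolynomial.eval_C]; exact continuousOn_const
  | add p q hp hq => simp only [map_add]; exact hp.add hq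
  | mul_X p i hp => simp only [map_mul, MvPolynomial.eval_X]; exact hp.mul (ha i)

/-- maximum principle for a function holomorphic off its zeros -/
lemma rado_max {d : ℂ → ℂ} {c : ℂ} {r : ℝ} (hd : ContinuousOn d (closedBall c r))
    (hh : ∀ z ∈ ball c r, d z ≠ 0 → DifferentiableAt ℂ d z) {M : ℝ} (hM : 0 ≤ M)
    (hs : ∀ z ∈ sphere c r, ‖d z‖ ≤ M) {z : ℂ} (hz : z ∈ ball c r) : ‖d z‖ ≤ M := by
  by_cases h0 : d z = 0
  · rw [h0, norm_zero]; exact hM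
  set V : Set ℂ := {z ∈ ball c r | d z ≠ 0} with hV
  have hVb : V ⊆ ball c r := fun x hx => hx.1
  have hcl : closure V ⊆ closedBall c r :=
    closure_minimal (hVb.trans ball_subset_closedBall) isClosed_closedBall
  refine Complex.norm_le_of_forall_mem_frontier_norm_le (isBounded_ball.subset hVb)
    ⟨fun x hx => (hh x hx.1 hx.2).differentiableWithinAt, hd.mono hcl⟩ (fun x hx => ?_) (subset_closure ⟨hz, h0⟩)
  have hxc := hcl hx.1
  by_cases hxb : x ∈ ball c r
  · by_cases hx0 : d x = 0
    · rw [hx0, norm_zero]; exact hM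
    · exfalso
      refine hx.2 (mem_interior_iff_mem_nhds.2 ?_)
      have h1 := ((hd x hxc).continuousAt (closedBall_mem_nhds_of_mem hxb)).eventually_ne hx0
      filter_upwards [h1, isOpen_ball.mem_nhds hxb] with y hy1 hy2
      exact ⟨hy2, hy1⟩
  · refine hs x ?_
    rw [mem_sphere]; rw [mem_closedBall] at hxc; rw [mem_ball] at hxb
    exact le_antisymm hxc (not_lt.1 hxb)
end Shch

namespace Shch
open Filter Topology

lemma rado_dense {d : ℂ → ℂ} {U : Set ℂ} (hU : IsOpen U) (hUc : IsPreconnected U) (hd : ContinuousOn d U)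
    (hh : ∀ z ∈ U, d z ≠ 0 → DifferentiableAt ℂ d z) {z0 : ℂ} (hz0 : z0 ∈ U) (hdz : d z0 ≠ 0) {z : ℂ} (hz : z ∈ U) :
    z ∈ closure {z ∈ U | d z ≠ 0} := by
  by_contra hcon
  set W : Set ℂ := interior {z | z ∈ U ∧ d z = 0} with hW
  have hWs : W ⊆ {z | z ∈ U ∧ d z = 0} := interior_subset
  have hzW : z ∈ W := by
    rw [hW, mem_interior_iff_mem_nhds]
    filter_upwards [hU.mem_nhds hz, isClosed_closure.isOpen_compl.mem_nhds hcon] with y hy1 hy2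
    refine ⟨hy1, ?_⟩
    by_contra h; exact hy2 (subset_closure ⟨hy1, h⟩)
  have hsub : U ⊆ W := by
    refine hUc.subset_of_closure_inter_subset isOpen_interior ⟨z, hz, hzW⟩ ?_
    rintro b ⟨hb1, hb2⟩
    by_contra hbW
    obtain ⟨ρ, hρ, hρU⟩ := Metric.isOpen_iff.1 hU b hb2
    obtain ⟨c, hcb, hc0⟩ : ∃ c ∈ ball b (ρ / 4), d c ≠ 0 := by
      by_contra h
      push Not at h
      refine hbW (mem_interior_iff_mem_nhds.2 ?_)
      filter_upwards [ball_mem_nhds b (show 0 < ρ / 4 by positivity)] with y hy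
      exact ⟨hρU (ball_subset_ball (by linarith) hy), h y hy⟩
    obtain ⟨e, heW, heb⟩ := Metric.mem_closure_iff.1 hb1 (ρ / 4) (by positivity)
    rw [mem_ball] at hcb
    rw [dist_comm] at heb
    set r := dist e c with hr
    have hr0 : 0 < r := dist_pos.2 (by rintro rfl; exact hc0 (hWs heW).2)
    have hrρ : r < ρ / 2 := by
      have := dist_triangle_right e c b; linarith
    have hcU : closedBall c r ⊆ U := by
      refine Subset.trans (fun x hx => ?_) hρU
      rw [mem_ball]; rw [mem_closedBall] at hx
      have := dist_triangle x c b; linarith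
    obtain ⟨T, hT⟩ := (isCompact_sphere (0:ℂ) r).elim_finite_subcover
      (fun s : sphere (0:ℂ) 1 => {t : ℂ | c + s * t ∈ W})
      (fun s => isOpen_interior.preimage (by fun_prop)) (by
        intro t ht
        have ht' : ‖t‖ = r := by simpa using ht
        have ht0 : t ≠ 0 := by rintro rfl; simp at ht'; linarith
        refine mem_iUnion.2 ⟨⟨(e - c) / t, ?_⟩, ?_⟩
        · rw [mem_sphere_zero_iff_norm, norm_div, ht', ← dist_eq_norm, ← hr, div_self hr0.ne']
        · simp only [Set.mem_ofPred_eq]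
          rw [div_mul_cancel₀ _ ht0, add_sub_cancel]; exact heW)
    have hmap : ∀ s : sphere (0:ℂ) 1, ∀ x ρ', x ∈ ball c ρ' → c + s * (x - c) ∈ ball c ρ' := by
      intro s x ρ' hx
      have hs : ‖(s:ℂ)‖ = 1 := by simpa using s.2
      rw [mem_ball, dist_eq_norm] at hx ⊢
      rwa [add_sub_cancel_left, norm_mul, hs, one_mul]
    have hmap' : ∀ s : sphere (0:ℂ) 1, ∀ x ρ', x ∈ closedBall c ρ' → c + s * (x - c) ∈ closedBall c ρ' := by
      intro s x ρ' hx
      have hs : ‖(s:ℂ)‖ = 1 := by simpa using s.2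
      rw [mem_closedBall, dist_eq_norm] at hx ⊢
      rwa [add_sub_cancel_left, norm_mul, hs, one_mul]
    have hfin := rado_max (d := fun z => ∏ s ∈ T, d (c + s * (z - c))) (c := c) (r := r) (by
        refine continuousOn_finset_prod _ fun s _ => ?_
        exact hd.comp (by fun_prop) fun x hx => hcU (hmap' s x r hx)) (by
        intro x hx hx0
        refine DifferentiableAt.fun_finset_prod fun s hs => ?_
        have h1 := Finset.prod_ne_zero_iff.1 hx0 s hs
        have h2 := hh _ (hcU (ball_subset_closedBall (hmap s x r hx))) h1
        exact DifferentiableAt.comp x (g := d) (f := fun z => c + s * (z - c)) h2 (by fun_prop)) (M := 0) le_rfl (by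
        intro x hx
        have h1 : x - c ∈ sphere (0:ℂ) r := by rw [mem_sphere_zero_iff_norm, ← dist_eq_norm]; exact hx
        obtain ⟨s, hs, hs2⟩ := mem_iUnion₂.1 (hT h1)
        rw [Finset.prod_eq_zero hs (hWs hs2).2, norm_zero]) (z := c) (mem_ball_self hr0)
    have h3 : (∏ s ∈ T, d (c + s * (c - c))) = 0 := norm_le_zero_iff.1 hfin
    rw [Finset.prod_eq_zero_iff] at h3
    obtain ⟨s, _, hs⟩ := h3
    rw [sub_self, mul_zero, add_zero] at hs
    exact hc0 hs
  exact hdz (hWs (hsub hz0)).2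

lemma cre (N : ℕ) (w : ℂ) : ((N:ℂ) * w).re = N * w.re := by simp [Complex.mul_re]

lemma rado_HP {d a : ℂ → ℂ} {c : ℂ} {r : ℝ} (hr : 0 < r) (hd : ContinuousOn d (closedBall c r)) (ha : ContinuousOn a (closedBall c r))
    (hh : ∀ z ∈ ball c r, d z ≠ 0 → DifferentiableAt ℂ d z ∧ DifferentiableAt ℂ a z) (hc : d c ≠ 0) : HP a c r := by
  intro q p _ hs
  by_contra hneg
  push Not at hneg
  obtain ⟨M, hM⟩ := (isCompact_closedBall c r).exists_bound_of_continuousOn hd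
  have hM0 : 0 ≤ M := (norm_nonneg _).trans (hM c (mem_closedBall_self hr.le))
  set γ := (q.eval c * a c + p.eval c).re with hγ
  have key : ∀ N : ℕ, ‖d c‖ * Real.exp (-(N * γ)) ≤ M := by
    intro N
    have hG : ContinuousOn (fun z => -(N * (q.eval z * a z + p.eval z))) (closedBall c r) :=
      (continuousOn_const.mul ((q.continuous.continuousOn.mul ha).add p.continuous.continuousOn)).neg
    have h1 := rado_max (d := fun z => d z * Complex.exp (-(N * (q.eval z * a z + p.eval z)))) (c := c) (r := r)
      (hd.mul (Complex.continuous_exp.comp_continuousOn hG)) (by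
        intro z hz hz0
        obtain ⟨h2, h3⟩ := hh z hz (left_ne_zero_of_mul hz0)
        have h4 : DifferentiableAt ℂ (fun z => -((N:ℂ) * (q.eval z * a z + p.eval z))) z :=
          (((q.differentiable z).mul h3).add (p.differentiable z)).const_mul _ |>.neg
        exact h2.mul h4.cexp) hM0 (by
        intro z hz
        rw [norm_mul, Complex.norm_exp]
        have h2 := hs z hz
        have h3 : (-((N:ℂ) * (q.eval z * a z + p.eval z))).re ≤ 0 := by
          rw [Complex.neg_re, cre, neg_nonpos]; positivity
        have h4 : Real.exp (-((N:ℂ) * (q.eval z * a z + p.eval z))).re ≤ 1 := Real.exp_le_one_iff.2 h3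
        calc _ ≤ M * 1 := mul_le_mul (hM z (sphere_subset_closedBall hz)) h4 (by positivity) hM0
          _ = M := mul_one M) (mem_ball_self hr)
    rw [norm_mul, Complex.norm_exp, Complex.neg_re, cre] at h1
    exact h1
  have hdp : 0 < ‖d c‖ := norm_pos_iff.2 hc
  obtain ⟨N, hN⟩ := exists_nat_gt (M / ‖d c‖ / (-γ))
  have h1 := key N
  rw [div_lt_iff₀ (by linarith), div_lt_iff₀ hdp] at hN
  have h2 := Real.add_one_le_exp (-(N * γ))
  have h3 : ‖d c‖ * (-(N * γ) + 1) ≤ M := (mul_le_mul_of_nonneg_left h2 hdp.le).trans h1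
  nlinarith

lemma circ_cont {g : ℂ → ℂ} (hg : Continuous g) (r : ℝ) : Continuous fun c => (∮ z in C(c, r), g z) := by
  simp only [circleIntegral, deriv_circleMap]
  apply intervalIntegral.continuous_parametric_intervalIntegral_of_continuous'
  simp only [Function.uncurry_def, smul_eq_mul, circleMap]
  fun_prop

lemma oned {u : ℂ × ℂ → EReal} (hu : PSH u) {e : ℂ × ℂ} (hue : u e ≠ ⊥) {m : ℕ} {a : Fin m → ℂ → ℂ} {c0 : ℂ} {R : ℝ}
    (ha : ∀ i, ContinuousOn (a i) (ball c0 R))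
    (hub : ∀ z ∈ ball c0 R, ∀ w, (PP fun i => a i z).eval w = 0 → u (z, w) = ⊥) (i : Fin m) :
    DifferentiableOn ℂ (a i) (ball c0 R) := by
  classical
  set U := ball c0 R with hUdef
  have hU : IsOpen U := isOpen_ball
  rcases U.eq_empty_or_nonempty with hemp | hne
  · rw [hemp]; exact differentiableOn_empty
  obtain ⟨k, hk1, z1, hz1, hz1k⟩ : ∃ k, (∀ z ∈ U, (rt fun i => a i z).card ≤ k) ∧ ∃ z ∈ U, (rt fun i => a i z).card = k := by
    have hex : ∃ k, ∀ z ∈ U, (rt fun i => a i z).card ≤ k := ⟨m, fun z _ => rt_card_le _⟩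
    refine ⟨Nat.find hex, Nat.find_spec hex, ?_⟩
    by_contra hcon
    push Not at hcon
    have h1 : ∀ z ∈ U, (rt fun i => a i z).card < Nat.find hex := fun z hz =>
      lt_of_le_of_ne (Nat.find_spec hex z hz) (hcon z hz)
    obtain ⟨z, hz⟩ := hne
    have h2 := h1 z hz
    have h3 := Nat.find_min hex (m := Nat.find hex - 1) (by omega)
    exact h3 fun z hz => by have := h1 z hz; omega
  obtain ⟨Q, hQ⟩ := exists_sd m k
  set d : ℂ → ℂ := fun z => MvPolynomial.eval (fun i => a i z) Q with hd
  have hdc : ContinuousOn d U := mv_cont Q ha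
  have hloc : ∀ z ∈ U, d z ≠ 0 → ∀ i, DifferentiableAt ℂ (a i) z := by
    intro z hz hdz i
    have hzk : (rt fun i => a i z).card = k := by
      by_contra h
      exact hdz ((hQ _).2 (lt_of_le_of_ne (hk1 z hz) h))
    exact loc_hol hu hue hU ha hub hz (fun z' hz' => by rw [hzk]; exact hk1 z' hz') i
  have hdd : ∀ z ∈ U, d z ≠ 0 → DifferentiableAt ℂ d z := fun z hz hdz => mv_diff Q (hloc z hz hdz)
  have hdense : ∀ z ∈ U, z ∈ closure {z ∈ U | d z ≠ 0} := fun z hz =>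
    rado_dense hU (convex_ball c0 R).isPreconnected hdc hdd hz1 ((hQ _).1 hz1k) hz
  suffices hs : ∀ R' < R, DifferentiableOn ℂ (a i) (ball c0 R') by
    intro z hz
    obtain ⟨R', h1, h2⟩ := exists_between (mem_ball.1 hz)
    exact ((hs R' h2).differentiableAt (isOpen_ball.mem_nhds h1)).differentiableWithinAt
  intro R' hR'
  have hRU : closedBall c0 R' ⊆ U := closedBall_subset_ball hR'
  obtain ⟨g, hg, hgf⟩ := exists_ext isClosed_closedBall ((ha i).mono hRU)
  refine DifferentiableOn.congr (f := g) ?_ fun z hz => (hgf z (ball_subset_closedBall hz)).symm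
  refine hol_of_circ_cont hg fun c r hr hcr => ?_
  have hcU : c ∈ U := hRU (ball_subset_closedBall (hcr (mem_closedBall_self hr.le)))
  obtain ⟨δ, hδ, hth⟩ := (isCompact_closedBall c r).exists_thickening_subset_open isOpen_ball hcr
  have hfr := mem_closure_iff_frequently.1 (hdense c hcU)
  have hcl : IsClosed {c | (∮ z in C(c, r), g z) = 0} := isClosed_eq (circ_cont hg r) continuous_const
  have hfr2 : ∃ᶠ c' in 𝓝 c, c' ∈ {c | (∮ z in C(c, r), g z) = 0} := by
    refine (hfr.and_eventually (ball_mem_nhds c hδ)).mono ?_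
    rintro c' ⟨⟨hc'U, hc'd⟩, hc'c⟩
    have hsub : closedBall c' r ⊆ ball c0 R' := by
      refine Subset.trans (fun x hx => ?_) hth
      rw [mem_thickening_iff]
      refine ⟨x - c' + c, ?_, ?_⟩
      · rw [mem_closedBall, dist_eq_norm] at hx ⊢; simpa using hx
      · rw [dist_eq_norm, show x - (x - c' + c) = c' - c by ring, ← dist_eq_norm]; exact hc'c
    have hsub2 : closedBall c' r ⊆ U := hsub.trans (ball_subset_closedBall.trans hRU)
    refine circ_zero hr hg.continuousOn ?_
    refine rado_HP hr (hdc.mono hsub2) hg.continuousOn (fun z hz hdz => ?_) hc'd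
    have hzU := hsub2 (ball_subset_closedBall hz)
    refine ⟨hdd z hzU hdz, (hloc z hzU hdz i).congr_of_eventuallyEq ?_⟩
    filter_upwards [isOpen_ball.mem_nhds (hsub (ball_subset_closedBall hz))] with y hy
    exact hgf y (ball_subset_closedBall hy)
  exact hcl.mem_of_frequently_of_tendsto hfr2 tendsto_id
end Shch

namespace Shch
open Filter Topology

lemma gat1 {g : ℂ → ℂ} {R M : ℝ} (hg : DifferentiableOn ℂ g (ball 0 R)) (hM : ∀ t ∈ ball (0:ℂ) R, ‖g t‖ ≤ M)
    {t : ℂ} (ht : t ∈ ball (0:ℂ) R) : ‖g t - g 0‖ ≤ 2 * M / R * ‖t‖ := by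
  have hR : 0 < R := nonempty_ball.mp ⟨_, ht⟩
  have h := Complex.dist_le_div_mul_dist_of_mapsTo_ball (R₂ := 2 * M) hg (by
    intro s hs
    rw [mem_closedBall, dist_eq_norm]
    have h1 := hM s hs
    have h2 := hM 0 (mem_ball_self hR)
    have h3 := norm_sub_le (g s) (g 0)
    linarith) ht
  rwa [dist_eq_norm, dist_zero_right] at h

lemma gat0 {g : ℂ → ℂ} {R M : ℝ} (hR : 0 < R) (hg : DifferentiableOn ℂ g (ball 0 R)) (hM : ∀ t ∈ ball (0:ℂ) R, ‖g t‖ ≤ M) :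
    ‖deriv g 0‖ ≤ 2 * M / R := by
  refine Complex.norm_deriv_le_div_of_mapsTo_ball (R₂ := 2 * M) hg (by
    intro s hs
    rw [mem_closedBall, dist_eq_norm]
    have h1 := hM s hs
    have h2 := hM 0 (mem_ball_self hR)
    have h3 := norm_sub_le (g s) (g 0)
    linarith) hR

lemma gat2 {g : ℂ → ℂ} {R M : ℝ} (hg : DifferentiableOn ℂ g (ball 0 R)) (hM : ∀ t ∈ ball (0:ℂ) R, ‖g t‖ ≤ M)
    {t : ℂ} (ht : t ∈ ball (0:ℂ) R) : ‖g t - g 0 - t * deriv g 0‖ ≤ 4 * M * (‖t‖ / R) ^ 2 := by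
  have hR : 0 < R := nonempty_ball.mp ⟨_, ht⟩
  have hM0 : 0 ≤ M := (norm_nonneg _).trans (hM 0 (mem_ball_self hR))
  have hd := gat0 hR hg hM
  have h := Complex.dist_le_mul_div_pow_of_mapsTo_ball_of_isLittleO (f := fun t => g t - t * deriv g 0)
    (c := 0) (R₁ := R) (R₂ := 4 * M) (n := 1)
    (hg.sub (differentiableOn_id.mul_const _)) (by
    intro s hs
    rw [mem_closedBall, dist_eq_norm]
    have h1 := hM s hs
    have h2 := hM 0 (mem_ball_self hR)
    have h3 : ‖s * deriv g 0‖ ≤ 2 * M := by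
      rw [norm_mul]
      have : ‖s‖ ≤ R := (mem_ball_zero_iff.1 hs).le
      calc _ ≤ R * (2 * M / R) := mul_le_mul this hd (norm_nonneg _) hR.le
        _ = 2 * M := by field_simp
    have h4 := norm_sub_le (g s - s * deriv g 0) (g 0 - 0 * deriv g 0)
    have h5 := norm_sub_le (g s) (s * deriv g 0)
    simp only [zero_mul, sub_zero] at h4 ⊢
    linarith) (by
    have h6 := (hg.differentiableAt (isOpen_ball.mem_nhds (mem_ball_self hR))).hasDerivAt
    have h7 := hasDerivAt_iff_isLittleO.1 h6
    simp only [sub_zero, zero_mul, pow_one, smul_eq_mul] at h7 ⊢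
    refine (h7.norm_right).congr_left fun s => by ring) ht
  rw [dist_eq_norm, dist_zero_right] at h
  simp only [zero_mul, sub_zero] at h
  rwa [show g t - g 0 - t * deriv g 0 = g t - t * deriv g 0 - g 0 by ring]

section gat
variable {E : Type*} [NormedAddCommGroup E] [NormedSpace ℂ E] [FiniteDimensional ℂ E]

lemma gat_diff {f : E → ℂ} {z0 : E} {R M : ℝ} (hR : 0 < R) (hM : ∀ z ∈ ball z0 R, ‖f z‖ ≤ M)
    (hG : ∀ z ∈ ball z0 R, ∀ b : E, DifferentiableAt ℂ (fun t : ℂ => f (z + t • b)) 0) :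
    DifferentiableAt ℂ f z0 := by
  have hM0 : 0 ≤ M := (norm_nonneg _).trans (hM z0 (mem_ball_self hR))
  have hball : ∀ {S : ℝ}, 0 < S → ∀ {z b : E}, z ∈ ball z0 (R/2) → ‖b‖ ≤ S → ∀ {t : ℂ}, t ∈ ball (0:ℂ) (R/(2*S)) →
      z + t • b ∈ ball z0 R := by
    intro S hS z b hz hb t ht
    rw [mem_ball, dist_eq_norm] at hz ⊢
    rw [mem_ball_zero_iff, lt_div_iff₀ (by positivity)] at ht
    have h1 : ‖t • b‖ ≤ ‖t‖ * S := by rw [norm_smul]; gcongr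
    have h2 : z + t • b - z0 = (z - z0) + t • b := by abel
    rw [h2]
    have := norm_add_le (z - z0) (t • b)
    linarith
  have hball2 : ∀ {S : ℝ}, 0 < S → ∀ {b : E}, ‖b‖ ≤ S → ∀ {t : ℂ}, t ∈ ball (0:ℂ) (R/(2*S)) →
      z0 + t • b ∈ ball z0 (R/2) := by
    intro S hS b hb t ht
    rw [mem_ball, dist_eq_norm]
    rw [mem_ball_zero_iff, lt_div_iff₀ (by positivity)] at ht
    have h1 : ‖t • b‖ ≤ ‖t‖ * S := by rw [norm_smul]; gcongr
    rw [add_sub_cancel_left]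
    linarith
  have hdiff : ∀ {S : ℝ}, 0 < S → ∀ {z b : E}, z ∈ ball z0 (R/2) → ‖b‖ ≤ S →
      DifferentiableOn ℂ (fun t : ℂ => f (z + t • b)) (ball 0 (R/(2*S))) := by
    intro S hS z b hz hb t ht
    have h1 := hG _ (hball hS hz hb ht) b
    have h2 : DifferentiableAt ℂ (fun s : ℂ => s - t) t := by fun_prop
    have h3 : DifferentiableAt ℂ ((fun s : ℂ => f (z + t • b + s • b)) ∘ fun s : ℂ => s - t) t :=
      DifferentiableAt.comp t (by simpa using h1) h2
    refine DifferentiableAt.differentiableWithinAt (h3.congr_of_eventuallyEq (Eventually.of_forall fun s => ?_))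
    simp only [Function.comp]
    congr 1
    module
  set L : E → E → ℂ := fun z b => deriv (fun t : ℂ => f (z + t • b)) 0 with hL
  have quad : ∀ {S : ℝ}, 0 < S → ∀ {z b : E}, z ∈ ball z0 (R/2) → ‖b‖ ≤ S → ∀ {t : ℂ}, t ∈ ball (0:ℂ) (R/(2*S)) →
      ‖f (z + t • b) - f z - t * L z b‖ ≤ 4 * M * (‖t‖ / (R/(2*S))) ^ 2 := by
    intro S hS z b hz hb t ht
    have := gat2 (hdiff hS hz hb) (fun t ht => hM _ (hball hS hz hb ht)) ht
    simpa using this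
  have hz0 : z0 ∈ ball z0 (R/2) := mem_ball_self (by positivity)
  have hdz : ∀ b, DifferentiableAt ℂ (fun t : ℂ => f (z0 + t • b)) 0 := fun b => hG z0 (mem_ball_self hR) b
  have hsmul : ∀ (c : ℂ) b, L z0 (c • b) = c * L z0 b := by
    intro c b
    have h1 : HasDerivAt (fun t : ℂ => f (z0 + t • b)) (L z0 b) ((fun t : ℂ => t * c) 0) := by
      change HasDerivAt _ _ (0 * c)
      rw [zero_mul]; exact (hdz b).hasDerivAt
    have h2 : HasDerivAt (fun t : ℂ => t * c) c 0 := by simpa using (hasDerivAt_id (0:ℂ)).mul_const c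
    have h3 := HasDerivAt.comp (h₂ := fun t : ℂ => f (z0 + t • b)) (0:ℂ) h1 h2
    have h4 : (fun t : ℂ => f (z0 + t • (c • b))) = (fun t : ℂ => f (z0 + t • b)) ∘ fun t : ℂ => t * c := by
      funext t; simp [mul_smul]
    simp only [hL]
    rw [h4, h3.deriv]; exact mul_comm _ _
  have hadd : ∀ b1 b2, L z0 (b1 + b2) = L z0 b1 + L z0 b2 := by
    intro b1 b2
    set S := 1 + ‖b1‖ + ‖b2‖ with hS'
    have hS : 0 < S := by positivity
    have hb1 : ‖b1‖ ≤ S := by linarith [norm_nonneg b2]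
    have hb2 : ‖b2‖ ≤ S := by linarith [norm_nonneg b1]
    have hb12 : ‖b1 + b2‖ ≤ S := by linarith [norm_add_le b1 b2]
    set ρ := R/(2*S) with hρ'
    have hρ : 0 < ρ := by positivity
    have key : ∀ t : ℂ, t ∈ ball (0:ℂ) ρ → ‖t‖ * ‖L z0 (b1 + b2) - (L z0 b1 + L z0 b2)‖ ≤ 16 * M / ρ ^ 2 * ‖t‖ * ‖t‖ := by
      intro t ht
      have e1 := quad hS hz0 hb12 ht
      have e2 := quad hS hz0 hb1 ht
      have hz1 := hball2 hS hb1 ht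
      have e3 := quad hS hz1 hb2 ht
      have e4 : ‖L (z0 + t • b1) b2 - L z0 b2‖ ≤ 2 * (2 * M / ρ * ‖t‖) / ρ := by
        have hh : DifferentiableOn ℂ (fun s : ℂ => f (z0 + t • b1 + s • b2) - f (z0 + s • b2)) (ball 0 ρ) :=
          (hdiff hS hz1 hb2).sub (hdiff hS hz0 hb2)
        have := gat0 hρ hh (M := 2 * M / ρ * ‖t‖) (by
          intro s hs
          have hz2 := hball2 hS hb2 hs
          have := gat1 (hdiff hS hz2 hb1) (fun t ht => hM _ (hball hS hz2 hb1 ht)) ht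
          simp only [zero_smul, add_zero] at this
          rwa [show z0 + t • b1 + s • b2 = z0 + s • b2 + t • b1 by abel])
        have hd1 : DifferentiableAt ℂ (fun s : ℂ => f (z0 + t • b1 + s • b2)) 0 :=
          (hdiff hS hz1 hb2).differentiableAt (ball_mem_nhds _ hρ)
        have h5 : deriv (fun s : ℂ => f (z0 + t • b1 + s • b2) - f (z0 + s • b2)) 0 = L (z0 + t • b1) b2 - L z0 b2 :=
          (hd1.hasDerivAt.sub (hdz b2).hasDerivAt).deriv
        rwa [h5] at this
      have h6 : z0 + t • (b1 + b2) = z0 + t • b1 + t • b2 := by rw [smul_add, add_assoc]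
      rw [h6] at e1
      have e5 : ‖t * (L (z0 + t • b1) b2 - L z0 b2)‖ ≤ ‖t‖ * (2 * (2 * M / ρ * ‖t‖) / ρ) := by
        rw [norm_mul]; gcongr
      rw [← norm_mul]
      have h7 : t * (L z0 (b1 + b2) - (L z0 b1 + L z0 b2)) =
        -(f (z0 + t • b1 + t • b2) - f z0 - t * L z0 (b1 + b2)) + (f (z0 + t • b1) - f z0 - t * L z0 b1)
        + (f (z0 + t • b1 + t • b2) - f (z0 + t • b1) - t * L (z0 + t • b1) b2) + t * (L (z0 + t • b1) b2 - L z0 b2) := by ring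
      rw [h7]
      rw [← hρ'] at e1 e2 e3
      rw [← norm_neg] at e1
      refine (norm_add_le _ _).trans ((add_le_add ((norm_add_le _ _).trans (add_le_add ((norm_add_le _ _).trans
        (add_le_add e1 e2)) e3)) e5).trans (le_of_eq ?_))
      rw [div_pow]
      ring
    by_contra hne
    have hpos : 0 < ‖L z0 (b1 + b2) - (L z0 b1 + L z0 b2)‖ := norm_pos_iff.2 (sub_ne_zero.2 hne)
    have hK : 0 ≤ 16 * M / ρ ^ 2 := by positivity
    have key2 : ∀ x : ℝ, 0 < x → x < ρ → ‖L z0 (b1 + b2) - (L z0 b1 + L z0 b2)‖ ≤ 16 * M / ρ ^ 2 * x := by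
      intro x hx hxρ
      have h8 : ‖(x:ℂ)‖ = x := by simp [abs_of_pos hx]
      have h9 := key (x:ℂ) (by rw [mem_ball_zero_iff, h8]; exact hxρ)
      rw [h8] at h9
      refine le_of_mul_le_mul_left (a := x) (h9.trans (le_of_eq (by ring))) hx
    have h10 : ‖L z0 (b1 + b2) - (L z0 b1 + L z0 b2)‖ ≤ 0 := by
      have ht : Tendsto (fun x : ℝ => 16 * M / ρ ^ 2 * x) (𝓝[>] 0) (𝓝 0) := by
        have : Tendsto (fun x : ℝ => 16 * M / ρ ^ 2 * x) (𝓝 0) (𝓝 (16 * M / ρ ^ 2 * 0)) :=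
          (continuous_const.mul continuous_id).tendsto 0
        rw [mul_zero] at this
        exact this.mono_left nhdsWithin_le_nhds
      refine ge_of_tendsto ht ?_
      filter_upwards [Ioo_mem_nhdsGT hρ] with x hx using key2 x hx.1 hx.2
    linarith
  let Ll : E →ₗ[ℂ] ℂ := { toFun := L z0, map_add' := hadd, map_smul' := hsmul }
  let Lc : E →L[ℂ] ℂ := LinearMap.toContinuousLinearMap Ll
  have hLc : ∀ b, Lc b = L z0 b := fun b => rfl
  refine HasFDerivAt.differentiableAt (f' := Lc) ?_
  rw [hasFDerivAt_iff_isLittleO_nhds_zero]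
  have hO : (fun h : E => f (z0 + h) - f z0 - Lc h) =O[𝓝 0] fun h : E => ‖h‖ ^ 2 := by
    refine Asymptotics.IsBigO.of_bound (4 * M * (4 / R) ^ 2) ?_
    filter_upwards [ball_mem_nhds (0:E) (show 0 < R/2 by positivity)] with h hh
    rw [mem_ball_zero_iff] at hh
    rcases eq_or_ne h 0 with rfl | h0
    · simp
    have hp : 0 < ‖h‖ := norm_pos_iff.2 h0
    have := quad hp hz0 (le_refl ‖h‖) (t := 1) (by
      rw [mem_ball_zero_iff, norm_one, lt_div_iff₀ (by positivity)]; linarith)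
    rw [one_smul, one_mul, norm_one] at this
    rw [hLc]
    refine this.trans ?_
    rw [norm_pow, norm_norm, mul_assoc (4 * M), ← mul_pow]
    have h11 : 1 / (R / (2 * ‖h‖)) ≤ 4 / R * ‖h‖ := by
      rw [one_div_div, div_le_iff₀ hR]
      have : 4 / R * ‖h‖ * R = 4 * ‖h‖ := by field_simp
      rw [this]; linarith
    gcongr
  refine hO.trans_isLittleO ?_
  have : (fun h : E => ‖h‖ ^ 2) =o[𝓝 0] fun h : E => ‖h‖ ^ 1 :=
    (Asymptotics.isLittleO_pow_pow (m := 1) (n := 2) (by norm_num)).comp_tendsto tendsto_norm_zero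
  simp only [pow_one] at this
  exact this.of_norm_right

end gat

end Shch

namespace Shch
open Filter Topology

lemma snoc_cont {n : ℕ} : Continuous fun p : (Fin n → ℂ) × ℂ => (Fin.snoc p.1 p.2 : Fin (n+1) → ℂ) := by
  refine continuous_pi fun i => ?_
  refine Fin.lastCases ?_ (fun j => ?_) i
  · simpa using continuous_snd
  · simp only [Fin.snoc_castSucc]; fun_prop

lemma forward {n m : ℕ} (D : Set (Fin n → ℂ)) (hD : IsOpen D)
    (a : Fin m → (Fin n → ℂ) → ℂ) (ha : ∀ i, ContinuousOn (a i) D)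
    {u : (Fin (n+1) → ℂ) → EReal} (hu : PSH u) {e : Fin (n+1) → ℂ} (hue : u e ≠ ⊥)
    (hub : ∀ z ∈ D, ∀ w, (PP fun i => a i z).eval w = 0 → u (Fin.snoc z w) = ⊥) (i : Fin m) :
    DifferentiableOn ℂ (a i) D := by
  set S : Set (Fin n → ℂ) := {z | ∃ w, u (Fin.snoc z w) ≠ ⊥} with hS
  have hdense : Dense S := by
    rw [dense_iff_inter_open]
    intro U hU hne
    have hU' : IsOpen {p : Fin (n+1) → ℂ | (fun j : Fin n => p j.castSucc) ∈ U} :=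
      hU.preimage (continuous_pi fun j => continuous_apply _)
    obtain ⟨z1, hz1⟩ := hne
    obtain ⟨x, hx, hx2⟩ := psh_dense hu hue hU' ⟨Fin.snoc z1 0, by
      rw [Set.mem_ofPred_eq]; simpa using hz1⟩
    refine ⟨fun j : Fin n => x j.castSucc, hx, x (Fin.last n), ?_⟩
    have : (Fin.snoc (fun j : Fin n => x j.castSucc) (x (Fin.last n)) : Fin (n+1) → ℂ) = x := by
      funext k
      refine Fin.lastCases ?_ (fun j => ?_) k <;> simp
    rwa [this]
  have hG : ∀ z ∈ D, ∀ b : Fin n → ℂ, DifferentiableAt ℂ (fun t : ℂ => a i (z + t • b)) 0 := by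
    intro z hz b
    obtain ⟨ε, hε, hεD⟩ := Metric.isOpen_iff.1 hD z hz
    set r := ε / (2 * (‖b‖ + 1)) with hr'
    have hr : 0 < r := by positivity
    have hin : ∀ z' ∈ ball z (ε/2), ∀ t ∈ ball (0:ℂ) r, z' + t • b ∈ D := by
      intro z' hz' t ht
      apply hεD
      rw [mem_ball, dist_eq_norm] at hz' ⊢
      rw [mem_ball_zero_iff, lt_div_iff₀ (by positivity)] at ht
      have h1 : ‖t • b‖ ≤ ‖t‖ * (‖b‖ + 1) := by rw [norm_smul]; gcongr; linarith
      have h2 : z' + t • b - z = (z' - z) + t • b := by abel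
      rw [h2]
      have := norm_add_le (z' - z) (t • b)
      linarith
    have hlu : TendstoLocallyUniformlyOn (fun (z' : Fin n → ℂ) (t : ℂ) => a i (z' + t • b))
        (fun t : ℂ => a i (z + t • b)) (𝓝[S] z) (ball 0 r) := by
      rw [tendstoLocallyUniformlyOn_iff_forall_tendsto]
      intro x hx
      have hc : ContinuousAt (a i) (z + x • b) :=
        (ha i).continuousAt (hD.mem_nhds (hin z (mem_ball_self (by positivity)) x hx))
      have t1 : Tendsto (fun y : (Fin n → ℂ) × ℂ => z + y.2 • b) (𝓝[S] z ×ˢ 𝓝[ball 0 r] x) (𝓝 (z + x • b)) := by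
        have : Tendsto (fun y : (Fin n → ℂ) × ℂ => z + y.2 • b) (𝓝 (z, x)) (𝓝 (z + x • b)) :=
          Continuous.tendsto (f := fun y : (Fin n → ℂ) × ℂ => z + y.2 • b) (by fun_prop) (z, x)
        rw [nhds_prod_eq] at this
        exact this.mono_left (Filter.prod_mono nhdsWithin_le_nhds nhdsWithin_le_nhds)
      have t2 : Tendsto (fun y : (Fin n → ℂ) × ℂ => y.1 + y.2 • b) (𝓝[S] z ×ˢ 𝓝[ball 0 r] x) (𝓝 (z + x • b)) := by
        have : Tendsto (fun y : (Fin n → ℂ) × ℂ => y.1 + y.2 • b) (𝓝 (z, x)) (𝓝 (z + x • b)) :=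
          Continuous.tendsto (f := fun y : (Fin n → ℂ) × ℂ => y.1 + y.2 • b) (by fun_prop) (z, x)
        rw [nhds_prod_eq] at this
        exact this.mono_left (Filter.prod_mono nhdsWithin_le_nhds nhdsWithin_le_nhds)
      have t3 := (hc.tendsto.comp t1).prodMk_nhds (hc.tendsto.comp t2)
      exact t3.mono_right (nhds_le_uniformity _)
    have hne : (𝓝[S] z).NeBot := mem_closure_iff_nhdsWithin_neBot.1 (hdense z)
    have hdf : DifferentiableOn ℂ (fun t : ℂ => a i (z + t • b)) (ball 0 r) := by
      refine hlu.differentiableOn ?_ isOpen_ball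
      filter_upwards [self_mem_nhdsWithin, mem_nhdsWithin_of_mem_nhds (ball_mem_nhds z (show 0 < ε/2 by positivity))] with z' h1 h2
      obtain ⟨w, hw⟩ := h1
      set φ : ℂ × ℂ → (Fin (n+1) → ℂ) := fun x => Fin.snoc (z' + x.1 • b) x.2 with hφ
      have hφc : Continuous φ :=
        snoc_cont.comp (f := fun x : ℂ × ℂ => (z' + x.1 • b, x.2)) (by fun_prop)
      have hpsh : PSH (u ∘ φ) := hu.comp_affine φ hφc (by
        intro x y
        refine ⟨Fin.snoc (y.1 • b) y.2, fun t => ?_⟩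
        funext k
        refine Fin.lastCases ?_ (fun j => ?_) k
        · simp [hφ]
        · simp [hφ]; ring)
      refine oned hpsh (e := (0, w)) (a := fun j t => a j (z' + t • b)) (by simpa [hφ] using hw) (fun j => ?_) ?_ i
      · refine (ha j).comp (t := D) ?_ fun t ht => hin z' h2 t ht
        exact Continuous.continuousOn (by fun_prop)
      · intro t ht w hw'
        exact hub _ (hin z' h2 t ht) w hw'
    exact hdf.differentiableAt (ball_mem_nhds _ hr)
  intro z hz
  obtain ⟨ε, hε, hεD⟩ := Metric.isOpen_iff.1 hD z hz
  have hc : ContinuousAt (a i) z := (ha i).continuousAt (hD.mem_nhds hz)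
  obtain ⟨δ, hδ, hδ2⟩ := Metric.continuousAt_iff.1 hc 1 one_pos
  refine (gat_diff (R := min ε δ) (M := ‖a i z‖ + 1) (lt_min hε hδ) (fun y hy => ?_) (fun y hy b =>
    hG y (hεD (ball_subset_ball (min_le_left _ _) hy)) b)).differentiableWithinAt
  have := hδ2 (ball_subset_ball (min_le_right _ _) hy)
  rw [dist_eq_norm] at this
  have h2 := norm_sub_norm_le (a i y) (a i z)
  linarith

end Shch

namespace Shch
open Filter Topology

/-- extended logarithm of a real number -/
def lg (x : ℝ) : EReal := ENNReal.log (ENNReal.ofReal x)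

lemma lg_exp (y : ℝ) : lg (Real.exp y) = (y : EReal) := by
  unfold lg
  rw [ENNReal.log_ofReal_of_pos (Real.exp_pos y), Real.log_exp]

lemma lg_mono {x y : ℝ} (h : x ≤ y) : lg x ≤ lg y := ENNReal.log_le_log (ENNReal.ofReal_le_ofReal h)

lemma lg_le {x y : ℝ} : lg x ≤ (y : EReal) ↔ x ≤ Real.exp y := by
  rw [← lg_exp y]
  unfold lg
  rw [ENNReal.log_le_log_iff, ENNReal.ofReal_le_ofReal_iff (Real.exp_pos y).le]

lemma lg_lt {x y : ℝ} : lg x < (y : EReal) ↔ x < Real.exp y := by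
  rw [← lg_exp y]
  unfold lg
  rw [ENNReal.log_lt_log_iff, ENNReal.ofReal_lt_ofReal_iff (Real.exp_pos y)]

lemma lg_ne_top (x : ℝ) : lg x ≠ ⊤ := by
  unfold lg
  rw [Ne, ENNReal.log_eq_top_iff]
  exact ENNReal.ofReal_ne_top

lemma lg_cont : Continuous lg := ENNReal.continuous_log.comp ENNReal.continuous_ofReal

lemma lg_max {f : ℂ → ℂ} (hf : Differentiable ℂ f) {N : ℕ} (hN : 0 < N) {c : ℂ} {r : ℝ} (hr : 0 < r) {p : ℂ[X]} {s : ℝ}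
    (h : ∀ z ∈ sphere c r, ‖f z‖ ^ ((1:ℝ)/N) ≤ Real.exp ((p.eval z).re + s)) :
    ∀ z ∈ closedBall c r, ‖f z‖ ^ ((1:ℝ)/N) ≤ Real.exp ((p.eval z).re + s) := by
  have hN' : (0:ℝ) < N := by exact_mod_cast hN
  have heq : ∀ z, ‖f z‖ ^ ((1:ℝ)/N) ≤ Real.exp ((p.eval z).re + s) ↔
      ‖f z * Complex.exp (-(N * (p.eval z + s)))‖ ≤ 1 := by
    intro z
    have h1 : (-((N:ℂ) * (p.eval z + s))).re = -(N * ((p.eval z).re + s)) := by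
      rw [Complex.neg_re, cre]; simp
    rw [norm_mul, Complex.norm_exp, h1, Real.exp_neg, ← div_eq_mul_inv, div_le_one (Real.exp_pos _)]
    rw [one_div, Real.rpow_inv_le_iff_of_pos (norm_nonneg _) (Real.exp_pos _).le hN', Real.rpow_natCast, ← Real.exp_nat_mul]
  have hd : Differentiable ℂ fun z => f z * Complex.exp (-(N * (p.eval z + s))) := by
    have : Differentiable ℂ fun z => p.eval z := p.differentiable
    exact hf.mul (((differentiable_const _).mul (this.add_const _)).neg.cexp)
  intro z hz
  rw [heq]
  refine Complex.norm_le_of_forall_mem_frontier_norm_le (U := ball c r) isBounded_ball hd.diffContOnCl ?_ ?_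
  · intro w hw
    rw [frontier_ball c hr.ne'] at hw
    exact (heq w).1 (h w hw)
  · rwa [closure_ball c hr.ne']

section psh
variable {E : Type*} [NormedAddCommGroup E] [NormedSpace ℂ E]

lemma psh_lg {f : E → ℂ} (hf : Differentiable ℂ f) {N : ℕ} (hN : 0 < N) : PSH fun x => lg (‖f x‖ ^ ((1:ℝ)/N)) := by
  have hc : Continuous fun x => lg (‖f x‖ ^ ((1:ℝ)/N)) :=
    lg_cont.comp (hf.continuous.norm.rpow_const fun x => Or.inr (by positivity))
  refine ⟨hc.upperSemicontinuous, fun x => lg_ne_top _, fun a b => ⟨?_, ?_⟩⟩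
  · have : Continuous fun t : ℂ => lg (‖f (a + t • b)‖ ^ ((1:ℝ)/N)) := hc.comp (f := fun t : ℂ => a + t • b) (by fun_prop)
    exact this.upperSemicontinuous.upperSemicontinuousOn _
  · intro c r hr _ p hp z hz
    simp only [lg_le] at hp ⊢
    have hf' : Differentiable ℂ fun t : ℂ => f (a + t • b) := hf.comp (by fun_prop)
    have := lg_max hf' hN hr (s := 0) (p := p) (by simpa using hp) z hz
    simpa using this

variable (P : ℕ → E → ℂ) (e : ℕ → ℕ) (C : ℝ)

def pQ (K : ℕ) (x : E) : ℝ := ∏ k ∈ Finset.range K, ‖P k x‖ ^ ((1:ℝ)/e k)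
def tau (K : ℕ) : ℝ := 2 * C * (1/2) ^ K
def pW (K : ℕ) (x : E) : ℝ := pQ P e K x * Real.exp (tau C K * (1 + ‖x‖))

lemma pQ_nonneg (K : ℕ) (x : E) : 0 ≤ pQ P e K x := Finset.prod_nonneg fun k _ => by positivity

lemma pQ_rep (hP : ∀ k, Differentiable ℂ (P k)) (he : ∀ k, 0 < e k) (K : ℕ) :
    ∃ f : E → ℂ, Differentiable ℂ f ∧ ∃ N : ℕ, 0 < N ∧ ∀ x, pQ P e K x = ‖f x‖ ^ ((1:ℝ)/N) := by
  induction K with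
  | zero => exact ⟨fun _ => 1, differentiable_const _, 1, one_pos, fun x => by simp [pQ]⟩
  | succ K ih =>
    obtain ⟨f, hf, N, hN, h⟩ := ih
    refine ⟨fun x => f x ^ (e K) * P K x ^ N, (hf.pow _).mul ((hP K).pow _), N * e K, Nat.mul_pos hN (he K), fun x => ?_⟩
    have hN' : (N:ℝ) ≠ 0 := by exact_mod_cast hN.ne'
    have he' : (e K:ℝ) ≠ 0 := by exact_mod_cast (he K).ne'
    unfold pQ at h ⊢
    rw [Finset.prod_range_succ, h x, norm_mul, norm_pow, norm_pow, Real.mul_rpow (by positivity) (by positivity),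
      ← Real.rpow_natCast, ← Real.rpow_natCast, ← Real.rpow_mul (norm_nonneg _), ← Real.rpow_mul (norm_nonneg _)]
    congr 2 <;> push_cast <;> field_simp

lemma tau_succ (K : ℕ) : tau C K = tau C (K+1) + C * (1/2) ^ K := by unfold tau; rw [pow_succ]; ring

lemma tau_nonneg {C : ℝ} (hC : 0 ≤ C) (K : ℕ) : 0 ≤ tau C K := by unfold tau; positivity

lemma tau_tend : Tendsto (tau C) atTop (𝓝 0) := by
  have := (tendsto_pow_atTop_nhds_zero_of_lt_one (r := (1/2:ℝ)) (by norm_num) (by norm_num)).const_mul (2 * C)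
  rw [mul_zero] at this
  exact this

variable {P C} {d : ℕ → ℕ}

lemma fac_le (hd : ∀ k, 0 < d k) (hb : ∀ k x, ‖P k x‖ ≤ Real.exp (d k * C * (1 + ‖x‖))) (k : ℕ) (x : E) :
    ‖P k x‖ ^ ((1:ℝ)/(d k * 2 ^ k : ℕ)) ≤ Real.exp (C * (1/2) ^ k * (1 + ‖x‖)) := by
  have h1 : (0:ℝ) < d k := by exact_mod_cast hd k
  have h2 : (0:ℝ) < (d k * 2 ^ k : ℕ) := by push_cast; positivity
  rw [one_div, Real.rpow_inv_le_iff_of_pos (norm_nonneg _) (Real.exp_pos _).le h2, Real.rpow_natCast, ← Real.exp_nat_mul]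
  refine (hb k x).trans (le_of_eq ?_)
  congr 1
  push_cast
  have : (1/2:ℝ)^k * 2^k = 1 := by rw [← mul_pow]; norm_num
  linear_combination (- (d k:ℝ) * C * (1 + ‖x‖)) * this

/-- monotonicity -/
lemma V_anti (hd : ∀ k, 0 < d k) (hC : 0 ≤ C) (hb : ∀ k x, ‖P k x‖ ≤ Real.exp (d k * C * (1 + ‖x‖))) (x : E) {H : ℝ} (hH : 1 + ‖x‖ ≤ H) :
    Antitone fun K => pQ P (fun k => d k * 2 ^ k) K x * Real.exp (tau C K * H) := by
  refine antitone_nat_of_succ_le fun K => ?_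
  have h0 := pQ_nonneg P (fun k => d k * 2 ^ k) K x
  rw [pQ, Finset.prod_range_succ, ← pQ, mul_assoc]
  refine mul_le_mul_of_nonneg_left ?_ h0
  calc _ ≤ Real.exp (C * (1/2) ^ K * (1 + ‖x‖)) * Real.exp (tau C (K+1) * H) := by
        gcongr; exact fac_le hd hb K x
    _ = Real.exp (C * (1/2) ^ K * (1 + ‖x‖) + tau C (K+1) * H) := (Real.exp_add _ _).symm
    _ ≤ _ := by
        rw [Real.exp_le_exp, tau_succ C K]
        have : C * (1/2)^K * (1 + ‖x‖) ≤ C * (1/2)^K * H := by gcongr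
        linarith

def pU (P : ℕ → E → ℂ) (d : ℕ → ℕ) (C : ℝ) (x : E) : EReal := ⨅ K, lg (pW P (fun k => d k * 2 ^ k) C K x)

lemma pQ_cont (hP : ∀ k, Differentiable ℂ (P k)) (e : ℕ → ℕ) (K : ℕ) : Continuous (pQ P e K) :=
  continuous_finset_prod _ fun k _ => (hP k).continuous.norm.rpow_const fun x => Or.inr (by positivity)

lemma pW_cont (hP : ∀ k, Differentiable ℂ (P k)) (e : ℕ → ℕ) (K : ℕ) : Continuous (pW P e C K) :=
  (pQ_cont hP e K).mul (by fun_prop)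

lemma pU_psh (hP : ∀ k, Differentiable ℂ (P k)) (hd : ∀ k, 0 < d k) (hC : 0 ≤ C)
    (hb : ∀ k x, ‖P k x‖ ≤ Real.exp (d k * C * (1 + ‖x‖))) : PSH (pU P d C) := by
  have husc : UpperSemicontinuous (pU P d C) :=
    upperSemicontinuous_iInf fun K => (lg_cont.comp (pW_cont hP _ K)).upperSemicontinuous
  refine ⟨husc, fun x h => ?_, fun a b => ⟨?_, ?_⟩⟩
  · have : pU P d C x ≤ lg (pW P (fun k => d k * 2 ^ k) C 0 x) := iInf_le _ 0
    rw [h] at this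
    exact lg_ne_top _ (top_le_iff.1 this)
  · exact (UpperSemicontinuous.comp husc (g := fun t : ℂ => a + t • b) (by fun_prop)).upperSemicontinuousOn _
  · intro c r hr _ p hp z hz
    set e : ℕ → ℕ := fun k => d k * 2 ^ k with he'
    have he : ∀ k, 0 < e k := fun k => Nat.mul_pos (hd k) (by positivity)
    set l : ℂ → E := fun t => a + t • b with hl
    have hlc : Continuous l := by fun_prop
    obtain ⟨H, hH⟩ : ∃ H : ℝ, ∀ t ∈ closedBall c r, 1 + ‖l t‖ ≤ H := by
      obtain ⟨H, hH⟩ := (isCompact_closedBall c r).bddAbove_image (f := fun t => 1 + ‖l t‖) (by fun_prop)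
      exact ⟨H, fun t ht => hH ⟨t, ht, rfl⟩⟩
    have hH0 : 0 ≤ H := by
      have := hH c (mem_closedBall_self hr.le)
      linarith [norm_nonneg (l c)]
    set V : ℕ → ℂ → ℝ := fun K t => pQ P e K (l t) * Real.exp (tau C K * H) with hV
    have hVa : ∀ t ∈ closedBall c r, Antitone fun K => V K t := fun t ht => V_anti hd hC hb (l t) (hH t ht)
    have hVc : ∀ K, Continuous (V K) := fun K => ((pQ_cont hP e K).comp hlc).mul continuous_const
    refine EReal.le_of_forall_lt_iff_le.1 fun y hy => ?_
    have hy' : (p.eval z).re < y := by exact_mod_cast hy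
    set ε := y - (p.eval z).re with hε'
    have hε : 0 < ε := by linarith
    have hcov : ∃ K, ∀ t ∈ sphere c r, V K t < Real.exp ((p.eval t).re + ε) := by
      set O : ℕ → Set ℂ := fun K => ⋃ j ∈ Finset.range (K+1), {t | V j t < Real.exp ((p.eval t).re + ε)} with hO
      have hOo : ∀ K, IsOpen (O K) := fun K => isOpen_biUnion fun j _ => isOpen_lt (hVc j) (by
        have := p.continuous
        fun_prop)
      have hmono : Monotone O := by
        intro i j hij
        refine biUnion_subset_biUnion_left fun x hx => ?_
        simp only [Finset.coe_range, Set.mem_Iio] at hx ⊢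
        omega
      have hsub : sphere c r ⊆ ⋃ K, O K := by
        intro t ht
        have h1 := hp t ht
        have h2 : pU P d C (l t) < (((p.eval t).re + ε/2 : ℝ) : EReal) :=
          lt_of_le_of_lt h1 (by exact_mod_cast (by linarith : (p.eval t).re < (p.eval t).re + ε/2))
        obtain ⟨K, hK⟩ := iInf_lt_iff.1 h2
        rw [lg_lt] at hK
        have h3 : Tendsto (fun K => tau C K * H) atTop (𝓝 0) := by
          have := (tau_tend C).mul_const H
          rwa [zero_mul] at this
        obtain ⟨K1, hK1⟩ := ((h3.eventually_lt_const (show (0:ℝ) < ε/2 by positivity)).and (eventually_ge_atTop K)).exists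
        rw [mem_iUnion]
        refine ⟨K1, ?_⟩
        rw [hO, mem_iUnion₂]
        refine ⟨K1, by simp, ?_⟩
        rw [Set.mem_ofPred_eq]
        have h4 := V_anti hd hC hb (l t) le_rfl hK1.2
        have h5 : pQ P e K1 (l t) ≤ pW P e C K1 (l t) := by
          have h6 : 1 ≤ Real.exp (tau C K1 * (1 + ‖l t‖)) := Real.one_le_exp (by have := tau_nonneg hC K1; positivity)
          exact le_mul_of_one_le_right (pQ_nonneg _ _ _ _) h6
        have h7 : pQ P e K1 (l t) < Real.exp ((p.eval t).re + ε/2) := lt_of_le_of_lt (h5.trans h4) hK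
        calc V K1 t = pQ P e K1 (l t) * Real.exp (tau C K1 * H) := rfl
          _ < Real.exp ((p.eval t).re + ε/2) * Real.exp (ε/2) := by
              refine mul_lt_mul'' h7 (Real.exp_lt_exp.2 hK1.1) (pQ_nonneg _ _ _ _) (Real.exp_pos _).le
          _ = _ := by rw [← Real.exp_add]; congr 1; ring
      obtain ⟨K, hK⟩ := (isCompact_sphere c r).elim_directed_cover O hOo hsub (directed_of_isDirected_le hmono)
      refine ⟨K, fun t ht => ?_⟩
      have := hK ht
      rw [hO, mem_iUnion₂] at this
      obtain ⟨j, hj, hj2⟩ := this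
      rw [Set.mem_ofPred_eq] at hj2
      exact lt_of_le_of_lt (hVa t (sphere_subset_closedBall ht) (Nat.lt_succ_iff.1 (Finset.mem_range.1 hj))) hj2
    obtain ⟨K, hK⟩ := hcov
    obtain ⟨f, hf, N, hN, hrep⟩ := pQ_rep P e hP he K
    have hf' : Differentiable ℂ fun t : ℂ => f (l t) := hf.comp (by fun_prop)
    have h8 := lg_max hf' hN hr (s := ε - tau C K * H) (p := p) (by
      intro t ht
      rw [← hrep]
      have := hK t ht
      rw [show (p.eval t).re + (ε - tau C K * H) = ((p.eval t).re + ε) - tau C K * H by ring, Real.exp_sub,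
        le_div_iff₀ (Real.exp_pos _)]
      exact this.le) z hz
    rw [← hrep] at h8
    have h9 : V K z ≤ Real.exp y := by
      have h10 : y = (p.eval z).re + (ε - tau C K * H) + tau C K * H := by rw [hε']; ring
      rw [h10, Real.exp_add]
      exact mul_le_mul_of_nonneg_right h8 (Real.exp_pos _).le
    refine (iInf_le _ K).trans (lg_le.2 (le_trans ?_ h9))
    refine mul_le_mul_of_nonneg_left (Real.exp_le_exp.2 ?_) (pQ_nonneg _ _ _ _)
    exact mul_le_mul_of_nonneg_left (hH z hz) (tau_nonneg hC K)

lemma pU_bot (hd : ∀ k, 0 < d k) (hC : 0 ≤ C)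
    (hb : ∀ k x, ‖P k x‖ ≤ Real.exp (d k * C * (1 + ‖x‖))) {x : E}
    (hx : ∃ᶠ k in atTop, ‖P k x‖ ≤ Real.exp (-(d k * 2 ^ k))) : pU P d C x = ⊥ := by
  set e : ℕ → ℕ := fun k => d k * 2 ^ k with he'
  have hanti : Antitone fun K => pW P e C K x := V_anti hd hC hb x le_rfl
  have h0 : ∀ K, 0 ≤ pW P e C K x := fun K => mul_nonneg (pQ_nonneg _ _ _ _) (Real.exp_pos _).le
  have hbdd : BddBelow (range fun K => pW P e C K x) := ⟨0, by rintro _ ⟨K, rfl⟩; exact h0 K⟩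
  have ht := tendsto_atTop_ciInf hanti hbdd
  set ℓ := ⨅ K, pW P e C K x with hℓ
  have hstep : ∃ᶠ K in atTop, ℓ ≤ Real.exp (-1) * pW P e C K x := by
    refine hx.mono fun k hk => (ciInf_le hbdd (k+1)).trans ?_
    have h1 : (0:ℝ) < d k := by exact_mod_cast hd k
    have h2 : (0:ℝ) < (d k * 2 ^ k : ℕ) := by push_cast; positivity
    have h3 : ‖P k x‖ ^ ((1:ℝ)/e k) ≤ Real.exp (-1) := by
      rw [one_div, Real.rpow_inv_le_iff_of_pos (norm_nonneg _) (Real.exp_pos _).le h2, Real.rpow_natCast, ← Real.exp_nat_mul]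
      refine hk.trans (le_of_eq ?_)
      congr 1
      push_cast; ring
    have h4 : Real.exp (tau C (k+1) * (1 + ‖x‖)) ≤ Real.exp (tau C k * (1 + ‖x‖)) := by
      rw [Real.exp_le_exp, tau_succ C k]
      have : 0 ≤ C * (1/2)^k := by positivity
      gcongr; linarith
    unfold pW
    rw [pQ, Finset.prod_range_succ, ← pQ]
    have h5 := pQ_nonneg P e k x
    calc _ ≤ pQ P e k x * Real.exp (-1) * Real.exp (tau C k * (1 + ‖x‖)) := by gcongr
      _ = _ := by ring
  have hℓ0 : ℓ ≤ 0 := by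
    have h6 : ℓ ≤ Real.exp (-1) * ℓ := by
      by_contra hcon
      push Not at hcon
      have h7 := (ht.const_mul (Real.exp (-1))).eventually_lt_const hcon
      obtain ⟨K, h8, h9⟩ := (hstep.and_eventually h7).exists
      linarith
    have h7 : Real.exp (-1) < 1 := Real.exp_lt_one_iff.2 (by norm_num)
    by_contra hcon
    push Not at hcon
    nlinarith
  by_contra hne
  obtain ⟨y, hy1, hy2⟩ := EReal.lt_iff_exists_real_btwn.1 (bot_lt_iff_ne_bot.2 hne)
  have h7 := ht.eventually_lt_const (lt_of_le_of_lt hℓ0 (Real.exp_pos y))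
  obtain ⟨K, hK⟩ := h7.exists
  have h8 : pU P d C x ≤ lg (pW P e C K x) := iInf_le _ K
  exact absurd (lt_of_lt_of_le hy2 h8) (not_lt.2 (lg_le.2 hK.le))

lemma pU_ge {x : E} (hd : ∀ k, 0 < d k) (hC : 0 ≤ C) {c : ℝ} (hc : 0 ≤ c)
    (hx : ∀ k, Real.exp (-(d k * (c * (3/2)^k))) ≤ ‖P k x‖) : pU P d C x ≠ ⊥ := by
  have key : ((-(4 * c) : ℝ) : EReal) ≤ pU P d C x := by
    refine le_iInf fun K => ?_
    rw [← lg_exp]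
    refine lg_mono ?_
    have h1 : Real.exp (-∑ k ∈ Finset.range K, c * (3/4)^k) ≤ pQ P (fun k => d k * 2 ^ k) K x := by
      rw [← Finset.sum_neg_distrib, Real.exp_sum]
      refine Finset.prod_le_prod (fun _ _ => (Real.exp_pos _).le) fun k _ => ?_
      have h1 : (0:ℝ) < d k := by exact_mod_cast hd k
      have h2 : (0:ℝ) < (d k * 2 ^ k : ℕ) := by push_cast; positivity
      rw [one_div, Real.le_rpow_inv_iff_of_pos (Real.exp_pos _).le (norm_nonneg _) h2, Real.rpow_natCast, ← Real.exp_nat_mul]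
      refine le_trans (le_of_eq ?_) (hx k)
      congr 1
      push_cast
      have : (3/4:ℝ)^k * 2^k = (3/2)^k := by rw [← mul_pow]; norm_num
      linear_combination (-(d k:ℝ) * c) * this
    have h2 : ∑ k ∈ Finset.range K, c * (3/4:ℝ)^k ≤ 4 * c := by
      rw [← Finset.mul_sum]
      have h3 : ∑ k ∈ Finset.range K, (3/4:ℝ)^k ≤ 4 := by
        rw [geom_sum_eq (by norm_num)]
        have : (0:ℝ) ≤ (3/4)^K := by positivity
        rw [div_le_iff_of_neg (by norm_num)]; linarith
      nlinarith
    have h3 : 1 ≤ Real.exp (tau C K * (1 + ‖x‖)) := Real.one_le_exp (by have := tau_nonneg hC K; positivity)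
    calc _ ≤ Real.exp (-∑ k ∈ Finset.range K, c * (3/4)^k) := Real.exp_le_exp.2 (by linarith)
      _ ≤ pQ P (fun k => d k * 2 ^ k) K x := h1
      _ ≤ _ := le_mul_of_one_le_right (pQ_nonneg _ _ _ _) h3
  intro h
  rw [h] at key
  exact EReal.coe_ne_bot _ (le_bot_iff.1 key)

end psh

end Shch

namespace Shch
open Filter Topology MeasureTheory

section jos
variable {E : Type*} [NormedAddCommGroup E] [NormedSpace ℂ E] [FiniteDimensional ℂ E]

lemma cheb [MeasurableSpace E] [BorelSpace E] (μ : Measure E) [μ.IsAddHaarMeasure]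
    {f : E → ℂ} (hf : Differentiable ℂ f) {d : ℕ} (hd : 0 < d) {C R0 lam : ℝ} (hC : 0 ≤ C) (hR0 : 0 ≤ R0) (hlam : 0 < lam)
    (hb : ∀ x, ‖f x‖ ≤ Real.exp (d * C * (1 + ‖x‖))) {a : E} (ha : ‖a‖ ≤ R0) (hfa : 1 ≤ ‖f a‖) :
    μ.real (ball 0 1 ∩ {x | ‖f x‖ < Real.exp (-(d * lam))}) ≤ C * (2 + 2 * R0) * μ.real (ball (0:E) (R0+1)) / lam := by
  have : ProperSpace E := FiniteDimensional.proper ℂ E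
  have : FiniteDimensional ℝ E := FiniteDimensional.complexToReal E
  have hd' : (0:ℝ) < d := by exact_mod_cast hd
  set u : E → EReal := fun x => lg (‖f x‖ ^ ((1:ℝ)/d)) with hu'
  have hu : PSH u := psh_lg hf hd
  set C1 := C * (2 + 2 * R0) with hC1
  have hua0 : ((0:ℝ):EReal) ≤ u a := by
    rw [← lg_exp, Real.exp_zero]
    exact lg_mono (Real.one_le_rpow hfa (by positivity))
  have hua : u a ≠ ⊥ := by
    intro h; rw [h] at hua0; exact EReal.coe_ne_bot _ (le_bot_iff.1 hua0)
  obtain ⟨hi, hle⟩ := psh_vol μ hu hua (R := R0 + 1) (C := C1) (L := lam)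
  have hfin : μ (ball a (R0+1)) ≠ ⊤ := measure_ball_lt_top.ne
  have hi2 : IntegrableOn (fun x => C1 - tr u lam x) (ball a (R0+1)) μ := (integrableOn_const hfin).sub hi
  set B := ball (0:E) 1 ∩ {x | ‖f x‖ < Real.exp (-(d * lam))} with hB
  have hBm : MeasurableSet B :=
    measurableSet_ball.inter (isOpen_lt hf.continuous.norm continuous_const).measurableSet
  have hsub : B ⊆ ball a (R0+1) := by
    intro x hx
    have := mem_ball_zero_iff.1 hx.1
    rw [mem_ball, dist_eq_norm]
    linarith [norm_sub_le x a]
  have hup : ∀ x ∈ ball a (R0+1), u x ≤ (C1 : ℝ) := by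
    intro x hx
    rw [mem_ball, dist_eq_norm] at hx
    have hxn : ‖x‖ ≤ 2 * R0 + 1 := by
      have := norm_add_le (x - a) a
      rw [sub_add_cancel] at this; linarith
    refine lg_le.2 ?_
    rw [one_div, Real.rpow_inv_le_iff_of_pos (norm_nonneg _) (Real.exp_pos _).le hd', Real.rpow_natCast, ← Real.exp_nat_mul]
    refine (hb x).trans (Real.exp_le_exp.2 ?_)
    rw [hC1, mul_assoc]
    have hh : 1 + ‖x‖ ≤ 2 + 2 * R0 := by linarith
    exact mul_le_mul_of_nonneg_left (mul_le_mul_of_nonneg_left hh hC) hd'.le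
  have hC10 : 0 ≤ C1 := by positivity
  have h1 : ∫ x in B, (C1 - tr u lam x) ∂μ ≤ ∫ x in ball a (R0+1), (C1 - tr u lam x) ∂μ := by
    refine setIntegral_mono_set hi2 ?_ (HasSubset.Subset.eventuallyLE hsub)
    refine (ae_restrict_iff' measurableSet_ball).2 (Eventually.of_forall (fun x hx => ?_))
    have := tr_le hu (L := lam) (hup x hx) (by linarith)
    simp only [Pi.zero_apply]; linarith
  have h2 : ∫ x in B, (C1 - tr u lam x) ∂μ = μ.real B * (C1 + lam) := by
    rw [setIntegral_congr_fun (g := fun _ => C1 + lam) hBm, setIntegral_const, smul_eq_mul]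
    intro x hx
    have : tr u lam x = -lam := by
      have h3 : u x ≤ ((-lam : ℝ) : EReal) := by
        refine lg_le.2 ?_
        rw [one_div, Real.rpow_inv_le_iff_of_pos (norm_nonneg _) (Real.exp_pos _).le hd', Real.rpow_natCast, ← Real.exp_nat_mul]
        have := hx.2
        rw [Set.mem_ofPred_eq] at this
        refine this.le.trans (le_of_eq ?_)
        congr 1; ring
      unfold tr; rw [max_eq_right h3]; rfl
    simp only [this]; ring
  have h4 : 0 ≤ (u a).toReal := EReal.toReal_nonneg (by exact_mod_cast hua0)
  have h5 : μ.real (ball a (R0+1)) = μ.real (ball (0:E) (R0+1)) := by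
    unfold Measure.real
    rw [Measure.addHaar_ball_center]
  rw [h5] at hle
  rw [h2] at h1
  have h6 : 0 ≤ μ.real B * C1 := by positivity
  have h7 : 0 ≤ μ.real (ball (0:E) (R0+1)) * (u a).toReal := by positivity
  rw [le_div_iff₀ hlam]
  nlinarith

lemma good_pt {P : ℕ → E → ℂ} {d : ℕ → ℕ} {C R0 : ℝ} (hP : ∀ k, Differentiable ℂ (P k)) (hd : ∀ k, 0 < d k) (hC : 0 ≤ C)
    (hb : ∀ k x, ‖P k x‖ ≤ Real.exp (d k * C * (1 + ‖x‖))) (hR0 : 0 ≤ R0)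
    (hne : ∀ k, ∃ a, ‖a‖ ≤ R0 ∧ 1 ≤ ‖P k a‖) :
    ∃ c : ℝ, 0 ≤ c ∧ ∃ x, ∀ k, Real.exp (-(d k * (c * (3/2)^k))) ≤ ‖P k x‖ := by
  borelize E
  have : FiniteDimensional ℝ E := FiniteDimensional.complexToReal E
  have : ProperSpace E := FiniteDimensional.proper ℂ E
  set μ : Measure E := Measure.addHaar
  set m1 := μ.real (ball (0:E) 1) with hm1
  have hm1p : 0 < m1 := ENNReal.toReal_pos (measure_ball_pos μ 0 one_pos).ne' measure_ball_lt_top.ne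
  set T := C * (2 + 2 * R0) * μ.real (ball (0:E) (R0+1)) with hT
  have hT0 : 0 ≤ T := by positivity
  set c := 4 * T / m1 + 1 with hc
  have hc0 : 0 < c := by positivity
  refine ⟨c, hc0.le, ?_⟩
  by_contra hcon
  push Not at hcon
  set B : ℕ → Set E := fun k => ball (0:E) 1 ∩ {x | ‖P k x‖ < Real.exp (-(d k * (c * (3/2)^k)))} with hB
  have hBle : ∀ k, μ (B k) ≤ ENNReal.ofReal (T / c * (2/3)^k) := by
    intro k
    obtain ⟨a, ha, ha1⟩ := hne k
    have h1 := cheb μ (hP k) (hd k) (lam := c * (3/2)^k) hC hR0 (by positivity) (hb k) ha ha1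
    have h2 : T / (c * (3/2)^k) = T / c * (2/3)^k := by
      have : (2/3:ℝ)^k = ((3/2)^k)⁻¹ := by rw [← inv_pow]; norm_num
      rw [this]; field_simp
    rw [← hT, h2] at h1
    have h3 : μ (B k) ≠ ⊤ := ((measure_mono inter_subset_left).trans_lt measure_ball_lt_top).ne
    exact (ENNReal.le_ofReal_iff_toReal_le h3 (by positivity)).2 h1
  have hsub : ball (0:E) 1 ⊆ ⋃ k, B k := by
    intro x hx
    obtain ⟨k, hk⟩ := hcon x
    exact mem_iUnion.2 ⟨k, hx, hk⟩
  have hsum : Summable fun k : ℕ => T / c * (2/3:ℝ)^k :=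
    (summable_geometric_of_lt_one (by norm_num) (by norm_num)).mul_left _
  have h4 : μ (ball (0:E) 1) ≤ ENNReal.ofReal (T / c * 3) := by
    calc _ ≤ μ (⋃ k, B k) := measure_mono hsub
      _ ≤ ∑' k, μ (B k) := measure_iUnion_le _
      _ ≤ ∑' k, ENNReal.ofReal (T / c * (2/3)^k) := ENNReal.tsum_le_tsum hBle
      _ = ENNReal.ofReal (∑' k, T / c * (2/3:ℝ)^k) := (ENNReal.ofReal_tsum_of_nonneg (fun k => by positivity) hsum).symm
      _ = _ := by
        rw [tsum_mul_left, tsum_geometric_of_lt_one (by norm_num) (by norm_num)]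
        norm_num
  have h5 : m1 ≤ T / c * 3 := ENNReal.toReal_le_of_le_ofReal (by positivity) h4
  rw [div_mul_eq_mul_div, le_div_iff₀ hc0] at h5
  have h6 : m1 * c = 4 * T + m1 := by rw [hc]; field_simp
  linarith

lemma josefson {P : ℕ → E → ℂ} {d : ℕ → ℕ} {C R0 : ℝ} (hP : ∀ k, Differentiable ℂ (P k)) (hd : ∀ k, 0 < d k) (hC : 0 ≤ C)
    (hb : ∀ k x, ‖P k x‖ ≤ Real.exp (d k * C * (1 + ‖x‖))) (hR0 : 0 ≤ R0)
    (hne : ∀ k, ∃ a, ‖a‖ ≤ R0 ∧ 1 ≤ ‖P k a‖) :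
    ∃ u : E → EReal, PSH u ∧ (∃ x, u x ≠ ⊥) ∧
      ∀ x, (∃ᶠ k in atTop, ‖P k x‖ ≤ Real.exp (-(d k * 2 ^ k))) → u x = ⊥ := by
  obtain ⟨c, hc, x, hx⟩ := good_pt hP hd hC hb hR0 hne
  exact ⟨pU P d C, pU_psh hP hd hC hb, ⟨x, pU_ge hd hC hc hx⟩, fun x hx => pU_bot hd hC hb hx⟩

end jos
end Shch

namespace Shch
open Filter Topology

/-- iterated divided differences -/
def dd (ζ : ℕ → ℂ) (g : ℂ → ℂ) : ℕ → ℂ → ℂ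
  | 0 => g
  | j+1 => dslope (dd ζ g j) (ζ j)

lemma dslope_bd {g : ℂ → ℂ} {M : ℝ} (hg : DifferentiableOn ℂ g (ball 0 9)) (hM : ∀ x ∈ ball (0:ℂ) 9, ‖g x‖ ≤ M)
    {s : ℂ} (hs : ‖s‖ ≤ 1) : DifferentiableOn ℂ (dslope g s) (ball 0 9) ∧ ∀ x ∈ ball (0:ℂ) 9, ‖dslope g s x‖ ≤ M / 4 := by
  have hs9 : s ∈ ball (0:ℂ) 9 := mem_ball_zero_iff.2 (by linarith)
  have hM0 : 0 ≤ M := (norm_nonneg _).trans (hM s hs9)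
  refine ⟨(Complex.differentiableOn_dslope (isOpen_ball.mem_nhds hs9)).2 hg, fun x hx => ?_⟩
  have hsub : ball s 8 ⊆ ball (0:ℂ) 9 := ball_subset_ball' (by rw [dist_zero_right]; linarith)
  have h2 : ∀ x ∈ ball (0:ℂ) 9, ‖g x - g s‖ ≤ 2 * M := fun x hx => by
    have := norm_sub_le (g x) (g s); linarith [hM x hx, hM s hs9]
  by_cases hx8 : x ∈ ball s 8
  · have := Complex.norm_dslope_le_div_of_mapsTo_ball (R₂ := 2 * M) (hg.mono hsub) (fun y hy => by
      rw [mem_closedBall, dist_eq_norm]; exact h2 y (hsub hy)) hx8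
    linarith
  · rw [mem_ball, dist_eq_norm, not_lt] at hx8
    have hne : x ≠ s := by rintro rfl; simp at hx8; linarith
    rw [dslope_of_ne _ hne, slope_def_field, norm_div, div_le_iff₀ (by linarith)]
    have := h2 x hx
    nlinarith

lemma dd_bd {ζ : ℕ → ℂ} (hζ : ∀ i, ‖ζ i‖ ≤ 1) {g : ℂ → ℂ} {M : ℝ} (hg : DifferentiableOn ℂ g (ball 0 9))
    (hM : ∀ x ∈ ball (0:ℂ) 9, ‖g x‖ ≤ M) (j : ℕ) :
    DifferentiableOn ℂ (dd ζ g j) (ball 0 9) ∧ ∀ x ∈ ball (0:ℂ) 9, ‖dd ζ g j x‖ ≤ M * (1/4) ^ j := by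
  induction j with
  | zero => exact ⟨hg, by simpa [dd] using hM⟩
  | succ j ih =>
    obtain ⟨h1, h2⟩ := dslope_bd ih.1 ih.2 (hζ j)
    refine ⟨h1, fun x hx => (h2 x hx).trans (le_of_eq ?_)⟩
    rw [pow_succ]; ring

lemma newton (ζ : ℕ → ℂ) (g : ℂ → ℂ) (T : ℕ) (x : ℂ) :
    g x = ∑ j ∈ Finset.range T, (∏ i ∈ Finset.range j, (x - ζ i)) * dd ζ g j (ζ j)
      + (∏ i ∈ Finset.range T, (x - ζ i)) * dd ζ g T x := by
  induction T with
  | zero => simp [dd]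
  | succ T ih =>
    rw [Finset.sum_range_succ, Finset.prod_range_succ]
    have h := sub_smul_dslope (dd ζ g T) (ζ T) x
    rw [smul_eq_mul] at h
    have h2 : dd ζ g (T+1) x = dslope (dd ζ g T) (ζ T) x := rfl
    rw [h2, mul_assoc, h]
    conv_lhs => rw [ih]
    ring

lemma dd_lin {Y : Type*} {ζ : ℕ → ℂ} (hinj : Function.Injective ζ) (Pr : (Y → ℂ) → Prop)
    (hsub : ∀ f g, Pr f → Pr g → Pr (fun y => f y - g y)) (hmul : ∀ f (c : ℂ), Pr f → Pr (fun y => f y / c))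
    (G : Y → ℂ → ℂ) {T : ℕ} (hG : ∀ i < T, Pr fun y => G y (ζ i)) (j : ℕ) :
    ∀ i, j ≤ i → i < T → Pr fun y => dd ζ (G y) j (ζ i) := by
  induction j with
  | zero => exact fun i _ hi => hG i hi
  | succ j ih =>
    intro i hji hi
    have hne : ζ i ≠ ζ j := fun h => by have := hinj h; omega
    have : (fun y => dd ζ (G y) (j+1) (ζ i)) = fun y => (dd ζ (G y) j (ζ i) - dd ζ (G y) j (ζ j)) / (ζ i - ζ j) := by
      funext y
      change dslope (dd ζ (G y) j) (ζ j) (ζ i) = _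
      rw [dslope_of_ne _ hne, slope_def_field]
    rw [this]
    exact hmul _ _ (hsub _ _ (ih i (by omega) hi) (ih j le_rfl (by omega)))

lemma grid {ζ : ℕ → ℂ} (hζ : ∀ i, ‖ζ i‖ ≤ 1) (hinj : Function.Injective ζ) (T : ℕ) : ∀ (n : ℕ) (f : (Fin n → ℂ) → ℂ) (M : ℝ),
    DifferentiableOn ℂ f (ball 0 9) → (∀ y ∈ ball (0 : Fin n → ℂ) 9, ‖f y‖ ≤ M) →
    (∀ g : Fin n → ℕ, (∀ i, g i < T) → f (fun i => ζ (g i)) = 0) →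
    ∀ y ∈ closedBall (0 : Fin n → ℂ) 1, ‖f y‖ ≤ (2 ^ n - 1) * M * (1/2) ^ T := by
  intro n
  induction n with
  | zero =>
    intro f M _ _ h0 y _
    have := h0 (fun i => i.elim0) (fun i => i.elim0)
    rw [Subsingleton.elim y (fun i => ζ ((fun i : Fin 0 => i.elim0) i)), this]
    simp
  | succ n ih =>
    intro f M hf hM h0 y hy
    have hcons : ∀ {ρ : ℝ}, 0 < ρ → ∀ {x : ℂ} {y : Fin n → ℂ}, x ∈ ball (0:ℂ) ρ → y ∈ ball (0 : Fin n → ℂ) ρ →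
        (Fin.cons x y : Fin (n+1) → ℂ) ∈ ball (0 : Fin (n+1) → ℂ) ρ := by
      intro ρ hρ x y hx hy
      rw [mem_ball_zero_iff, pi_norm_lt_iff hρ] at hy ⊢
      rw [mem_ball_zero_iff] at hx
      intro i
      refine Fin.cases ?_ (fun j => ?_) i
      · simpa using hx
      · simpa using hy j
    have hM0 : 0 ≤ M := (norm_nonneg _).trans (hM 0 (mem_ball_self (by norm_num)))
    set G : (Fin n → ℂ) → ℂ → ℂ := fun y x => f (Fin.cons x y) with hGdef
    have hGx : ∀ y ∈ ball (0 : Fin n → ℂ) 9, DifferentiableOn ℂ (G y) (ball 0 9) := by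
      intro y hy
      refine hf.comp (g := f) (f := fun x : ℂ => (Fin.cons x y : Fin (n+1) → ℂ)) ?_ fun x hx => hcons (by norm_num) hx hy
      refine Differentiable.differentiableOn (differentiable_pi.2 fun i => ?_)
      refine Fin.cases ?_ (fun j => ?_) i
      · simp only [Fin.cons_zero]; fun_prop
      · simp only [Fin.cons_succ]; fun_prop
    have hGM : ∀ y ∈ ball (0 : Fin n → ℂ) 9, ∀ x ∈ ball (0:ℂ) 9, ‖G y x‖ ≤ M := fun y hy x hx =>
      hM _ (hcons (by norm_num) hx hy)
    have hz9 : ∀ i, ζ i ∈ ball (0:ℂ) 9 := fun i => mem_ball_zero_iff.2 (by linarith [hζ i])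
    have hGy : ∀ x ∈ ball (0:ℂ) 9, DifferentiableOn ℂ (fun y => G y x) (ball 0 9) := by
      intro x hx
      refine hf.comp (g := f) (f := fun y : Fin n → ℂ => (Fin.cons x y : Fin (n+1) → ℂ)) ?_ fun y hy => hcons (by norm_num) hx hy
      refine Differentiable.differentiableOn (differentiable_pi.2 fun i => ?_)
      refine Fin.cases ?_ (fun j => ?_) i
      · simp only [Fin.cons_zero]; fun_prop
      · simp only [Fin.cons_succ]; fun_prop
    -- divided differences at nodes
    have hF : ∀ j < T, ∀ y ∈ closedBall (0 : Fin n → ℂ) 1,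
        ‖dd ζ (G y) j (ζ j)‖ ≤ (2 ^ n - 1) * (M * (1/4) ^ j) * (1/2) ^ T := by
      intro j hj
      refine ih (fun y => dd ζ (G y) j (ζ j)) (M * (1/4)^j) ?_ ?_ ?_
      · exact dd_lin hinj (fun f : (Fin n → ℂ) → ℂ => DifferentiableOn ℂ f (ball 0 9)) (fun f g hf hg => hf.sub hg)
          (fun f c hf => by simp only [div_eq_mul_inv]; exact hf.mul_const _) G (T := T) (fun i _ => hGy _ (hz9 i)) j j le_rfl hj
      · intro y hy
        exact (dd_bd hζ (hGx y hy) (hGM y hy) j).2 _ (hz9 j)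
      · intro g hg
        refine dd_lin hinj (fun f : (Fin n → ℂ) → ℂ => f (fun i => ζ (g i)) = 0) (fun f g hf hg => by simp [hf, hg])
          (fun f c hf => by simp [hf]) G (T := T) (fun i hi => ?_) j j le_rfl hj
        have := h0 (Fin.cons i g) (fun k => by
          refine Fin.cases ?_ (fun l => ?_) k
          · simpa using hi
          · simpa using hg l)
        simp only [hGdef]
        rw [← this]
        congr 1
        funext k
        refine Fin.cases ?_ (fun l => ?_) k <;> simp
    have hy1 : ∀ i, ‖y i‖ ≤ 1 := by
      rw [mem_closedBall_zero_iff, pi_norm_le_iff_of_nonneg (by norm_num)] at hy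
      exact hy
    set y' : Fin n → ℂ := fun i => y i.succ with hy'
    have hy'1 : y' ∈ closedBall (0 : Fin n → ℂ) 1 := by
      rw [mem_closedBall_zero_iff, pi_norm_le_iff_of_nonneg (by norm_num)]
      exact fun i => hy1 _
    have hy'9 : y' ∈ ball (0 : Fin n → ℂ) 9 := closedBall_subset_ball (by norm_num) hy'1
    have hyc : f y = G y' (y 0) := by
      simp only [hGdef, hy']
      congr 1
      funext k
      refine Fin.cases ?_ (fun l => ?_) k <;> simp
    have hN : ∀ j, ‖∏ i ∈ Finset.range j, (y 0 - ζ i)‖ ≤ 2 ^ j := by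
      intro j
      rw [norm_prod]
      refine (Finset.prod_le_prod (fun _ _ => norm_nonneg _) (g := fun _ => (2:ℝ)) fun i _ => ?_).trans (by simp)
      linarith [norm_sub_le (y 0) (ζ i), hy1 0, hζ i]
    have hn1 : (1:ℝ) ≤ 2 ^ n := one_le_pow₀ (by norm_num)
    rw [hyc, newton ζ (G y') T (y 0)]
    refine (norm_add_le _ _).trans ?_
    have e1 : ‖∑ j ∈ Finset.range T, (∏ i ∈ Finset.range j, (y 0 - ζ i)) * dd ζ (G y') j (ζ j)‖ ≤
        (2 ^ n - 1) * M * (1/2) ^ T * 2 := by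
      refine (norm_sum_le _ _).trans ?_
      have : ∀ j ∈ Finset.range T, ‖(∏ i ∈ Finset.range j, (y 0 - ζ i)) * dd ζ (G y') j (ζ j)‖ ≤
          (2 ^ n - 1) * M * (1/2) ^ T * (1/2) ^ j := by
        intro j hj
        rw [norm_mul]
        refine (mul_le_mul (hN j) (hF j (Finset.mem_range.1 hj) y' hy'1) (norm_nonneg _) (by positivity)).trans (le_of_eq ?_)
        have h4 : (2:ℝ)^j * (1/4)^j = (1/2)^j := by rw [← mul_pow]; norm_num
        linear_combination ((2 ^ n - 1) * M * (1/2) ^ T) * h4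
      refine (Finset.sum_le_sum this).trans ?_
      rw [← Finset.mul_sum]
      have hg : ∑ j ∈ Finset.range T, (1/2:ℝ)^j ≤ 2 := by
        rw [geom_sum_eq (by norm_num)]
        have : (0:ℝ) ≤ (1/2)^T := by positivity
        rw [div_le_iff_of_neg (by norm_num)]; linarith
      refine mul_le_mul_of_nonneg_left hg ?_
      have : (0:ℝ) ≤ 2 ^ n - 1 := by linarith
      positivity
    have e2 : ‖(∏ i ∈ Finset.range T, (y 0 - ζ i)) * dd ζ (G y') T (y 0)‖ ≤ M * (1/2)^T := by
      rw [norm_mul]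
      refine (mul_le_mul (hN T) ((dd_bd hζ (hGx y' hy'9) (hGM y' hy'9) T).2 (y 0) (mem_ball_zero_iff.2 (by linarith [hy1 0])))
        (norm_nonneg _) (by positivity)).trans (le_of_eq ?_)
      have h4 : (2:ℝ)^T * (1/4)^T = (1/2)^T := by rw [← mul_pow]; norm_num
      linear_combination M * h4
    refine (add_le_add e1 e2).trans (le_of_eq ?_)
    rw [pow_succ]; ring

end Shch

namespace Shch
open Filter Topology

/-- polynomial with all partial degrees `< d` -/
def MP {N d : ℕ} (b : (Fin N → Fin d) → ℂ) (x : Fin N → ℂ) : ℂ :=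
  ∑ β : Fin N → Fin d, b β * ∏ i, x i ^ (β i : ℕ)

theorem MP_diff {N d : ℕ} (b : (Fin N → Fin d) → ℂ) : Differentiable ℂ (MP b) := by
  unfold MP
  fun_prop

theorem geom_root {d : ℕ} {ω : ℂ} (hω : IsPrimitiveRoot ω d) (p q : Fin d) :
    ∑ g : Fin d, (ω ^ (p:ℕ) * (ω ^ (q:ℕ))⁻¹) ^ (g:ℕ) = if p = q then (d:ℂ) else 0 := by
  have hd : d ≠ 0 := by rintro rfl; exact p.elim0
  have h0 : ω ≠ 0 := hω.ne_zero hd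
  split_ifs with h
  · subst h
    rw [mul_inv_cancel₀ (pow_ne_zero _ h0)]; simp
  · have h1 : ω ^ (p:ℕ) * (ω ^ (q:ℕ))⁻¹ ≠ 1 := by
      intro h2
      rw [mul_inv_eq_one₀ (pow_ne_zero _ h0)] at h2
      exact h (Fin.ext (hω.pow_inj p.2 q.2 h2))
    rw [Fin.sum_univ_eq_sum_range (fun g => (ω ^ (p:ℕ) * (ω ^ (q:ℕ))⁻¹) ^ g) d, geom_sum_eq h1]
    have : (ω ^ (p:ℕ) * (ω ^ (q:ℕ))⁻¹) ^ d = 1 := by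
      rw [mul_pow, inv_pow, ← pow_mul, ← pow_mul, mul_comm (p:ℕ), mul_comm (q:ℕ), pow_mul, pow_mul, hω.pow_eq_one]
      simp
    rw [this]; simp

theorem MP_lower {N d : ℕ} (b : (Fin N → Fin d) → ℂ) (hd : 0 < d) {β : Fin N → Fin d} (hβ : 1 ≤ ‖b β‖) :
    ∃ x, ‖x‖ ≤ 1 ∧ 1 ≤ ‖MP b x‖ := by
  classical
  obtain ⟨ω, hω⟩ : ∃ ω : ℂ, IsPrimitiveRoot ω d := ⟨_, Complex.isPrimitiveRoot_exp d hd.ne'⟩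
  have hn : ‖ω‖ = 1 := hω.norm'_eq_one hd.ne'
  by_contra hcon
  push Not at hcon
  have hx : ∀ γ : Fin N → Fin d, ‖MP b (fun i => ω ^ (γ i : ℕ))‖ < 1 := fun γ => by
    refine hcon _ ((pi_norm_le_iff_of_nonneg zero_le_one).2 fun i => by simp [hn])
  have key : ∑ γ : Fin N → Fin d, MP b (fun i => ω ^ (γ i : ℕ)) * ∏ i, ((ω ^ (β i : ℕ))⁻¹) ^ (γ i : ℕ)
      = (d:ℂ) ^ N * b β := by
    unfold MP
    simp only [Finset.sum_mul]
    rw [Finset.sum_comm]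
    have : ∀ β' : Fin N → Fin d, ∑ γ : Fin N → Fin d, b β' * (∏ i, (ω ^ (γ i : ℕ)) ^ (β' i : ℕ)) *
        ∏ i, ((ω ^ (β i : ℕ))⁻¹) ^ (γ i : ℕ) = if β' = β then (d:ℂ)^N * b β else 0 := by
      intro β'
      have e1 : ∀ γ : Fin N → Fin d, b β' * (∏ i, (ω ^ (γ i : ℕ)) ^ (β' i : ℕ)) *
        ∏ i, ((ω ^ (β i : ℕ))⁻¹) ^ (γ i : ℕ) = b β' * ∏ i, (ω ^ (β' i : ℕ) * (ω ^ (β i : ℕ))⁻¹) ^ (γ i : ℕ) := by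
        intro γ
        rw [mul_assoc, ← Finset.prod_mul_distrib]
        congr 1
        refine Finset.prod_congr rfl fun i _ => ?_
        rw [mul_pow, ← pow_mul, ← pow_mul, mul_comm (γ i : ℕ)]
      simp only [e1]
      rw [← Finset.mul_sum]
      have e2 := Finset.prod_univ_sum (fun _ : Fin N => (Finset.univ : Finset (Fin d)))
        (fun i (g : Fin d) => (ω ^ (β' i : ℕ) * (ω ^ (β i : ℕ))⁻¹) ^ (g : ℕ))
      rw [Fintype.piFinset_univ] at e2
      rw [← e2]
      simp only [geom_root hω]
      split_ifs with h
      · subst h; simp [mul_comm]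
      · obtain ⟨i, hi⟩ := Function.ne_iff.1 h
        rw [Finset.prod_eq_zero (Finset.mem_univ i) (by simp [hi])]; simp
    simp only [this]
    simp
  have hne : (Finset.univ : Finset (Fin N → Fin d)).Nonempty := ⟨β, Finset.mem_univ _⟩
  have h1 : ‖∑ γ : Fin N → Fin d, MP b (fun i => ω ^ (γ i : ℕ)) * ∏ i, ((ω ^ (β i : ℕ))⁻¹) ^ (γ i : ℕ)‖
      < (d:ℝ) ^ N := by
    calc _ ≤ ∑ γ : Fin N → Fin d, ‖MP b (fun i => ω ^ (γ i : ℕ)) * ∏ i, ((ω ^ (β i : ℕ))⁻¹) ^ (γ i : ℕ)‖ :=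
          norm_sum_le _ _
      _ = ∑ γ : Fin N → Fin d, ‖MP b (fun i => ω ^ (γ i : ℕ))‖ := by
          refine Finset.sum_congr rfl fun γ _ => ?_
          rw [norm_mul, norm_prod]; simp [hn]
      _ < ∑ γ : Fin N → Fin d, (1:ℝ) := Finset.sum_lt_sum_of_nonempty hne fun γ _ => hx γ
      _ = _ := by simp
  rw [key, norm_mul, norm_pow, Complex.norm_natCast] at h1
  have : 0 < (d:ℝ)^N := by positivity
  nlinarith

theorem MP_upper {N d : ℕ} (b : (Fin N → Fin d) → ℂ) (hb : ∀ β, ‖b β‖ ≤ 1) (x : Fin N → ℂ) :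
    ‖MP b x‖ ≤ Real.exp (d * N * (1 + ‖x‖)) := by
  have h1 : ∀ β : Fin N → Fin d, ‖b β * ∏ i, x i ^ (β i : ℕ)‖ ≤ Real.exp (d * N * ‖x‖) := by
    intro β
    rw [norm_mul, norm_prod]
    calc ‖b β‖ * ∏ i, ‖x i ^ (β i : ℕ)‖ ≤ 1 * ∏ _i : Fin N, Real.exp (d * ‖x‖) := by
          refine mul_le_mul (hb β) (Finset.prod_le_prod (fun _ _ => norm_nonneg _) fun i _ => ?_) (Finset.prod_nonneg fun _ _ => norm_nonneg _) zero_le_one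
          rw [norm_pow]
          calc ‖x i‖ ^ (β i : ℕ) ≤ (1 + ‖x‖) ^ (β i : ℕ) :=
                pow_le_pow_left₀ (norm_nonneg _) (by linarith [norm_le_pi_norm x i]) _
            _ ≤ (1 + ‖x‖) ^ d := pow_le_pow_right₀ (by linarith [norm_nonneg x]) (β i).2.le
            _ ≤ (Real.exp ‖x‖) ^ d := pow_le_pow_left₀ (by positivity) (by linarith [Real.add_one_le_exp ‖x‖]) _
            _ = _ := (Real.exp_nat_mul _ _).symm
      _ = _ := by
          rw [one_mul, Finset.prod_const, Finset.card_univ, Fintype.card_fin, ← Real.exp_nat_mul]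
          congr 1; ring
  calc ‖MP b x‖ ≤ ∑ β : Fin N → Fin d, Real.exp (d * N * ‖x‖) := norm_sum_le_of_le _ fun β _ => h1 β
    _ = (d:ℝ)^N * Real.exp (d * N * ‖x‖) := by simp
    _ ≤ (Real.exp d) ^ N * Real.exp (d * N * ‖x‖) := by
        refine mul_le_mul_of_nonneg_right (pow_le_pow_left₀ (by positivity) (by linarith [Real.add_one_le_exp (d:ℝ)]) _) (Real.exp_pos _).le
    _ = _ := by rw [← Real.exp_nat_mul, ← Real.exp_add]; congr 1; ring

/-- coefficients of the reduction of `w ^ j` modulo the polynomial -/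
def cc (m : ℕ) (A : ℕ → ℂ) : ℕ → ℕ → ℂ
  | 0, l => if l = 0 then 1 else 0
  | j+1, l => (if l = 0 then 0 else cc m A j (l-1)) - cc m A j (m-1) * A l

theorem cc_pow {m : ℕ} (hm : 0 < m) {A : ℕ → ℂ} {w : ℂ} (hw : w ^ m + ∑ l ∈ Finset.range m, A l * w ^ l = 0) (j : ℕ) :
    w ^ j = ∑ l ∈ Finset.range m, cc m A j l * w ^ l := by
  obtain ⟨m, rfl⟩ := Nat.exists_eq_succ_of_ne_zero hm.ne'
  induction j with
  | zero => simp [cc]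
  | succ j ih =>
    have e : ∀ l, cc (m+1) A (j+1) l * w ^ l = (if l = 0 then 0 else cc (m+1) A j (l-1)) * w^l
        - cc (m+1) A j m * (A l * w ^ l) := by
      intro l; simp only [cc, Nat.add_sub_cancel]; ring
    simp only [Nat.succ_eq_add_one, e, Finset.sum_sub_distrib, ← Finset.mul_sum] at *
    rw [Finset.sum_range_succ' (fun l => (if l = 0 then 0 else cc (m+1) A j (l-1)) * w^l), 
      eq_neg_of_add_eq_zero_right hw, pow_succ, ih, Finset.sum_range_succ, add_mul, Finset.sum_mul]
    simp only [Nat.add_eq_zero_iff, one_ne_zero, and_false, if_false, Nat.add_sub_cancel, if_true]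
    have : ∀ l, cc (m+1) A j l * w ^ l * w = cc (m+1) A j l * w ^ (l+1) := fun l => by ring
    simp only [this]
    ring

theorem cc_bd {m : ℕ} {A : ℕ → ℂ} {K : ℝ} (hK : ∀ l, ‖A l‖ ≤ K) (j l : ℕ) : ‖cc m A j l‖ ≤ (1 + K) ^ j := by
  have hK0 : 0 ≤ K := (norm_nonneg _).trans (hK 0)
  induction j generalizing l with
  | zero => simp only [cc]; split_ifs <;> simp
  | succ j ih =>
    simp only [cc]
    have h1 : ‖(if l = 0 then 0 else cc m A j (l-1))‖ ≤ (1+K)^j := by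
      split_ifs
      · simp; positivity
      · exact ih _
    calc _ ≤ ‖(if l = 0 then 0 else cc m A j (l-1))‖ + ‖cc m A j (m-1)‖ * ‖A l‖ := by
          rw [← norm_mul]; exact norm_sub_le _ _
      _ ≤ (1+K)^j + (1+K)^j * K := add_le_add h1 (mul_le_mul (ih _) (hK l) (norm_nonneg _) (by positivity))
      _ = _ := by ring

theorem cc_diff {E : Type*} [NormedAddCommGroup E] [NormedSpace ℂ E] {m : ℕ} {A : E → ℕ → ℂ} {S : Set E}
    (hA : ∀ l, DifferentiableOn ℂ (fun z => A z l) S) (j l : ℕ) :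
    DifferentiableOn ℂ (fun z => cc m (A z) j l) S := by
  induction j generalizing l with
  | zero => simp only [cc]; exact differentiableOn_const _
  | succ j ih =>
    simp only [cc]
    refine DifferentiableOn.sub ?_ ((ih _).mul (hA l))
    split_ifs
    · exact differentiableOn_const _
    · exact ih _

theorem root_bd {m : ℕ} (hm : 0 < m) {A : ℕ → ℂ} {K : ℝ} (hK : ∀ l, ‖A l‖ ≤ K) {w : ℂ}
    (hw : w ^ m + ∑ l ∈ Finset.range m, A l * w ^ l = 0) : ‖w‖ ≤ 1 + m * K := by
  have hK0 : 0 ≤ K := (norm_nonneg _).trans (hK 0)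
  by_cases h1 : ‖w‖ ≤ 1
  · have : 0 ≤ m * K := by positivity
    linarith
  push Not at h1
  have h2 : ‖w‖ ^ m ≤ m * K * ‖w‖ ^ (m-1) := by
    rw [← norm_pow, eq_neg_of_add_eq_zero_left hw, norm_neg]
    calc _ ≤ ∑ l ∈ Finset.range m, K * ‖w‖^(m-1) := by
          refine norm_sum_le_of_le _ fun l hl => ?_
          rw [norm_mul, norm_pow]
          refine mul_le_mul (hK l) (pow_le_pow_right₀ h1.le (by have := Finset.mem_range.1 hl; omega)) (by positivity) hK0
      _ = _ := by simp; ring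
  have h3 : ‖w‖ ^ m = ‖w‖ * ‖w‖^(m-1) := by rw [← pow_succ']; congr 1; omega
  rw [h3] at h2
  have := le_of_mul_le_mul_right h2 (by positivity)
  linarith

/-- reduced coefficients -/
def RR {n d : ℕ} (m : ℕ) (A : (Fin n → ℂ) → ℕ → ℂ) (b : (Fin (n+1) → Fin d) → ℂ) (l : ℕ) (z : Fin n → ℂ) : ℂ :=
  ∑ β : Fin (n+1) → Fin d, b β * ((∏ i : Fin n, z i ^ (β i.castSucc : ℕ)) * cc m (A z) (β (Fin.last n)) l)

theorem RR_MP {n d m : ℕ} (hm : 0 < m) {A : (Fin n → ℂ) → ℕ → ℂ} (b : (Fin (n+1) → Fin d) → ℂ) {z : Fin n → ℂ} {w : ℂ}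
    (hw : w ^ m + ∑ l ∈ Finset.range m, A z l * w ^ l = 0) :
    MP b (Fin.snoc z w) = ∑ l ∈ Finset.range m, RR m A b l z * w ^ l := by
  unfold MP RR
  simp only [Finset.sum_mul]
  rw [Finset.sum_comm]
  refine Finset.sum_congr rfl fun β _ => ?_
  rw [Fin.prod_univ_castSucc]
  simp only [Fin.snoc_castSucc, Fin.snoc_last]
  rw [cc_pow hm hw, Finset.mul_sum, Finset.mul_sum]
  refine Finset.sum_congr rfl fun l _ => ?_
  ring

theorem RR_diff {n d m : ℕ} {A : (Fin n → ℂ) → ℕ → ℂ} (b : (Fin (n+1) → Fin d) → ℂ) {S : Set (Fin n → ℂ)}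
    (hA : ∀ l, DifferentiableOn ℂ (fun z => A z l) S) (l : ℕ) : DifferentiableOn ℂ (RR m A b l) S := by
  unfold RR
  refine DifferentiableOn.fun_sum fun β _ => ?_
  refine (differentiableOn_const _).mul (DifferentiableOn.mul ?_ (cc_diff hA _ _))
  exact Differentiable.differentiableOn (by fun_prop)

theorem RR_bd {n d m : ℕ} {A : (Fin n → ℂ) → ℕ → ℂ} (b : (Fin (n+1) → Fin d) → ℂ) (hb : ∀ β, ‖b β‖ ≤ 1)
    {z : Fin n → ℂ} {K Z : ℝ} (hK : ∀ l, ‖A z l‖ ≤ K) (hz : ‖z‖ ≤ Z) (l : ℕ) :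
    ‖RR m A b l z‖ ≤ Real.exp (d * ((n+1) + n * Z + K)) := by
  have hK0 : 0 ≤ K := (norm_nonneg _).trans (hK 0)
  have hZ0 : 0 ≤ Z := (norm_nonneg _).trans hz
  have gen : ∀ {t T : ℝ} (j : Fin d), 0 ≤ t → t ≤ 1 + T → 0 ≤ T → t ^ (j:ℕ) ≤ Real.exp (d * T) := by
    intro t T j h0 h1 h2
    calc t ^ (j:ℕ) ≤ (1+T)^(j:ℕ) := pow_le_pow_left₀ h0 h1 _
      _ ≤ (1+T)^d := pow_le_pow_right₀ (by linarith) j.2.le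
      _ ≤ (Real.exp T)^d := pow_le_pow_left₀ (by linarith) (by linarith [Real.add_one_le_exp T]) _
      _ = _ := (Real.exp_nat_mul _ _).symm
  have h1 : ∀ β : Fin (n+1) → Fin d,
      ‖b β * ((∏ i : Fin n, z i ^ (β i.castSucc : ℕ)) * cc m (A z) (β (Fin.last n)) l)‖ ≤ Real.exp (d * (n * Z + K)) := by
    intro β
    rw [norm_mul, norm_mul, norm_prod]
    calc _ ≤ 1 * ((∏ _i : Fin n, Real.exp (d * Z)) * Real.exp (d * K)) := by
          refine mul_le_mul (hb β) (mul_le_mul (Finset.prod_le_prod (fun _ _ => norm_nonneg _) fun i _ => ?_) ?_ (norm_nonneg _) (by positivity)) (by positivity) zero_le_one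
          · rw [norm_pow]
            exact gen _ (norm_nonneg _) (by linarith [norm_le_pi_norm z i]) hZ0
          · exact (cc_bd hK _ _).trans (gen _ (by linarith) le_rfl hK0)
      _ = _ := by
          rw [one_mul, Finset.prod_const, Finset.card_univ, Fintype.card_fin, ← Real.exp_nat_mul, ← Real.exp_add]
          congr 1; ring
  calc ‖RR m A b l z‖ ≤ ∑ β : Fin (n+1) → Fin d, Real.exp (d * (n * Z + K)) := norm_sum_le_of_le _ fun β _ => h1 β
    _ = (d:ℝ)^(n+1) * Real.exp (d * (n * Z + K)) := by simp
    _ ≤ (Real.exp d) ^ (n+1) * Real.exp (d * (n * Z + K)) := by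
        refine mul_le_mul_of_nonneg_right (pow_le_pow_left₀ (by positivity) (by linarith [Real.add_one_le_exp (d:ℝ)]) _) (Real.exp_pos _).le
    _ = _ := by rw [← Real.exp_nat_mul, ← Real.exp_add]; congr 1; push_cast; ring

/-- Siegel type lemma by dimension count. -/
theorem siegel {n d m T : ℕ} (A : (Fin n → ℂ) → ℕ → ℂ) (p : (Fin n → ℕ) → (Fin n → ℂ)) (h : m * T ^ n < d ^ (n+1)) :
    ∃ b : (Fin (n+1) → Fin d) → ℂ, (∀ β, ‖b β‖ ≤ 1) ∧ (∃ β, 1 ≤ ‖b β‖) ∧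
      ∀ l < m, ∀ g : Fin n → ℕ, (∀ i, g i < T) → RR m A b l (p g) = 0 := by
  classical
  let L : ((Fin (n+1) → Fin d) → ℂ) →ₗ[ℂ] ((Fin m × (Fin n → Fin T)) → ℂ) :=
    { toFun := fun b q => RR m A b q.1 (p fun i => q.2 i)
      map_add' := fun b b' => by
        funext q; simp only [RR, Pi.add_apply, add_mul, Finset.sum_add_distrib]
      map_smul' := fun c b => by
        funext q; simp only [RR, Pi.smul_apply, smul_eq_mul, Finset.mul_sum, mul_assoc, RingHom.id_apply] }
  have hk : LinearMap.ker L ≠ ⊥ := LinearMap.ker_ne_bot_of_finrank_lt (by simpa using h)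
  obtain ⟨b, hb, hb0⟩ := (Submodule.ne_bot_iff _).1 hk
  have hn : 0 < ‖b‖ := norm_pos_iff.2 hb0
  have hne : Nonempty (Fin (n+1) → Fin d) := by
    by_contra hc
    rw [not_nonempty_iff] at hc
    exact hb0 (Subsingleton.elim _ _)
  obtain ⟨β, hβ⟩ := Finite.exists_max (fun β => ‖b β‖)
  have hβ' : ‖b‖ ≤ ‖b β‖ := (pi_norm_le_iff_of_nonneg (norm_nonneg _)).2 hβ
  refine ⟨((‖b‖ : ℂ)⁻¹) • b, fun β' => ?_, ⟨β, ?_⟩, fun l hl g hg => ?_⟩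
  · simp only [Pi.smul_apply, norm_smul, norm_inv, Complex.norm_real, norm_norm]
    rw [inv_mul_le_iff₀ hn, mul_one]; exact norm_le_pi_norm b β'
  · simp only [Pi.smul_apply, norm_smul, norm_inv, Complex.norm_real, norm_norm]
    rw [le_inv_mul_iff₀ hn, mul_one]; exact hβ'
  · have h1 : L (((‖b‖ : ℂ)⁻¹) • b) = 0 := by
      rw [map_smul, LinearMap.mem_ker.1 hb, smul_zero]
    exact congrFun h1 (⟨l, hl⟩, fun i => ⟨g i, hg i⟩)

theorem local_approx {n m : ℕ} (hm : 0 < m) {D : Set (Fin n → ℂ)} (hD : IsOpen D) {A : (Fin n → ℂ) → ℕ → ℂ}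
    (hA : ∀ l, DifferentiableOn ℂ (fun z => A z l) D) (hA0 : ∀ z l, m ≤ l → A z l = 0) {z0 : Fin n → ℂ} (hz0 : z0 ∈ D) :
    ∃ r > 0, ∀ κ : ℝ, ∃ (d : ℕ) (P : (Fin (n+1) → ℂ) → ℂ), 0 < d ∧ Differentiable ℂ P ∧
      (∀ x, ‖P x‖ ≤ Real.exp (d * (n+1) * (1 + ‖x‖))) ∧ (∃ a, ‖a‖ ≤ 1 ∧ 1 ≤ ‖P a‖) ∧
      ∀ z ∈ ball z0 r, ∀ w, w ^ m + ∑ l ∈ Finset.range m, A z l * w ^ l = 0 → 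
        ‖P (Fin.snoc z w)‖ ≤ Real.exp (-(d * κ)) := by
  obtain ⟨ε, hε, hball⟩ := Metric.isOpen_iff.1 hD z0 hz0
  set r : ℝ := ε / 10 with hr
  have hr0 : 0 < r := by positivity
  have hcb : closedBall z0 (9 * r) ⊆ D := (closedBall_subset_ball (by rw [hr]; linarith)).trans hball
  -- bound for A
  have hex : ∀ l : ℕ, ∃ K : ℝ, ∀ z ∈ closedBall z0 (9*r), ‖A z l‖ ≤ K := fun l =>
    (isCompact_closedBall z0 (9*r)).exists_bound_of_continuousOn ((hA l).continuousOn.mono hcb)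
  choose K0 hK0 using hex
  set K : ℝ := ∑ l ∈ Finset.range m, |K0 l| with hKd
  have hKn : 0 ≤ K := Finset.sum_nonneg fun _ _ => abs_nonneg _
  have hK : ∀ z ∈ closedBall z0 (9*r), ∀ l, ‖A z l‖ ≤ K := by
    intro z hz l
    by_cases hl : l < m
    · exact (hK0 l z hz).trans ((le_abs_self _).trans
        (Finset.single_le_sum (f := fun l => |K0 l|) (fun _ _ => abs_nonneg _) (Finset.mem_range.2 hl)))
    · rw [hA0 z l (not_lt.1 hl)]; simpa using hKn
  set Z : ℝ := ‖z0‖ + 9 * r with hZ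
  set C2 : ℝ := (n+1) + n * Z + K with hC2
  set C3 : ℝ := m * (2^n * (1 + m * K) ^ m) with hC3
  have hC30 : 0 ≤ C3 := by positivity
  refine ⟨r, hr0, fun κ => ?_⟩
  obtain ⟨k, hk⟩ := exists_nat_ge (2 * (κ + C2 + C3))
  set d : ℕ := m * k ^ n + 1 with hd
  set ζ : ℕ → ℂ := fun i => 1 / ((i:ℂ) + 1) with hζd
  have hζ : ∀ i, ‖ζ i‖ ≤ 1 := by
    intro i
    have : ‖(i:ℂ) + 1‖ = (i:ℝ) + 1 := by
      have := Complex.norm_natCast (i+1)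
      push_cast at this; exact this
    simp only [hζd, norm_div, norm_one, this]
    rw [div_le_one (by positivity)]
    have : (0:ℝ) ≤ i := by positivity
    linarith
  have hinj : Function.Injective ζ := by
    intro i j hij
    simp only [hζd, one_div, inv_inj, add_left_inj, Nat.cast_inj] at hij
    exact hij
  have hcount : m * (k * d) ^ n < d ^ (n+1) := by
    rw [mul_pow, ← mul_assoc, pow_succ, mul_comm (d^n)]
    exact Nat.mul_lt_mul_of_pos_right (by omega) (by positivity)
  obtain ⟨b, hb1, ⟨β, hβ⟩, hv⟩ := siegel A (fun g => z0 + (r:ℂ) • (fun i => ζ (g i))) hcount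
  refine ⟨d, MP b, by omega, MP_diff b, fun x => ?_, MP_lower b (by omega) hβ, ?_⟩
  · have := MP_upper b hb1 x
    push_cast at this ⊢
    exact this
  intro z hz w hw
  have hzc : z ∈ closedBall z0 (9*r) := closedBall_subset_closedBall (by linarith) (ball_subset_closedBall hz)
  rw [RR_MP hm b hw]
  have hwb := root_bd hm (hK z hzc) hw
  have hRl : ∀ l < m, ‖RR m A b l z‖ ≤ 2 ^ n * Real.exp (d * C2) * (1/2)^(k*d) := by
    intro l hl
    have hmap : ∀ y ∈ ball (0 : Fin n → ℂ) 9, z0 + (r:ℂ) • y ∈ closedBall z0 (9*r) := by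
      intro y hy
      rw [mem_ball_zero_iff] at hy
      rw [mem_closedBall, dist_self_add_left, norm_smul, Complex.norm_real, Real.norm_of_nonneg hr0.le]
      nlinarith
    have hg := grid hζ hinj (k*d) n (fun y => RR m A b l (z0 + (r:ℂ) • y)) (Real.exp (d * C2)) (by
        refine (RR_diff b hA l).comp (f := fun y : Fin n → ℂ => z0 + (r:ℂ) • y) (Differentiable.differentiableOn (by fun_prop))
          (fun y hy => hcb (hmap y hy))) (by
        intro y hy
        refine RR_bd b hb1 (hK _ (hmap y hy)) ?_ l
        have := mem_closedBall_iff_norm.1 (hmap y hy)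
        have h2 := norm_sub_norm_le (z0 + (r:ℂ) • y) z0
        linarith) (fun g hg => hv l hl g hg)
    have h := hg ((r:ℂ)⁻¹ • (z - z0)) (by
      rw [mem_closedBall_zero_iff, norm_smul, norm_inv, Complex.norm_real, Real.norm_of_nonneg hr0.le, inv_mul_le_iff₀ hr0, mul_one]
      exact (mem_ball_iff_norm.1 hz).le)
    have e : z0 + (r:ℂ) • ((r:ℂ)⁻¹ • (z - z0)) = z := by
      rw [smul_smul, mul_inv_cancel₀ (by exact_mod_cast hr0.ne'), one_smul]; abel
    simp only [e] at h
    refine h.trans ?_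
    refine mul_le_mul_of_nonneg_right (mul_le_mul_of_nonneg_right (by linarith) (Real.exp_pos _).le) (by positivity)
  have hW : ∀ l < m, ‖w‖ ^ l ≤ (1 + m * K) ^ m := by
    intro l hl
    have h1 : 1 ≤ 1 + m * K := by have : 0 ≤ m * K := by positivity
                                  linarith
    exact (pow_le_pow_left₀ (norm_nonneg _) hwb l).trans (pow_le_pow_right₀ h1 hl.le)
  have hd1 : (1:ℝ) ≤ d := by exact_mod_cast (show 1 ≤ d by omega)
  have hhalf : ((1/2:ℝ))^(k*d) ≤ Real.exp (-(k * d / 2)) := by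
    calc ((1/2:ℝ))^(k*d) ≤ (Real.exp (-(1/2)))^(k*d) :=
          pow_le_pow_left₀ (by norm_num) (by linarith [Real.add_one_le_exp (-(1/2):ℝ)]) _
      _ = _ := by rw [← Real.exp_nat_mul]; congr 1; push_cast; ring
  calc ‖∑ l ∈ Finset.range m, RR m A b l z * w ^ l‖ 
      ≤ ∑ l ∈ Finset.range m, 2 ^ n * Real.exp (d * C2) * (1/2)^(k*d) * (1 + m * K) ^ m := by
        refine norm_sum_le_of_le _ fun l hl => ?_
        rw [norm_mul, norm_pow]
        have hl' := Finset.mem_range.1 hl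
        exact mul_le_mul (hRl l hl') (hW l hl') (by positivity) (by positivity)
    _ = C3 * (Real.exp (d * C2) * (1/2)^(k*d)) := by simp [hC3]; ring
    _ ≤ Real.exp (d * C3) * (Real.exp (d * C2) * Real.exp (-(k * d / 2))) := by
        refine mul_le_mul ?_ (mul_le_mul_of_nonneg_left hhalf (Real.exp_pos _).le) (by positivity) (Real.exp_pos _).le
        have := Real.add_one_le_exp (d * C3)
        nlinarith
    _ ≤ Real.exp (-(d * κ)) := by
        rw [← Real.exp_add, ← Real.exp_add]
        refine Real.exp_le_exp.2 ?_
        nlinarith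

end Shch

namespace Shch
open Filter Topology

theorem backward {n m : ℕ} (hm : 0 < m) {D : Set (Fin n → ℂ)} (hD : IsOpen D) (hne : D.Nonempty)
    (a : Fin m → (Fin n → ℂ) → ℂ) (ha : ∀ i, DifferentiableOn ℂ (a i) D) :
    ∃ u : (Fin (n+1) → ℂ) → EReal, PSH u ∧ (∃ x, u x ≠ ⊥) ∧ ∀ z ∈ D, ∀ w : ℂ,
      w ^ m + ∑ i : Fin m, a i z * w ^ (m - ((i : ℕ) + 1)) = 0 → u (Fin.snoc z w) = ⊥ := by
  classical
  set A : (Fin n → ℂ) → ℕ → ℂ := fun z l => if h : l < m then a (Fin.rev ⟨l, h⟩) z else 0 with hAd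
  have hA : ∀ l, DifferentiableOn ℂ (fun z => A z l) D := by
    intro l
    by_cases h : l < m
    · simp only [hAd, h, dif_pos]; exact ha _
    · simp only [hAd, h, dif_neg, not_false_eq_true]; exact differentiableOn_const _
  have hA0 : ∀ z l, m ≤ l → A z l = 0 := fun z l h => dif_neg (not_lt.2 h)
  have hsum : ∀ z w, ∑ i : Fin m, a i z * w ^ (m - ((i : ℕ) + 1)) = ∑ l ∈ Finset.range m, A z l * w ^ l := by
    intro z w
    rw [Finset.sum_range, ← Equiv.sum_comp Fin.revPerm]
    refine Finset.sum_congr rfl fun i _ => ?_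
    have h1 : m - ((Fin.rev i : ℕ) + 1) = i := by rw [Fin.val_rev]; omega
    simp only [Fin.revPerm_apply, h1, hAd, i.2, dif_pos]
  have hloc : ∀ z0 : D, _ := fun z0 => local_approx hm hD hA hA0 z0.2
  choose r hr hP using hloc
  -- countable subcover
  obtain ⟨s, hsc, hs⟩ := TopologicalSpace.isOpen_iUnion_countable (fun z0 : D => ball (z0 : Fin n → ℂ) (r z0)) (fun _ => isOpen_ball)
  have hcov : ∀ z ∈ D, ∃ z0 ∈ s, z ∈ ball (z0 : Fin n → ℂ) (r z0) := by
    intro z hz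
    have : z ∈ ⋃ z0 : D, ball (z0 : Fin n → ℂ) (r z0) := mem_iUnion.2 ⟨⟨z, hz⟩, mem_ball_self (hr _)⟩
    rw [← hs] at this
    simpa using this
  have hsne : s.Nonempty := by
    obtain ⟨z, hz⟩ := hne
    obtain ⟨z0, h, _⟩ := hcov z hz
    exact ⟨z0, h⟩
  obtain ⟨e, he⟩ := hsc.exists_eq_range hsne
  choose d P hd hPd hPb hPl hPs using fun k : ℕ => hP (e (Nat.unpair k).1) (2^k)
  obtain ⟨u, hu, hx, hub⟩ := josefson (P := P) (d := d) (C := (n:ℝ)+1) (R0 := 1) hPd hd (by positivity) hPb zero_le_one hPl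
  refine ⟨u, hu, hx, fun z hz w hw => hub _ ?_⟩
  obtain ⟨z0, hz0, hzb⟩ := hcov z hz
  rw [he] at hz0
  obtain ⟨j, rfl⟩ := hz0
  rw [frequently_atTop]
  intro N
  refine ⟨Nat.pair j N, Nat.right_le_pair _ _, ?_⟩
  rw [hsum] at hw
  exact hPs (Nat.pair j N) z (by rw [Nat.unpair_pair]; exact hzb) w hw

end Shch

/-- **Theorem (Shcherbina).** For continuous `a₁, …, a_m` on a domain `D ⊆ ℂⁿ`, the set
`𝓔 = {(z,w) ∈ D × ℂ : wᵐ + a₁(z)w^{m-1} + ⋯ + a_m(z) = 0}` is pluripolar in `ℂ^{n+1}`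
iff `a₁, …, a_m` are holomorphic on `D`. -/
theorem graphs_of_multifunctions_pluripolar_iff_holomorphic
    {n m : ℕ} (hm : 0 < m) (D : Set (Fin n → ℂ))
    (hDopen : IsOpen D) (hDconn : IsConnected D)
    (a : Fin m → (Fin n → ℂ) → ℂ) (ha : ∀ i, ContinuousOn (a i) D) :
    Pluripolar {p : Fin (n + 1) → ℂ | ∃ z ∈ D, ∃ w : ℂ, p = Fin.snoc z w ∧
        w ^ m + ∑ i : Fin m, a i z * w ^ (m - ((i : ℕ) + 1)) = 0} ↔
      ∀ i, DifferentiableOn ℂ (a i) D := by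
  constructor
  · rintro ⟨u, hu, hne, hub⟩ i
    push Not at hne
    obtain ⟨e, he⟩ := hne
    refine Shch.forward D hDopen a ha (u := u) hu he (fun z hz w hw => hub _ ⟨z, hz, w, rfl, ?_⟩) i
    rw [Shch.PP_eval] at hw
    exact hw
  · intro h
    obtain ⟨u, hu, ⟨x, hx⟩, hub⟩ := Shch.backward hm hDopen hDconn.nonempty a h
    refine ⟨u, hu, fun hc => hx (hc x), ?_⟩
    rintro p ⟨z, hz, w, rfl, hw⟩
    exact hub z hz w hw
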